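/- Finite-time blowup for IPM with a smooth compactly supported source: there exist an initial datum ρ₀ ∈ C_c^∞(ℝ²), a source F : ℝ² × [0,1) → ℝ such that each F(·,t) is C^∞ and supported in the closed unit ball and sup_{t∈[0,1)} ‖F(·,t)‖_{C^k} < ∞ for every k ∈ ℕ, and functions ρ : ℝ² × [0,1) → ℝ, u : ℝ² × [0,1) → ℝ², P : ℝ² × [0,1) → ℝ, all smooth on ℝ² × [0,1), such that: ρ(·,0) = ρ₀; for every t ∈ [0,1) the function ρ(·,t) is compactly supported and u(·,t) is square integrable; the quadruple (ρ,u,P,F) satisfies the IPM system on ℝ² × [0,1); and ‖ρ(·,t)‖_{C¹} → ∞ as t → 1⁻. -/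

import Mathlib

open MeasureTheory Real Filter

/-- First spatial partial derivative `∂/∂x₁`. -/
noncomputable def pd1 (f : ℝ × ℝ → ℝ) : ℝ × ℝ → ℝ := fun x => fderiv ℝ f x (1, 0)

/-- Second spatial partial derivative `∂/∂x₂`. -/
noncomputable def pd2 (f : ℝ × ℝ → ℝ) : ℝ × ℝ → ℝ := fun x => fderiv ℝ f x (0, 1)

/-- Mixed partial derivative `∂₁^i ∂₂^j f`. -/
noncomputable def pdMix (i j : ℕ) (f : ℝ × ℝ → ℝ) : ℝ × ℝ → ℝ := pd1^[i] (pd2^[j] f)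

/-- The `C^k` norm: supremum of the absolute values of all partial derivatives
of order at most `k`. -/
noncomputable def CkNorm (k : ℕ) (f : ℝ × ℝ → ℝ) : ℝ :=
  sSup {y : ℝ | ∃ i j : ℕ, ∃ x : ℝ × ℝ, i + j ≤ k ∧ y = |pdMix i j f x|}

/-- The space-time domain `ℝ² × [0,1)`. -/
def spaceTime : Set ((ℝ × ℝ) × ℝ) := Set.univ ×ˢ Set.Ico (0 : ℝ) 1

namespace IPM

open scoped ContDiff Topology

/-- Derivative of `f` in the constant direction `v`. -/
noncomputable def dir {E : Type*} [NormedAddCommGroup E] [NormedSpace ℝ E] (v : E) (f : E → ℝ) :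
    E → ℝ := fun p => fderiv ℝ f p v

section dir
variable {E : Type*} [NormedAddCommGroup E] [NormedSpace ℝ E] {f g : E → ℝ} {v w : E}

theorem contDiff_dir (hf : ContDiff ℝ ∞ f) (v : E) : ContDiff ℝ ∞ (dir v f) :=
  (hf.fderiv_right (m := ∞) (by simp)).clm_apply contDiff_const

theorem differentiable_of_smooth (hf : ContDiff ℝ ∞ f) : Differentiable ℝ f :=
  hf.differentiable (by simp)

theorem dir_add (hf : ContDiff ℝ ∞ f) (hg : ContDiff ℝ ∞ g) (v : E) :
    dir v (fun p => f p + g p) = fun p => dir v f p + dir v g p := by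
  funext p
  simp only [dir]
  rw [fderiv_fun_add (differentiable_of_smooth hf p) (differentiable_of_smooth hg p)]
  rfl

theorem dir_neg (f : E → ℝ) (v : E) : dir v (fun p => -f p) = fun p => -dir v f p := by
  funext p
  simp only [dir]
  rw [fderiv_fun_neg]
  rfl

theorem dir_mul (hf : ContDiff ℝ ∞ f) (hg : ContDiff ℝ ∞ g) (v : E) :
    dir v (fun p => f p * g p) = fun p => f p * dir v g p + g p * dir v f p := by
  funext p
  simp only [dir]
  rw [fderiv_fun_mul (differentiable_of_smooth hf p) (differentiable_of_smooth hg p)]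
  simp

theorem dir_const (c : ℝ) (v : E) : dir v (fun _ : E => c) = fun _ => 0 := by
  funext p
  simp [dir]

theorem dir_const_mul (hf : ContDiff ℝ ∞ f) (c : ℝ) (v : E) :
    dir v (fun p => c * f p) = fun p => c * dir v f p := by
  rw [dir_mul contDiff_const hf, dir_const]
  simp

theorem dir_comm (hf : ContDiff ℝ ∞ f) (v w : E) : dir v (dir w f) = dir w (dir v f) := by
  funext p
  have hd : DifferentiableAt ℝ (fderiv ℝ f) p :=
    (hf.fderiv_right (m := ∞) (by simp)).differentiable (by simp) p
  have hs : IsSymmSndFDerivAt ℝ f p :=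
    hf.contDiffAt.isSymmSndFDerivAt (by simpa using WithTop.coe_le_coe.2 (le_top : (2:ℕ∞) ≤ ⊤))
  have key : ∀ a b : E, dir a (dir b f) p = fderiv ℝ (fderiv ℝ f) p a b := by
    intro a b
    change fderiv ℝ (fun y => fderiv ℝ f y b) p a = _
    rw [fderiv_clm_apply hd (differentiableAt_const b)]
    simp
  rw [key, key]
  exact hs.eq v w

theorem dir_congr {p : E} (h : f =ᶠ[𝓝 p] g) (v : E) : dir v f =ᶠ[𝓝 p] dir v g := by
  filter_upwards [h.fderiv (𝕜 := ℝ)] with q hq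
  simp [dir, hq]

theorem dir_comp {F : Type*} [NormedAddCommGroup F] [NormedSpace ℝ F] {W : F → ℝ} {L : E → F}
    {p : E} {L' : F} (hW : ContDiff ℝ ∞ W) (hL : DifferentiableAt ℝ L p)
    (h : fderiv ℝ L p v = L') : dir v (fun q => W (L q)) p = dir L' W (L p) := by
  simp only [dir]
  rw [← h]
  have := fderiv_comp (𝕜 := ℝ) p (g := W) (f := L) (differentiable_of_smooth hW _) hL
  change fderiv ℝ (W ∘ L) p v = _
  rw [this]
  rfl

theorem dir_vec_add (a b : E) (f : E → ℝ) (p : E) : dir (a + b) f p = dir a f p + dir b f p := by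
  simp [dir]

theorem dir_vec_smul (c : ℝ) (a : E) (f : E → ℝ) (p : E) : dir (c • a) f p = c * dir a f p := by
  simp [dir]

end dir

/-- Space-time points `(x, t)`. -/
abbrev ST := (ℝ × ℝ) × ℝ

noncomputable abbrev dx (f : ST → ℝ) : ST → ℝ := dir ((1, 0), 0) f
noncomputable abbrev dy (f : ST → ℝ) : ST → ℝ := dir ((0, 1), 0) f
noncomputable abbrev dt (f : ST → ℝ) : ST → ℝ := dir ((0, 0), 1) f

section slice
variable {f : ST → ℝ}

theorem contDiff_slice (hf : ContDiff ℝ ∞ f) (t : ℝ) : ContDiff ℝ ∞ (fun x => f (x, t)) :=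
  hf.comp (contDiff_prodMk_left t)

theorem fderiv_slice (hf : ContDiff ℝ ∞ f) (t : ℝ) (x v : ℝ × ℝ) :
    fderiv ℝ (fun x => f (x, t)) x v = fderiv ℝ f (x, t) (v, 0) := by
  have h1 : HasFDerivAt (fun x : ℝ × ℝ => (x, t)) (ContinuousLinearMap.inl ℝ (ℝ × ℝ) ℝ) x :=
    hasFDerivAt_prodMk_left x t
  have h2 := ((differentiable_of_smooth hf (x, t)).hasFDerivAt).comp x h1
  have h3 := h2.fderiv
  change fderiv ℝ (f ∘ fun x => (x, t)) x v = _
  rw [h3]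
  simp

theorem pd1_slice (hf : ContDiff ℝ ∞ f) (t : ℝ) :
    pd1 (fun x => f (x, t)) = fun x => dx f (x, t) := by
  funext x
  exact fderiv_slice hf t x (1, 0)

theorem pd2_slice (hf : ContDiff ℝ ∞ f) (t : ℝ) :
    pd2 (fun x => f (x, t)) = fun x => dy f (x, t) := by
  funext x
  exact fderiv_slice hf t x (0, 1)

theorem contDiff_dx_iterate (hf : ContDiff ℝ ∞ f) (i : ℕ) : ContDiff ℝ ∞ (dx^[i] f) := by
  induction i with
  | zero => exact hf
  | succ i ih => rw [Function.iterate_succ_apply']; exact contDiff_dir ih _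

theorem contDiff_dy_iterate (hf : ContDiff ℝ ∞ f) (i : ℕ) : ContDiff ℝ ∞ (dy^[i] f) := by
  induction i with
  | zero => exact hf
  | succ i ih => rw [Function.iterate_succ_apply']; exact contDiff_dir ih _

theorem pdMix_slice (hf : ContDiff ℝ ∞ f) (i j : ℕ) (t : ℝ) :
    pdMix i j (fun x => f (x, t)) = fun x => (dx^[i] (dy^[j] f)) (x, t) := by
  have h2 : ∀ j, pd2^[j] (fun x => f (x, t)) = fun x => (dy^[j] f) (x, t) := by
    intro j
    induction j with
    | zero => rfl
    | succ j ih =>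
      rw [Function.iterate_succ_apply', ih, pd2_slice (contDiff_dy_iterate hf j),
        Function.iterate_succ_apply']
  unfold pdMix
  rw [h2]
  induction i with
  | zero => rfl
  | succ i ih =>
    rw [Function.iterate_succ_apply', ih,
      pd1_slice (contDiff_dx_iterate (contDiff_dy_iterate hf j) i), Function.iterate_succ_apply']

end slice

/-- The density, the two velocity components and the source generated by a potential `φ`;
the pressure is `∂₂φ`. -/
noncomputable def rho (φ : ST → ℝ) : ST → ℝ := fun p => -(dx (dx φ) p + dy (dy φ) p)
noncomputable def vel1 (φ : ST → ℝ) : ST → ℝ := fun p => -dx (dy φ) p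
noncomputable def vel2 (φ : ST → ℝ) : ST → ℝ := dx (dx φ)
noncomputable def force (φ : ST → ℝ) : ST → ℝ := fun p =>
  dt (rho φ) p + vel1 φ p * dx (rho φ) p + vel2 φ p * dy (rho φ) p

section potential
variable {φ ψ : ST → ℝ}

theorem contDiff_rho (h : ContDiff ℝ ∞ φ) : ContDiff ℝ ∞ (rho φ) :=
  ((contDiff_dir (contDiff_dir h _) _).add (contDiff_dir (contDiff_dir h _) _)).neg

theorem contDiff_vel1 (h : ContDiff ℝ ∞ φ) : ContDiff ℝ ∞ (vel1 φ) :=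
  (contDiff_dir (contDiff_dir h _) _).neg

theorem contDiff_vel2 (h : ContDiff ℝ ∞ φ) : ContDiff ℝ ∞ (vel2 φ) :=
  contDiff_dir (contDiff_dir h _) _

theorem contDiff_force (h : ContDiff ℝ ∞ φ) : ContDiff ℝ ∞ (force φ) :=
  ((contDiff_dir (contDiff_rho h) _).add
    ((contDiff_vel1 h).mul (contDiff_dir (contDiff_rho h) _))).add
    ((contDiff_vel2 h).mul (contDiff_dir (contDiff_rho h) _))

theorem rho_add (h : ContDiff ℝ ∞ φ) (h' : ContDiff ℝ ∞ ψ) :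
    rho (fun p => φ p + ψ p) = fun p => rho φ p + rho ψ p := by
  funext p
  simp only [rho, dx, dy]
  rw [dir_add h h', dir_add h h', dir_add (contDiff_dir h _) (contDiff_dir h' _),
    dir_add (contDiff_dir h _) (contDiff_dir h' _)]
  ring

theorem vel1_add (h : ContDiff ℝ ∞ φ) (h' : ContDiff ℝ ∞ ψ) :
    vel1 (fun p => φ p + ψ p) = fun p => vel1 φ p + vel1 ψ p := by
  funext p
  simp only [vel1, dx, dy]
  rw [dir_add h h', dir_add (contDiff_dir h _) (contDiff_dir h' _)]
  ring

theorem vel2_add (h : ContDiff ℝ ∞ φ) (h' : ContDiff ℝ ∞ ψ) :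
    vel2 (fun p => φ p + ψ p) = fun p => vel2 φ p + vel2 ψ p := by
  funext p
  simp only [vel2, dx]
  rw [dir_add h h', dir_add (contDiff_dir h _) (contDiff_dir h' _)]

theorem force_add (h : ContDiff ℝ ∞ φ) (h' : ContDiff ℝ ∞ ψ) (p : ST) :
    force (fun p => φ p + ψ p) p = force φ p +
      (dt (rho ψ) p + (vel1 φ p * dx (rho ψ) p + vel2 φ p * dy (rho ψ) p)
        + (vel1 ψ p * dx (rho φ) p + vel2 ψ p * dy (rho φ) p)
        + (vel1 ψ p * dx (rho ψ) p + vel2 ψ p * dy (rho ψ) p)) := by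
  simp only [force]
  rw [rho_add h h', vel1_add h h', vel2_add h h']
  simp only [dx, dy, dt]
  rw [dir_add (contDiff_rho h) (contDiff_rho h'), dir_add (contDiff_rho h) (contDiff_rho h'),
    dir_add (contDiff_rho h) (contDiff_rho h')]
  ring

theorem rho_congr {p : ST} (h : φ =ᶠ[𝓝 p] ψ) : rho φ =ᶠ[𝓝 p] rho ψ := by
  filter_upwards [dir_congr (dir_congr h ((1, 0), 0)) ((1, 0), 0),
    dir_congr (dir_congr h ((0, 1), 0)) ((0, 1), 0)] with q h1 h2
  simp only [rho, dx, dy, h1, h2]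

theorem vel1_congr {p : ST} (h : φ =ᶠ[𝓝 p] ψ) : vel1 φ =ᶠ[𝓝 p] vel1 ψ := by
  filter_upwards [dir_congr (dir_congr h ((0, 1), 0)) ((1, 0), 0)] with q h1
  simp only [vel1, dx, dy, h1]

theorem vel2_congr {p : ST} (h : φ =ᶠ[𝓝 p] ψ) : vel2 φ =ᶠ[𝓝 p] vel2 ψ :=
  dir_congr (dir_congr h ((1, 0), 0)) ((1, 0), 0)

theorem force_congr {p : ST} (h : φ =ᶠ[𝓝 p] ψ) : force φ =ᶠ[𝓝 p] force ψ := by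
  filter_upwards [dir_congr (rho_congr h) ((0, 0), 1), dir_congr (rho_congr h) ((1, 0), 0),
    dir_congr (rho_congr h) ((0, 1), 0), vel1_congr h, vel2_congr h] with q h1 h2 h3 h4 h5
  simp only [force, dx, dy, dt, h1, h2, h3, h4, h5]

theorem dir_zero_fun {E : Type*} [NormedAddCommGroup E] [NormedSpace ℝ E] (v : E) :
    dir v (fun _ : E => (0 : ℝ)) = fun _ => 0 := dir_const 0 v

theorem rho_zero : rho (fun _ => 0) = fun _ => 0 := by
  funext p; simp [rho, dx, dy, dir_const]

theorem force_zero : force (fun _ => 0) = fun _ => 0 := by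
  funext p; simp [force, rho_zero, dx, dy, dt, dir_const]

end potential

theorem rho_eq_zero_of_eventually {φ : ST → ℝ} {p : ST} (h : φ =ᶠ[𝓝 p] fun _ => 0) :
    rho φ p = 0 := by
  rw [(rho_congr h).eq_of_nhds, rho_zero]

theorem isClosed_disc : IsClosed {x : ℝ × ℝ | x.1 ^ 2 + x.2 ^ 2 ≤ 1} :=
  isClosed_le (by fun_prop) continuous_const

theorem isCompact_disc : IsCompact {x : ℝ × ℝ | x.1 ^ 2 + x.2 ^ 2 ≤ 1} := by
  refine (isCompact_Icc (a := ((-1, -1) : ℝ × ℝ)) (b := (1, 1))).of_isClosed_subset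
    isClosed_disc ?_
  intro x hx
  have hx : x.1 ^ 2 + x.2 ^ 2 ≤ 1 := hx
  simp only [Set.mem_Icc, Prod.le_def]
  refine ⟨⟨?_, ?_⟩, ?_, ?_⟩ <;> nlinarith [sq_nonneg x.1, sq_nonneg x.2]

theorem hasCompactSupport_pd1 {f : ℝ × ℝ → ℝ} (h : HasCompactSupport f) :
    HasCompactSupport (pd1 f) := by
  refine (h.fderiv (𝕜 := ℝ)).mono fun x hx => ?_
  simp only [Function.mem_support, pd1] at hx ⊢
  intro h0
  simp [h0] at hx

theorem hasCompactSupport_pd2 {f : ℝ × ℝ → ℝ} (h : HasCompactSupport f) :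
    HasCompactSupport (pd2 f) := by
  refine (h.fderiv (𝕜 := ℝ)).mono fun x hx => ?_
  simp only [Function.mem_support, pd2] at hx ⊢
  intro h0
  simp [h0] at hx

theorem bddAbove_CkNorm_one {f : ℝ × ℝ → ℝ} (hf : ContDiff ℝ ∞ f) (hc : HasCompactSupport f) :
    BddAbove {y : ℝ | ∃ i j : ℕ, ∃ x : ℝ × ℝ, i + j ≤ 1 ∧ y = |pdMix i j f x|} := by
  have h1 : Continuous (pd1 f) := (contDiff_dir hf ((1, 0) : ℝ × ℝ)).continuous
  have h2 : Continuous (pd2 f) := (contDiff_dir hf ((0, 1) : ℝ × ℝ)).continuous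
  obtain ⟨M0, hM0⟩ := hc.exists_bound_of_continuous hf.continuous
  obtain ⟨M1, hM1⟩ := (hasCompactSupport_pd1 hc).exists_bound_of_continuous h1
  obtain ⟨M2, hM2⟩ := (hasCompactSupport_pd2 hc).exists_bound_of_continuous h2
  simp only [Real.norm_eq_abs] at hM0 hM1 hM2
  refine ⟨max M0 (max M1 M2), ?_⟩
  rintro y ⟨i, j, x, hij, rfl⟩
  have : (i = 0 ∧ j = 0) ∨ (i = 1 ∧ j = 0) ∨ (i = 0 ∧ j = 1) := by omega
  rcases this with ⟨rfl, rfl⟩ | ⟨rfl, rfl⟩ | ⟨rfl, rfl⟩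
  · exact (hM0 x).trans (le_max_left _ _)
  · exact (hM1 x).trans ((le_max_left _ _).trans (le_max_right _ _))
  · exact (hM2 x).trans ((le_max_right _ _).trans (le_max_right _ _))

theorem spaceTime_uniqueDiffOn : UniqueDiffOn ℝ spaceTime :=
  uniqueDiffOn_univ.prod (uniqueDiffOn_Ico 0 1)

theorem blowup_of_chain (φ : ℕ → ST → ℝ) (T : ℕ → ℝ)
    (hφ : ∀ n, ContDiff ℝ ∞ (φ n)) (hTm : Monotone T) (hT1 : Tendsto T atTop (𝓝 1))
    (hTlt : ∀ n, T n < 1)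
    (hst : ∀ n x t, t ≤ T n → φ (n + 1) (x, t) = φ n (x, t))
    (hsupp : ∀ n (x : ℝ × ℝ) t, t ≤ 1 → 1 < x.1 ^ 2 + x.2 ^ 2 → φ n (x, t) = 0)
    (hF : ∀ i j, ∃ M, ∀ n, ∀ t ∈ Set.Ico (0 : ℝ) 1, ∀ x,
      |(dx^[i] (dy^[j] (force (φ n)))) (x, t)| ≤ M)
    (hG : ∀ B : ℝ, ∀ᶠ n in atTop, ∀ t ∈ Set.Ico (T n) 1, ∃ x,
      B ≤ |dy (rho (φ (n + 1))) (x, t)|) :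
    ∃ (ρ₀ : ℝ × ℝ → ℝ) (ρ P F : (ℝ × ℝ) × ℝ → ℝ) (u : (ℝ × ℝ) × ℝ → ℝ × ℝ),
      ContDiff ℝ (⊤ : ℕ∞) ρ₀ ∧ HasCompactSupport ρ₀ ∧
      (∀ t ∈ Set.Ico (0 : ℝ) 1, ContDiff ℝ (⊤ : ℕ∞) (fun x => F (x, t))) ∧
      (∀ t ∈ Set.Ico (0 : ℝ) 1, ∀ x : ℝ × ℝ, F (x, t) ≠ 0 → x.1 ^ 2 + x.2 ^ 2 ≤ 1) ∧
      (∀ k : ℕ, ∃ M : ℝ, ∀ t ∈ Set.Ico (0 : ℝ) 1, CkNorm k (fun x => F (x, t)) ≤ M) ∧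
      ContDiffOn ℝ (⊤ : ℕ∞) ρ spaceTime ∧ ContDiffOn ℝ (⊤ : ℕ∞) u spaceTime ∧
      ContDiffOn ℝ (⊤ : ℕ∞) P spaceTime ∧
      (∀ x : ℝ × ℝ, ρ (x, 0) = ρ₀ x) ∧
      (∀ t ∈ Set.Ico (0 : ℝ) 1, HasCompactSupport (fun x => ρ (x, t))) ∧
      (∀ t ∈ Set.Ico (0 : ℝ) 1, Integrable (fun x : ℝ × ℝ => ‖u (x, t)‖ ^ 2)) ∧
      (∀ x : ℝ × ℝ, ∀ t ∈ Set.Ico (0 : ℝ) 1,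
        fderivWithin ℝ ρ spaceTime (x, t) ((0, 0), 1)
            + (u (x, t)).1 * fderivWithin ℝ ρ spaceTime (x, t) ((1, 0), 0)
            + (u (x, t)).2 * fderivWithin ℝ ρ spaceTime (x, t) ((0, 1), 0) = F (x, t) ∧
        (u (x, t)).1 = -fderivWithin ℝ P spaceTime (x, t) ((1, 0), 0) ∧
        (u (x, t)).2 = -fderivWithin ℝ P spaceTime (x, t) ((0, 1), 0) - ρ (x, t) ∧
        (fderivWithin ℝ u spaceTime (x, t) ((1, 0), 0)).1
            + (fderivWithin ℝ u spaceTime (x, t) ((0, 1), 0)).2 = 0) ∧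
      Tendsto (fun t => CkNorm 1 (fun x => ρ (x, t)))
        (nhdsWithin (1 : ℝ) (Set.Iio 1)) atTop := by
  classical
  have hex : ∀ t : ℝ, t < 1 → ∃ n, t < T n := fun t ht =>
    (hT1.eventually (lt_mem_nhds ht)).exists
  let N : ℝ → ℕ := fun t => if h : t < 1 then Nat.find (hex t h) else 0
  have hNspec : ∀ t, t < 1 → t < T (N t) := by
    intro t h
    simp only [N, dif_pos h]
    exact Nat.find_spec (hex t h)
  have hNle : ∀ t n, t < T n → N t ≤ n := by
    intro t n h
    simp only [N, dif_pos (h.trans (hTlt n))]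
    exact Nat.find_le h
  have hstab : ∀ m k x t, t ≤ T m → φ (m + k) (x, t) = φ m (x, t) := by
    intro m k x t h
    induction k with
    | zero => rfl
    | succ k ih => rw [← ih, ← add_assoc]; exact hst _ _ _ (h.trans (hTm (Nat.le_add_right _ _)))
  let Φ : ST → ℝ := fun p => φ (N p.2) p
  have hΦ : ∀ n x t, t < T n → Φ =ᶠ[𝓝 (x, t)] φ n := by
    intro n x t h
    have : ∀ᶠ p : ST in 𝓝 (x, t), p.2 < T n := continuous_snd.continuousAt.eventually
      (gt_mem_nhds h)
    filter_upwards [this] with p hp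
    obtain ⟨k, hk⟩ := Nat.exists_eq_add_of_le (hNle _ _ hp)
    change φ (N p.2) p = φ n p
    rw [hk]
    exact (hstab _ k p.1 p.2 (hNspec _ (hp.trans (hTlt n))).le).symm
  have hloc : ∀ x t, t < 1 → ∃ n, t < T n ∧ Φ =ᶠ[𝓝 (x, t)] φ n := fun x t h =>
    ⟨N t, hNspec t h, hΦ _ _ _ (hNspec t h)⟩
  have hrho : ∀ t n, t < T n → (fun x => rho Φ (x, t)) = fun x => rho (φ n) (x, t) := by
    intro t n h
    funext x
    exact (rho_congr (hΦ n x t h)).eq_of_nhds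
  have hforce : ∀ t n, t < T n → (fun x => force Φ (x, t)) = fun x => force (φ n) (x, t) := by
    intro t n h
    funext x
    exact (force_congr (hΦ n x t h)).eq_of_nhds
  have hout : ∀ n (x : ℝ × ℝ) t, t < 1 → 1 < x.1 ^ 2 + x.2 ^ 2 →
      φ n =ᶠ[𝓝 (x, t)] fun _ => 0 := by
    intro n x t ht hx
    have h1 : ∀ᶠ p : ST in 𝓝 (x, t), p.2 < 1 :=
      continuous_snd.continuousAt.eventually (gt_mem_nhds ht)
    have hc : Continuous fun p : ST => p.1.1 ^ 2 + p.1.2 ^ 2 := by fun_prop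
    have h2 : ∀ᶠ p : ST in 𝓝 (x, t), 1 < p.1.1 ^ 2 + p.1.2 ^ 2 :=
      hc.continuousAt.eventually (lt_mem_nhds hx)
    filter_upwards [h1, h2] with p hp1 hp2
    exact hsupp n p.1 p.2 hp1.le hp2
  have hcsupp : ∀ t, t < 1 → HasCompactSupport (fun x => rho Φ (x, t)) := by
    intro t ht
    rw [hrho t _ (hNspec t ht)]
    refine HasCompactSupport.intro isCompact_disc fun x hx => ?_
    exact rho_eq_zero_of_eventually (hout _ x t ht (not_le.1 hx))
  have hsm : ∀ t, t < 1 → ContDiff ℝ ∞ (fun x => rho Φ (x, t)) := by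
    intro t ht
    rw [hrho t _ (hNspec t ht)]
    exact contDiff_slice (contDiff_rho (hφ _)) t
  have hlt : ∀ p ∈ spaceTime, p.2 < 1 := fun p hp => hp.2.2
  have srho : ∀ x t, t < 1 → ContDiffAt ℝ ∞ (rho Φ) (x, t) := by
    intro x t ht
    obtain ⟨n, -, h⟩ := hloc x t ht
    exact (contDiff_rho (hφ n)).contDiffAt.congr_of_eventuallyEq (rho_congr h)
  have sP : ∀ x t, t < 1 → ContDiffAt ℝ ∞ (dy Φ) (x, t) := by
    intro x t ht
    obtain ⟨n, -, h⟩ := hloc x t ht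
    exact (contDiff_dir (hφ n) _).contDiffAt.congr_of_eventuallyEq (dir_congr h _)
  have s1 : ∀ x t, t < 1 → ContDiffAt ℝ ∞ (vel1 Φ) (x, t) := by
    intro x t ht
    obtain ⟨n, -, h⟩ := hloc x t ht
    exact (contDiff_vel1 (hφ n)).contDiffAt.congr_of_eventuallyEq (vel1_congr h)
  have s2 : ∀ x t, t < 1 → ContDiffAt ℝ ∞ (vel2 Φ) (x, t) := by
    intro x t ht
    obtain ⟨n, -, h⟩ := hloc x t ht
    exact (contDiff_vel2 (hφ n)).contDiffAt.congr_of_eventuallyEq (vel2_congr h)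
  have fdw : ∀ {V : Type} [NormedAddCommGroup V] [NormedSpace ℝ V] (f : ST → V) (x : ℝ × ℝ) t,
      t ∈ Set.Ico (0 : ℝ) 1 → ContDiffAt ℝ ∞ f (x, t) →
      fderivWithin ℝ f spaceTime (x, t) = fderiv ℝ f (x, t) := by
    intro V _ _ f x t ht hf
    exact (hf.differentiableAt (by simp)).fderivWithin
      (spaceTime_uniqueDiffOn _ ⟨Set.mem_univ _, ht⟩)
  refine ⟨fun x => rho Φ (x, 0), rho Φ, dy Φ, force Φ, fun p => (vel1 Φ p, vel2 Φ p),
    hsm 0 one_pos, hcsupp 0 one_pos, ?_, ?_, ?_, ?_, ?_, ?_, fun _ => rfl, ?_, ?_, ?_, ?_⟩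
  · intro t ht
    rw [hforce t _ (hNspec t ht.2)]
    exact contDiff_slice (contDiff_force (hφ _)) t
  · intro t ht x hx
    by_contra h
    apply hx
    obtain ⟨n, -, hn⟩ := hloc x t ht.2
    rw [(force_congr (hn.trans (hout n x t ht.2 (not_le.1 h)))).eq_of_nhds, force_zero]
  · intro k
    choose M hM using hF
    refine ⟨∑ i ∈ Finset.range (k + 1), ∑ j ∈ Finset.range (k + 1), |M i j|, fun t ht => ?_⟩
    rw [hforce t _ (hNspec t ht.2)]
    refine Real.sSup_le ?_ (by positivity)
    rintro y ⟨i, j, x, hij, rfl⟩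
    rw [pdMix_slice (contDiff_force (hφ _))]
    refine ((hM i j _ t ht x).trans (le_abs_self _)).trans ?_
    have h1 : |M i j| ≤ ∑ j ∈ Finset.range (k + 1), |M i j| :=
      Finset.single_le_sum (f := fun j => |M i j|) (fun _ _ => abs_nonneg _)
        (Finset.mem_range.2 (by omega))
    refine h1.trans (Finset.single_le_sum
      (f := fun i => ∑ j ∈ Finset.range (k + 1), |M i j|)
      (fun _ _ => by positivity) (Finset.mem_range.2 (by omega)))
  · exact fun p hp => (srho p.1 p.2 (hlt p hp)).contDiffWithinAt
  · exact fun p hp => ((s1 p.1 p.2 (hlt p hp)).prodMk (s2 p.1 p.2 (hlt p hp))).contDiffWithinAt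
  · exact fun p hp => (sP p.1 p.2 (hlt p hp)).contDiffWithinAt
  · exact fun t ht => hcsupp t ht.2
  · intro t ht
    have h12 : (fun x : ℝ × ℝ => ‖(vel1 Φ (x, t), vel2 Φ (x, t))‖ ^ 2) =
        fun x => ‖(vel1 (φ (N t)) (x, t), vel2 (φ (N t)) (x, t))‖ ^ 2 := by
      funext x
      rw [(vel1_congr (hΦ _ x t (hNspec t ht.2))).eq_of_nhds,
        (vel2_congr (hΦ _ x t (hNspec t ht.2))).eq_of_nhds]
    rw [h12]
    refine Continuous.integrable_of_hasCompactSupport ?_ ?_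
    · exact (((contDiff_slice (contDiff_vel1 (hφ (N t))) t).continuous.prodMk
        (contDiff_slice (contDiff_vel2 (hφ (N t))) t).continuous).norm).pow 2
    · refine HasCompactSupport.intro isCompact_disc fun x hx => ?_
      have h0 := hout (N t) x t ht.2 (not_le.1 hx)
      rw [(vel1_congr h0).eq_of_nhds, (vel2_congr h0).eq_of_nhds]
      simp [vel1, vel2, dx, dy, dir_const]
  · intro x t ht
    obtain ⟨n, -, hn⟩ := hloc x t ht.2
    have e1 : fderivWithin ℝ (fun p => (vel1 Φ p, vel2 Φ p)) spaceTime (x, t) =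
        (fderiv ℝ (vel1 Φ) (x, t)).prod (fderiv ℝ (vel2 Φ) (x, t)) := by
      rw [fdw _ x t ht ((s1 x t ht.2).prodMk (s2 x t ht.2))]
      exact DifferentiableAt.fderiv_prodMk ((s1 x t ht.2).differentiableAt (by simp))
        ((s2 x t ht.2).differentiableAt (by simp))
    rw [fdw _ x t ht (srho x t ht.2), fdw _ x t ht (sP x t ht.2), e1]
    refine ⟨rfl, rfl, ?_, ?_⟩
    · change vel2 Φ (x, t) = -dy (dy Φ) (x, t) - rho Φ (x, t)
      simp only [vel2, rho]
      ring
    · change dx (vel1 Φ) (x, t) + dy (vel2 Φ) (x, t) = 0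
      simp only [dx, dy]
      rw [(dir_congr (vel1_congr hn) _).eq_of_nhds, (dir_congr (vel2_congr hn) _).eq_of_nhds]
      simp only [vel2, dx]
      rw [show vel1 (φ n) = fun p => -dir ((1, 0), 0) (dir ((0, 1), 0) (φ n)) p from rfl,
        dir_neg,
        dir_comm (contDiff_dir (hφ n) ((1, 0), 0)) ((0, 1), 0) ((1, 0), 0),
        dir_comm (hφ n) ((0, 1), 0) ((1, 0), 0)]
      simp
  · rw [tendsto_atTop]
    intro B
    obtain ⟨n0, hn0⟩ := eventually_atTop.1 (hG B)
    have hev : ∀ᶠ t in 𝓝[<] (1 : ℝ), T n0 < t ∧ t < 1 :=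
      (eventually_nhdsWithin_of_eventually_nhds (lt_mem_nhds (hTlt n0))).and self_mem_nhdsWithin
    filter_upwards [hev] with t ht
    have hN : n0 < N t := by
      by_contra h
      exact absurd (hNspec t ht.2) (not_lt.2 ((hTm (not_lt.1 h)).trans ht.1.le))
    obtain ⟨m, hm⟩ := Nat.exists_eq_add_of_lt hN
    have hTm' : T (n0 + m) ≤ t := by
      by_contra h
      have := hNle t _ (not_le.1 h)
      omega
    obtain ⟨x, hx⟩ := hn0 (n0 + m) (Nat.le_add_right _ _) t ⟨hTm', ht.2⟩
    refine hx.trans ?_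
    refine le_csSup (bddAbove_CkNorm_one (hsm t ht.2) (hcsupp t ht.2)) ⟨0, 1, x, le_rfl, ?_⟩
    have hlt' : t < T (n0 + m + 1) := hm ▸ hNspec t ht.2
    rw [hrho t _ hlt']
    change _ = |pd2 (fun x => rho (φ (n0 + m + 1)) (x, t)) x|
    rw [pd2_slice (contDiff_rho (hφ _))]

theorem contDiff_deriv {f : ℝ → ℝ} (hf : ContDiff ℝ ∞ f) : ContDiff ℝ ∞ (deriv f) :=
  (contDiff_infty_iff_deriv.1 hf).2

theorem hasDerivAt_of_smooth {f : ℝ → ℝ} (hf : ContDiff ℝ ∞ f) (t : ℝ) :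
    HasDerivAt f (deriv f t) t :=
  (hf.differentiable (by simp) t).hasDerivAt

theorem hasDerivAt_primitive {f : ℝ → ℝ} (hf : Continuous f) (a t : ℝ) :
    HasDerivAt (fun t => ∫ s in a..t, f s) (f t) t :=
  intervalIntegral.integral_hasDerivAt_right (hf.intervalIntegrable _ _)
    hf.stronglyMeasurable.stronglyMeasurableAtFilter hf.continuousAt

theorem contDiff_primitive {f : ℝ → ℝ} (hf : ContDiff ℝ ∞ f) (a : ℝ) :
    ContDiff ℝ ∞ (fun t => ∫ s in a..t, f s) := by
  have h : deriv (fun t => ∫ s in a..t, f s) = f :=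
    funext fun t => (hasDerivAt_primitive hf.continuous a t).deriv
  refine contDiff_infty_iff_deriv.2 ⟨fun t =>
    (hasDerivAt_primitive hf.continuous a t).differentiableAt, ?_⟩
  rw [h]; exact hf

/-- Smooth cutoffs supported in `[-1,1]` and locally constant on `(-1/2,1/2)`. -/
structure Cut (f : ℝ → ℝ) : Prop where
  smooth : ContDiff ℝ ∞ f
  supp : ∀ y, 1 < |y| → f y = 0
  flat : ∀ y, |y| < 1 / 2 → deriv f y = 0

/-- Functions vanishing on `(-1/2,1/2)`. -/
def Van (f : ℝ → ℝ) : Prop := ∀ y, |y| < 1 / 2 → f y = 0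

theorem eventually_abs_lt {y c : ℝ} (h : |y| < c) : ∀ᶠ z in 𝓝 y, |z| < c :=
  continuous_abs.continuousAt.eventually (gt_mem_nhds h)

theorem Cut.deriv {f : ℝ → ℝ} (h : Cut f) : Cut (deriv f) where
  smooth := contDiff_deriv h.smooth
  supp y hy := by
    have : f =ᶠ[𝓝 y] fun _ => 0 := by
      filter_upwards [continuous_abs.continuousAt.eventually (lt_mem_nhds hy)] with z hz
      exact h.supp z hz
    rw [this.deriv_eq]; simp
  flat y hy := by
    have : _root_.deriv f =ᶠ[𝓝 y] fun _ => 0 := by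
      filter_upwards [eventually_abs_lt hy] with z hz
      exact h.flat z hz
    rw [this.deriv_eq]; simp

theorem Cut.van_deriv {f : ℝ → ℝ} (h : Cut f) : Van (_root_.deriv f) := h.flat

theorem Van.deriv {f : ℝ → ℝ} (h : Van f) : Van (deriv f) := fun y hy => by
  have : f =ᶠ[𝓝 y] fun _ => 0 := by
    filter_upwards [eventually_abs_lt hy] with z hz
    exact h z hz
  rw [this.deriv_eq]; simp

theorem Cut.mul {f g : ℝ → ℝ} (hf : Cut f) (hg : Cut g) : Cut (fun y => f y * g y) where
  smooth := hf.smooth.mul hg.smooth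
  supp y hy := by simp [hf.supp y hy]
  flat y hy := by
    have := ((hasDerivAt_of_smooth hf.smooth y).mul (hasDerivAt_of_smooth hg.smooth y)).deriv
    change _root_.deriv (f * g) y = 0
    rw [this, hf.flat y hy, hg.flat y hy]; simp

theorem Cut.bounded {f : ℝ → ℝ} (hf : Cut f) : ∃ C, ∀ y, |f y| ≤ C := by
  have : HasCompactSupport f := HasCompactSupport.intro (isCompact_Icc (a := -1) (b := 1))
    fun y hy => hf.supp y (by
      by_contra h
      exact hy (abs_le.1 (not_lt.1 h)))
  simpa using this.exists_bound_of_continuous hf.smooth.continuous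

theorem exists_cut : ∃ χ : ℝ → ℝ, Cut χ ∧ ∀ y, |y| < 1 / 2 → χ y = 1 := by
  let B : ContDiffBump (0 : ℝ) := ⟨1 / 2, 1, by norm_num, by norm_num⟩
  have h1 : ∀ y : ℝ, |y| < 1 / 2 → B y = 1 := fun y hy =>
    B.one_of_mem_closedBall (by
      rw [mem_closedBall_zero_iff, Real.norm_eq_abs]; exact hy.le)
  refine ⟨B, ⟨B.contDiff, fun y hy => ?_, fun y hy => ?_⟩, h1⟩
  · exact B.zero_of_le_dist (by simpa using hy.le)
  · have : (B : ℝ → ℝ) =ᶠ[𝓝 y] fun _ => 1 := by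
      filter_upwards [eventually_abs_lt hy] with z hz
      exact h1 z hz
    rw [this.deriv_eq]; simp

/-- Smooth `2π`-periodic functions. -/
structure Per (h : ℝ → ℝ) : Prop where
  smooth : ContDiff ℝ ∞ h
  per : Function.Periodic h (2 * π)

theorem Per.deriv {h : ℝ → ℝ} (H : Per h) : Per (deriv h) where
  smooth := contDiff_deriv H.smooth
  per s := by
    have : (fun x => h (x + 2 * π)) = h := funext H.per
    rw [← deriv_comp_add_const, this]

theorem Per.mul {f g : ℝ → ℝ} (hf : Per f) (hg : Per g) : Per (fun s => f s * g s) :=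
  ⟨hf.smooth.mul hg.smooth, fun s => by simp only [hf.per s, hg.per s]⟩

theorem Per.const (c : ℝ) : Per (fun _ => c) := ⟨contDiff_const, fun _ => rfl⟩

theorem Per.sub {f g : ℝ → ℝ} (hf : Per f) (hg : Per g) : Per (fun s => f s - g s) :=
  ⟨hf.smooth.sub hg.smooth, fun s => by simp only [hf.per s, hg.per s]⟩

theorem Per.bounded {h : ℝ → ℝ} (H : Per h) : ∃ C, ∀ s, |h s| ≤ C := by
  obtain ⟨C, hC⟩ := (isCompact_Icc (a := 0) (b := 2 * π)).exists_bound_of_continuousOn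
    H.smooth.continuous.continuousOn
  refine ⟨C, fun s => ?_⟩
  obtain ⟨y, hy, hys⟩ := H.per.exists_mem_Ico₀ two_pi_pos s
  rw [hys]
  exact hC y ⟨hy.1, hy.2.le⟩

theorem Per.antideriv {h : ℝ → ℝ} (H : Per h) (h0 : ∫ s in (0:ℝ)..2 * π, h s = 0) :
    ∃ g, Per g ∧ _root_.deriv g = h := by
  refine ⟨fun t => ∫ s in (0:ℝ)..t, h s, ⟨contDiff_primitive H.smooth 0, fun t => ?_⟩,
    funext fun t => (hasDerivAt_primitive H.smooth.continuous 0 t).deriv⟩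
  have hi : ∀ a b, IntervalIntegrable h volume a b := fun a b =>
    H.smooth.continuous.intervalIntegrable a b
  have h1 := intervalIntegral.integral_add_adjacent_intervals (hi 0 t) (hi t (t + 2 * π))
  have h2 := H.per.intervalIntegral_add_eq t 0
  simp only [zero_add] at h2
  change ∫ s in (0:ℝ)..(t + 2 * π), h s = _
  rw [← h1, h2, h0, add_zero]

theorem Per.antideriv_mean_zero {h : ℝ → ℝ} (H : Per h) (h0 : ∫ s in (0:ℝ)..2 * π, h s = 0) :
    ∃ g, Per g ∧ _root_.deriv g = h ∧ ∫ s in (0:ℝ)..2 * π, g s = 0 := by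
  obtain ⟨g, hg, hd⟩ := H.antideriv h0
  have hpi : (2 * π) ≠ 0 := two_pi_pos.ne'
  refine ⟨fun s => g s - (∫ s in (0:ℝ)..2 * π, g s) / (2 * π), hg.sub (Per.const _), ?_, ?_⟩
  · funext s
    rw [deriv_sub_const, hd]
  · rw [intervalIntegral.integral_sub (hg.smooth.continuous.intervalIntegrable _ _)
      (by simp)]
    simp only [intervalIntegral.integral_const, sub_zero, smul_eq_mul]
    field_simp
    ring

theorem Per.double_antideriv_of_mean_zero {h : ℝ → ℝ} (H : Per h)
    (h0 : ∫ s in (0:ℝ)..2 * π, h s = 0) : ∃ g, Per g ∧ _root_.deriv (_root_.deriv g) = h := by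
  obtain ⟨g, hg, hd, hm⟩ := H.antideriv_mean_zero h0
  obtain ⟨f, hf, hdf⟩ := hg.antideriv hm
  exact ⟨f, hf, by rw [hdf, hd]⟩

theorem Per.double_antideriv {h : ℝ → ℝ} (H : Per h) :
    ∃ (c : ℝ) (g : ℝ → ℝ), Per g ∧ ∀ s, _root_.deriv (_root_.deriv g) s = h s - c := by
  have hpi : (2 * π) ≠ 0 := two_pi_pos.ne'
  obtain ⟨g, hg, hd⟩ := (H.sub (Per.const ((∫ s in (0:ℝ)..2 * π, h s) / (2 * π)))
    ).double_antideriv_of_mean_zero (by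
      rw [intervalIntegral.integral_sub (H.smooth.continuous.intervalIntegrable _ _) (by simp)]
      simp only [intervalIntegral.integral_const, sub_zero, smul_eq_mul]
      field_simp
      ring)
  exact ⟨_, g, hg, fun s => congrFun hd s⟩

theorem contDiff_sawtooth :
    ContDiff ℝ ∞ (fun s : ℝ => arcsin (sin s) * smoothTransition (8 * cos s - 1)) := by
  rw [contDiff_iff_contDiffAt]
  intro s
  have hT : ContDiff ℝ ∞ (fun s : ℝ => smoothTransition (8 * cos s - 1)) :=
    smoothTransition.contDiff.comp (((contDiff_const.mul contDiff_cos)).sub contDiff_const)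
  by_cases hc : cos s = 0
  · have : (fun s : ℝ => arcsin (sin s) * smoothTransition (8 * cos s - 1)) =ᶠ[𝓝 s]
        fun _ => 0 := by
      have h8 : ∀ᶠ t in 𝓝 s, 8 * cos t - 1 < 0 := by
        have hcont : Continuous fun t : ℝ => 8 * cos t - 1 := by fun_prop
        exact hcont.continuousAt.eventually (gt_mem_nhds (by simp [hc]))
      filter_upwards [h8] with t ht
      rw [smoothTransition.zero_of_nonpos ht.le, mul_zero]
    exact contDiffAt_const.congr_of_eventuallyEq this
  · refine ContDiffAt.mul ?_ hT.contDiffAt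
    have h1 : sin s ≠ -1 := by
      intro h
      have := sin_sq_add_cos_sq s
      rw [h] at this
      exact hc (by nlinarith)
    have h2 : sin s ≠ 1 := by
      intro h
      have := sin_sq_add_cos_sq s
      rw [h] at this
      exact hc (by nlinarith)
    exact (contDiffAt_arcsin h1 h2).comp s contDiff_sin.contDiffAt

/-- A periodic profile whose second derivative is the identity on `(-11/10,11/10)`. -/
theorem exists_profile : ∃ H : ℝ → ℝ, Per H ∧ ∀ s, |s| < 11 / 10 → deriv (deriv H) s = s := by
  let f : ℝ → ℝ := fun s => arcsin (sin s) * smoothTransition (8 * cos s - 1)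
  have hf : Per f := ⟨contDiff_sawtooth, fun s => by
    simp only [f, sin_add_two_pi, cos_add_two_pi]⟩
  have hg : Per (fun s => f (s + π)) := ⟨hf.smooth.comp (contDiff_id.add contDiff_const),
    fun s => by
      rw [add_right_comm]; exact hf.per _⟩
  obtain ⟨H, hH, hd⟩ := (hf.sub hg).double_antideriv_of_mean_zero (by
    rw [intervalIntegral.integral_sub (hf.smooth.continuous.intervalIntegrable _ _)
      (hg.smooth.continuous.intervalIntegrable _ _),
      intervalIntegral.integral_comp_add_right f π]
    have := hf.per.intervalIntegral_add_eq (0 + π) 0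
    rw [show (2 * π + π) = 0 + π + 2 * π by ring, this]
    simp)
  refine ⟨H, hH, fun s hs => ?_⟩
  rw [congrFun hd s]
  obtain ⟨h1, h2⟩ := abs_lt.1 hs
  have hcos : 1 - s ^ 2 / 2 ≤ cos s := one_sub_sq_div_two_le_cos
  have hs2 : s ^ 2 < 121 / 100 := by nlinarith
  have hpi := pi_gt_three
  have e1 : smoothTransition (8 * cos s - 1) = 1 := smoothTransition.one_of_one_le (by linarith)
  have e2 : smoothTransition (8 * cos (s + π) - 1) = 0 := by
    rw [cos_add_pi]
    exact smoothTransition.zero_of_nonpos (by linarith)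
  simp only [f, e1, e2]
  rw [arcsin_sin (by linarith) (by linarith)]
  ring

/-- The data of one oscillating layer: the direction `b` of the background, the direction `κ` and
frequency `N` of the layer, the background gradient `g`, the amplitude `A` and its time cutoff `θ`,
together with a size parameter `X` and a smallness parameter `η`. -/
structure Stage where
  N : ℝ
  X : ℝ
  η : ℝ
  s0 : ℝ
  b1 : ℝ → ℝ
  b2 : ℝ → ℝ
  k1 : ℝ → ℝ
  k2 : ℝ → ℝ
  g1 : ℝ → ℝ
  g2 : ℝ → ℝ
  A : ℝ → ℝ
  θ : ℝ → ℝ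
  one_le_N : 1 ≤ N
  one_le_X : 1 ≤ X
  η_pos : 0 < η
  η_le : η ≤ 1
  inv_N_le : 1 / N ≤ η
  s0_nonneg : 0 ≤ s0
  smooth_b1 : ContDiff ℝ ∞ b1
  smooth_b2 : ContDiff ℝ ∞ b2
  smooth_k1 : ContDiff ℝ ∞ k1
  smooth_k2 : ContDiff ℝ ∞ k2
  smooth_g1 : ContDiff ℝ ∞ g1
  smooth_g2 : ContDiff ℝ ∞ g2
  smooth_A : ContDiff ℝ ∞ A
  smooth_θ : ContDiff ℝ ∞ θ
  k_pos : ∀ t, 0 < k1 t ^ 2 + k2 t ^ 2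
  deriv_A : ∀ t, deriv A t =
    k1 t * (k1 t * g2 t - k2 t * g1 t) * (k1 t ^ 2 + k2 t ^ 2)⁻¹ * A t
  θ_zero : ∀ t ≤ s0, θ t = 0
  b1_le : ∀ t ∈ Set.Icc s0 1, |b1 t| ≤ X
  b2_le : ∀ t ∈ Set.Icc s0 1, |b2 t| ≤ X
  k1_le : ∀ t ∈ Set.Icc s0 1, |k1 t| ≤ X
  k2_le : ∀ t ∈ Set.Icc s0 1, |k2 t| ≤ X
  g1_le : ∀ t ∈ Set.Icc s0 1, |g1 t| ≤ X
  g2_le : ∀ t ∈ Set.Icc s0 1, |g2 t| ≤ X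
  deriv_b1_le : ∀ t ∈ Set.Icc s0 1, |deriv b1 t| ≤ X
  deriv_b2_le : ∀ t ∈ Set.Icc s0 1, |deriv b2 t| ≤ X
  deriv_k1_le : ∀ t ∈ Set.Icc s0 1, |deriv k1 t| ≤ X
  deriv_k2_le : ∀ t ∈ Set.Icc s0 1, |deriv k2 t| ≤ X
  inv_k_le : ∀ t ∈ Set.Icc s0 1, (k1 t ^ 2 + k2 t ^ 2)⁻¹ ≤ X
  A_le : ∀ t ∈ Set.Icc s0 1, |A t| ≤ X * η
  θ_le : ∀ t, |θ t| ≤ 1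

/-- Coefficients of size `η ^ j` up to powers of `X`. -/
def K0 (j : ℕ) (c : Stage → ℝ → ℝ) : Prop :=
  (∀ S, ContDiff ℝ ∞ (c S)) ∧
    ∃ (C : ℝ) (m : ℕ), 0 ≤ C ∧ ∀ S, ∀ t ∈ Set.Icc S.s0 1, |c S t| ≤ C * S.X ^ m * S.η ^ j

theorem Stage.X_pos (S : Stage) : 0 < S.X := one_pos.trans_le S.one_le_X

theorem Stage.X_pow_le (S : Stage) {m n : ℕ} (h : m ≤ n) : S.X ^ m ≤ S.X ^ n :=
  pow_le_pow_right₀ S.one_le_X h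

theorem Stage.η_pow_le (S : Stage) {m n : ℕ} (h : m ≤ n) : S.η ^ n ≤ S.η ^ m :=
  pow_le_pow_of_le_one S.η_pos.le S.η_le h

theorem Stage.bound_mono (S : Stage) {C C' : ℝ} {m m' j j' : ℕ} (hC : 0 ≤ C) (hCC : C ≤ C')
    (hm : m ≤ m') (hj : j' ≤ j) : C * S.X ^ m * S.η ^ j ≤ C' * S.X ^ m' * S.η ^ j' := by
  have h1 := S.X_pow_le hm
  have h2 := S.η_pow_le hj
  have := S.X_pos
  have := S.η_pos
  have : 0 ≤ C' := hC.trans hCC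
  gcongr

theorem K0.add {j : ℕ} {c c' : Stage → ℝ → ℝ} (h : K0 j c) (h' : K0 j c') :
    K0 j (fun S t => c S t + c' S t) := by
  obtain ⟨hs, C, m, hC, hb⟩ := h
  obtain ⟨hs', C', m', hC', hb'⟩ := h'
  refine ⟨fun S => (hs S).add (hs' S), C + C', max m m', by positivity, fun S t ht => ?_⟩
  have h1 := (hb S t ht).trans (S.bound_mono hC le_rfl (le_max_left m m') le_rfl)
  have h2 := (hb' S t ht).trans (S.bound_mono hC' le_rfl (le_max_right m m') le_rfl)
  calc |c S t + c' S t| ≤ |c S t| + |c' S t| := abs_add_le _ _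
    _ ≤ _ := add_le_add h1 h2
    _ = _ := by ring

theorem K0.mul {i j : ℕ} {c c' : Stage → ℝ → ℝ} (h : K0 i c) (h' : K0 j c') :
    K0 (i + j) (fun S t => c S t * c' S t) := by
  obtain ⟨hs, C, m, hC, hb⟩ := h
  obtain ⟨hs', C', m', hC', hb'⟩ := h'
  refine ⟨fun S => (hs S).mul (hs' S), C * C', m + m', by positivity, fun S t ht => ?_⟩
  have := S.X_pos
  have := S.η_pos
  calc |c S t * c' S t| = |c S t| * |c' S t| := abs_mul _ _
    _ ≤ (C * S.X ^ m * S.η ^ i) * (C' * S.X ^ m' * S.η ^ j) :=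
      mul_le_mul (hb S t ht) (hb' S t ht) (abs_nonneg _) (by positivity)
    _ = _ := by ring

theorem K0.mono {i j : ℕ} {c : Stage → ℝ → ℝ} (h : K0 j c) (hij : i ≤ j) : K0 i c := by
  obtain ⟨hs, C, m, hC, hb⟩ := h
  exact ⟨hs, C, m, hC, fun S t ht => (hb S t ht).trans (S.bound_mono hC le_rfl le_rfl hij)⟩

theorem K0.const (r : ℝ) : K0 0 (fun _ _ => r) :=
  ⟨fun _ => contDiff_const, |r|, 0, abs_nonneg _, fun S t _ => by simp⟩

theorem K0.neg {j : ℕ} {c : Stage → ℝ → ℝ} (h : K0 j c) : K0 j (fun S t => -c S t) := by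
  obtain ⟨hs, C, m, hC, hb⟩ := h
  exact ⟨fun S => (hs S).neg, C, m, hC, fun S t ht => by rw [abs_neg]; exact hb S t ht⟩

theorem K0.sub {j : ℕ} {c c' : Stage → ℝ → ℝ} (h : K0 j c) (h' : K0 j c') :
    K0 j (fun S t => c S t - c' S t) := by
  simpa only [sub_eq_add_neg] using h.add h'.neg

/-- `KK false j` is `K0 j`; for `KK true j` the time derivative is required to be in `K0 j` too. -/
def KK (d : Bool) (j : ℕ) (c : Stage → ℝ → ℝ) : Prop :=
  K0 j c ∧ (d = true → K0 j (fun S => deriv (c S)))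

section KK
variable {d : Bool} {i j : ℕ} {c c' : Stage → ℝ → ℝ}

theorem KK.smooth (h : KK d j c) (S : Stage) : ContDiff ℝ ∞ (c S) := h.1.1 S

theorem KK.lower (h : KK true j c) : KK d j c := ⟨h.1, fun _ => h.2 rfl⟩

theorem KK.mono (h : KK d j c) (hij : i ≤ j) : KK d i c :=
  ⟨h.1.mono hij, fun hd => (h.2 hd).mono hij⟩

theorem KK.mul (h : KK d i c) (h' : KK d j c') : KK d (i + j) (fun S t => c S t * c' S t) := by
  refine ⟨h.1.mul h'.1, fun hd => ?_⟩
  have := ((h.2 hd).mul h'.1).add (h.1.mul (h'.2 hd))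
  convert this using 2 with S t
  exact funext fun t => ((hasDerivAt_of_smooth (h.smooth S) t).mul
    (hasDerivAt_of_smooth (h'.smooth S) t)).deriv

theorem KK.add (h : KK d j c) (h' : KK d j c') : KK d j (fun S t => c S t + c' S t) := by
  refine ⟨h.1.add h'.1, fun hd => ?_⟩
  convert (h.2 hd).add (h'.2 hd) using 2 with S t
  exact funext fun t => ((hasDerivAt_of_smooth (h.smooth S) t).add
    (hasDerivAt_of_smooth (h'.smooth S) t)).deriv

theorem KK.const (r : ℝ) : KK d 0 (fun _ _ => r) := by
  refine ⟨K0.const r, fun _ => ?_⟩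
  simpa using K0.const 0

theorem KK.of_bound {m : ℕ} (hs : ∀ S, ContDiff ℝ ∞ (c S))
    (h : ∀ S, ∀ t ∈ Set.Icc S.s0 1, |c S t| ≤ S.X ^ m) : K0 0 c :=
  ⟨hs, 1, m, zero_le_one, fun S t ht => by simpa using h S t ht⟩

end KK

theorem K0.kk {j : ℕ} {c : Stage → ℝ → ℝ} (h : K0 j c) : KK false j c := ⟨h, by simp⟩

theorem kk_b1 {d : Bool} : KK d 0 Stage.b1 :=
  ⟨KK.of_bound (m := 1) Stage.smooth_b1 fun S t ht => by simpa using S.b1_le t ht, fun _ =>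
    KK.of_bound (m := 1) (fun S => contDiff_deriv S.smooth_b1)
      fun S t ht => by simpa using S.deriv_b1_le t ht⟩

theorem kk_b2 {d : Bool} : KK d 0 Stage.b2 :=
  ⟨KK.of_bound (m := 1) Stage.smooth_b2 fun S t ht => by simpa using S.b2_le t ht, fun _ =>
    KK.of_bound (m := 1) (fun S => contDiff_deriv S.smooth_b2)
      fun S t ht => by simpa using S.deriv_b2_le t ht⟩

theorem kk_k1 {d : Bool} : KK d 0 Stage.k1 :=
  ⟨KK.of_bound (m := 1) Stage.smooth_k1 fun S t ht => by simpa using S.k1_le t ht, fun _ =>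
    KK.of_bound (m := 1) (fun S => contDiff_deriv S.smooth_k1)
      fun S t ht => by simpa using S.deriv_k1_le t ht⟩

theorem kk_k2 {d : Bool} : KK d 0 Stage.k2 :=
  ⟨KK.of_bound (m := 1) Stage.smooth_k2 fun S t ht => by simpa using S.k2_le t ht, fun _ =>
    KK.of_bound (m := 1) (fun S => contDiff_deriv S.smooth_k2)
      fun S t ht => by simpa using S.deriv_k2_le t ht⟩

theorem kk_g1 : KK false 0 Stage.g1 :=
  (KK.of_bound (m := 1) Stage.smooth_g1 fun S t ht => by simpa using S.g1_le t ht).kk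

theorem kk_g2 : KK false 0 Stage.g2 :=
  (KK.of_bound (m := 1) Stage.smooth_g2 fun S t ht => by simpa using S.g2_le t ht).kk

/-- `1/|κ|²`. -/
noncomputable def Stage.q (S : Stage) (t : ℝ) : ℝ := (S.k1 t ^ 2 + S.k2 t ^ 2)⁻¹

theorem Stage.smooth_q (S : Stage) : ContDiff ℝ ∞ S.q :=
  ((S.smooth_k1.pow 2).add (S.smooth_k2.pow 2)).inv fun t => (S.k_pos t).ne'

theorem Stage.q_pos (S : Stage) (t : ℝ) : 0 < S.q t := inv_pos.2 (S.k_pos t)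

theorem Stage.deriv_q (S : Stage) (t : ℝ) : deriv S.q t =
    -(2 * (S.k1 t * deriv S.k1 t) + 2 * (S.k2 t * deriv S.k2 t)) * (S.q t * S.q t) := by
  have h1 := hasDerivAt_of_smooth S.smooth_k1 t
  have h2 := hasDerivAt_of_smooth S.smooth_k2 t
  have := (((h1.pow 2).add (h2.pow 2)).inv (S.k_pos t).ne').deriv
  change deriv S.q t = _ at this
  rw [this]
  have hk := (S.k_pos t).ne'
  simp only [Stage.q, Pi.add_apply, Pi.pow_apply]
  field_simp
  ring

theorem kk_q {d : Bool} : KK d 0 Stage.q := by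
  have h0 : K0 0 Stage.q := KK.of_bound (m := 1) Stage.smooth_q fun S t ht => by
    rw [abs_of_pos (S.q_pos t)]
    simpa [Stage.q] using S.inv_k_le t ht
  refine ⟨h0, fun _ => ?_⟩
  have h1 := (kk_k1 (d := true)).1.mul (kk_k1.2 rfl)
  have h2 := (kk_k2 (d := true)).1.mul (kk_k2.2 rfl)
  have := ((((K0.const 2).mul h1).add ((K0.const 2).mul h2)).neg).mul (h0.mul h0)
  convert this using 2 with S
  exact funext fun t => S.deriv_q t

theorem kk_invN {d : Bool} : KK d 1 (fun S _ => 1 / S.N) := by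
  refine ⟨⟨fun _ => contDiff_const, 1, 0, zero_le_one, fun S t _ => ?_⟩, fun _ => ?_⟩
  · have : 0 < S.N := one_pos.trans_le S.one_le_N
    rw [abs_of_pos (by positivity)]
    simpa using S.inv_N_le
  · refine ⟨fun S => ?_, 0, 0, le_rfl, fun S t _ => by simp⟩
    simp only [deriv_const']
    exact contDiff_const

/-- The cut-off amplitude. -/
noncomputable def Stage.a (S : Stage) (t : ℝ) : ℝ := S.θ t * S.A t

theorem Stage.smooth_a (S : Stage) : ContDiff ℝ ∞ S.a := S.smooth_θ.mul S.smooth_A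

theorem kk_a : KK false 1 Stage.a := by
  refine K0.kk ⟨Stage.smooth_a, 1, 1, zero_le_one, fun S t ht => ?_⟩
  have h1 := S.θ_le t
  have h2 := S.A_le t ht
  rw [Stage.a, abs_mul]
  calc |S.θ t| * |S.A t| ≤ 1 * (S.X * S.η) := by gcongr
    _ = _ := by ring

/-- Points `(t, y₁, y₂, s)`. -/
abbrev Q := ℝ × ℝ × ℝ × ℝ

abbrev Fam := Stage → Q → ℝ

/-- Finite sums of products of separate variables, with coefficients of order `j`; with flag
`v = true` all terms vanish in the inner square. -/
inductive Sep (d : Bool) (j : ℕ) (v : Bool) : Fam → Prop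
  | zero : Sep d j v (fun _ _ => 0)
  | add {W W' : Fam} : Sep d j v W → Sep d j v W' → Sep d j v (fun S q => W S q + W' S q)
  | term {c : Stage → ℝ → ℝ} {f1 f2 h : ℝ → ℝ} : KK d j c → Cut f1 → Cut f2 → Per h →
      (v = true → Van f1 ∨ Van f2) →
      Sep d j v (fun S q => c S q.1 * f1 q.2.1 * f2 q.2.2.1 * h q.2.2.2)

noncomputable def D1 (W : Fam) : Fam := fun S => dir (0, 1, 0, 0) (W S)
noncomputable def D2 (W : Fam) : Fam := fun S => dir (0, 0, 1, 0) (W S)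
noncomputable def Ds (W : Fam) : Fam := fun S => dir (0, 0, 0, 1) (W S)
noncomputable def Dt (W : Fam) : Fam := fun S => dir (1, 0, 0, 0) (W S)

theorem dir_term {c f1 f2 h : ℝ → ℝ} (hc : ContDiff ℝ ∞ c) (h1 : ContDiff ℝ ∞ f1)
    (h2 : ContDiff ℝ ∞ f2) (hh : ContDiff ℝ ∞ h) (w q : Q) :
    dir w (fun q : Q => c q.1 * f1 q.2.1 * f2 q.2.2.1 * h q.2.2.2) q =
      w.1 * (deriv c q.1 * f1 q.2.1 * f2 q.2.2.1 * h q.2.2.2)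
      + w.2.1 * (c q.1 * deriv f1 q.2.1 * f2 q.2.2.1 * h q.2.2.2)
      + w.2.2.1 * (c q.1 * f1 q.2.1 * deriv f2 q.2.2.1 * h q.2.2.2)
      + w.2.2.2 * (c q.1 * f1 q.2.1 * f2 q.2.2.1 * deriv h q.2.2.2) := by
  have e1 : HasFDerivAt (fun q : Q => q.1) (ContinuousLinearMap.fst ℝ ℝ (ℝ × ℝ × ℝ)) q :=
    hasFDerivAt_fst
  have e2 : HasFDerivAt (fun q : Q => q.2) (ContinuousLinearMap.snd ℝ ℝ (ℝ × ℝ × ℝ)) q :=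
    hasFDerivAt_snd
  have e21 := (hasFDerivAt_fst (𝕜 := ℝ) (p := q.2)).comp q e2
  have e22 := (hasFDerivAt_snd (𝕜 := ℝ) (p := q.2)).comp q e2
  have e221 := (hasFDerivAt_fst (𝕜 := ℝ) (p := q.2.2)).comp q e22
  have e222 := (hasFDerivAt_snd (𝕜 := ℝ) (p := q.2.2)).comp q e22
  have k1 := (hasDerivAt_of_smooth hc q.1).comp_hasFDerivAt q e1
  have k2 := (hasDerivAt_of_smooth h1 q.2.1).comp_hasFDerivAt q e21
  have k3 := (hasDerivAt_of_smooth h2 q.2.2.1).comp_hasFDerivAt q e221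
  have k4 := (hasDerivAt_of_smooth hh q.2.2.2).comp_hasFDerivAt q e222
  have k := (((k1.mul k2).mul k3).mul k4).fderiv
  simp only [dir]
  change fderiv ℝ (((c ∘ fun q : Q => q.1) * (f1 ∘ (Prod.fst ∘ fun q : Q => q.2))) *
    (f2 ∘ (Prod.fst ∘ (Prod.snd ∘ fun q : Q => q.2))) *
    (h ∘ (Prod.snd ∘ (Prod.snd ∘ fun q : Q => q.2)))) q w = _
  rw [k]
  simp
  ring

theorem Ds_term {c : Stage → ℝ → ℝ} {f1 f2 h : ℝ → ℝ} (hc : ∀ S, ContDiff ℝ ∞ (c S))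
    (h1 : ContDiff ℝ ∞ f1) (h2 : ContDiff ℝ ∞ f2) (hh : ContDiff ℝ ∞ h) :
    Ds (fun S q => c S q.1 * f1 q.2.1 * f2 q.2.2.1 * h q.2.2.2) =
      fun S q => c S q.1 * f1 q.2.1 * f2 q.2.2.1 * deriv h q.2.2.2 := by
  funext S q
  simp only [Ds, dir_term (hc S) h1 h2 hh]
  ring

section Sep
variable {d v v' : Bool} {i j : ℕ} {W W' : Fam} {c : Stage → ℝ → ℝ}

theorem Sep.smooth (h : Sep d j v W) (S : Stage) : ContDiff ℝ ∞ (W S) := by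
  induction h with
  | zero => exact contDiff_const
  | add _ _ h h' => exact h.add h'
  | term hc h1 h2 hh _ =>
    have := hc.smooth S
    have := h1.smooth
    have := h2.smooth
    have := hh.smooth
    fun_prop

theorem Sep.coef (hc : KK d i c) (h : Sep d j v W) :
    Sep d (i + j) v (fun S q => c S q.1 * W S q) := by
  induction h with
  | zero => simpa using Sep.zero
  | add _ _ h h' => simpa only [mul_add] using h.add h'
  | term hc' h1 h2 hh hv =>
    convert Sep.term (hc.mul hc') h1 h2 hh hv using 3
    ring

theorem Sep.coef' (hc : KK d 0 c) (h : Sep d j v W) :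
    Sep d j v (fun S q => c S q.1 * W S q) := by
  simpa using Sep.coef hc h

theorem Sep.neg (h : Sep d j v W) : Sep d j v (fun S q => -W S q) := by
  simpa using Sep.coef' (KK.const (-1)) h

theorem Sep.sub (h : Sep d j v W) (h' : Sep d j v W') :
    Sep d j v (fun S q => W S q - W' S q) := by
  simpa only [sub_eq_add_neg] using h.add h'.neg

theorem Sep.mono (h : Sep d j v W) (hij : i ≤ j) : Sep d i v W := by
  induction h with
  | zero => exact Sep.zero
  | add _ _ h h' => exact h.add h'
  | term hc h1 h2 hh hv => exact Sep.term (hc.mono hij) h1 h2 hh hv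

theorem Sep.lower (h : Sep true j v W) : Sep d j v W := by
  induction h with
  | zero => exact Sep.zero
  | add _ _ h h' => exact h.add h'
  | term hc h1 h2 hh hv => exact Sep.term hc.lower h1 h2 hh hv

theorem Sep.full (h : Sep d j true W) : Sep d j v W := by
  induction h with
  | zero => exact Sep.zero
  | add _ _ h h' => exact h.add h'
  | term hc h1 h2 hh hv => exact Sep.term hc h1 h2 hh fun _ => hv rfl

theorem Sep.mul_term {c' : Stage → ℝ → ℝ} {f1 f2 h : ℝ → ℝ} (hW : Sep d i v W) (hc : KK d j c')
    (h1 : Cut f1) (h2 : Cut f2) (hh : Per h) (hv : v' = true → Van f1 ∨ Van f2) :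
    Sep d (i + j) (v || v')
      (fun S q => W S q * (c' S q.1 * f1 q.2.1 * f2 q.2.2.1 * h q.2.2.2)) := by
  induction hW with
  | zero => simpa using Sep.zero
  | add _ _ h h' => simpa only [add_mul] using h.add h'
  | term hc' h1' h2' hh' hv' =>
    convert Sep.term (hc'.mul hc) (h1'.mul h1) (h2'.mul h2) (hh'.mul hh) ?_ using 3
    · ring
    · intro hvv
      rcases Bool.or_eq_true_iff.1 hvv with h0 | h0
      · rcases hv' h0 with h | h
        · exact Or.inl fun y hy => by simp [h y hy]
        · exact Or.inr fun y hy => by simp [h y hy]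
      · rcases hv h0 with h | h
        · exact Or.inl fun y hy => by simp [h y hy]
        · exact Or.inr fun y hy => by simp [h y hy]

theorem Sep.mul (hW : Sep d i v W) (hW' : Sep d j v' W') :
    Sep d (i + j) (v || v') (fun S q => W S q * W' S q) := by
  induction hW' with
  | zero => simpa using Sep.zero
  | add _ _ h h' => simpa only [mul_add] using h.add h'
  | term hc h1 h2 hh hv => exact hW.mul_term hc h1 h2 hh hv

theorem Sep.d1 (h : Sep d j v W) : Sep d j true (D1 W) := by
  induction h with
  | zero =>
    convert Sep.zero using 1
    exact funext fun S => dir_const 0 _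
  | add h h' e e' =>
    convert e.add e' using 1
    exact funext fun S => dir_add (h.smooth S) (h'.smooth S) _
  | term hc h1 h2 hh hv =>
    convert Sep.term (v := true) hc h1.deriv h2 hh (fun _ => Or.inl h1.van_deriv) using 1
    funext S q
    simp only [D1, dir_term (hc.smooth S) h1.smooth h2.smooth hh.smooth]
    ring

theorem Sep.d2 (h : Sep d j v W) : Sep d j true (D2 W) := by
  induction h with
  | zero =>
    convert Sep.zero using 1
    exact funext fun S => dir_const 0 _
  | add h h' e e' =>
    convert e.add e' using 1
    exact funext fun S => dir_add (h.smooth S) (h'.smooth S) _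
  | term hc h1 h2 hh hv =>
    convert Sep.term (v := true) hc h1 h2.deriv hh (fun _ => Or.inr h2.van_deriv) using 1
    funext S q
    simp only [D2, dir_term (hc.smooth S) h1.smooth h2.smooth hh.smooth]
    ring

theorem Sep.ds (h : Sep d j v W) : Sep d j v (Ds W) := by
  induction h with
  | zero =>
    convert Sep.zero using 1
    exact funext fun S => dir_const 0 _
  | add h h' e e' =>
    convert e.add e' using 1
    exact funext fun S => dir_add (h.smooth S) (h'.smooth S) _
  | term hc h1 h2 hh hv =>
    convert Sep.term hc h1 h2 hh.deriv hv using 1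
    funext S q
    simp only [Ds, dir_term (hc.smooth S) h1.smooth h2.smooth hh.smooth]
    ring

theorem Sep.dt (h : Sep true j v W) : Sep false j v (Dt W) := by
  induction h with
  | zero =>
    convert Sep.zero using 1
    exact funext fun S => dir_const 0 _
  | add h h' e e' =>
    convert e.add e' using 1
    exact funext fun S => dir_add (h.smooth S) (h'.smooth S) _
  | term hc h1 h2 hh hv =>
    convert Sep.term (hc.2 rfl).kk h1 h2 hh hv using 1
    funext S q
    simp only [Dt, dir_term (hc.smooth S) h1.smooth h2.smooth hh.smooth]
    ring

/-- Families independent of the fast variable. -/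
def Slow (W : Fam) : Prop := ∀ S t y1 y2 s s', W S (t, y1, y2, s) = W S (t, y1, y2, s')

theorem Sep.exists_mean (h : Sep d j v W) : ∃ m V, Sep d j v m ∧ Sep d j v V ∧ Slow m ∧
    ∀ S q, Ds (Ds V) S q = W S q - m S q := by
  induction h with
  | zero => exact ⟨_, _, Sep.zero, Sep.zero, fun _ _ _ _ _ _ => rfl, fun S q => by
      simp [Ds, dir_const]⟩
  | add _ _ e e' =>
    obtain ⟨m, V, hm, hV, hs, hd⟩ := e
    obtain ⟨m', V', hm', hV', hs', hd'⟩ := e'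
    refine ⟨_, _, hm.add hm', hV.add hV', fun S t y1 y2 s s' => ?_, fun S q => ?_⟩
    · simp only [hs S t y1 y2 s s', hs' S t y1 y2 s s']
    · have h1 : Ds (fun S q => V S q + V' S q) =
          fun S q => Ds V S q + Ds V' S q :=
        funext fun S => dir_add (hV.smooth S) (hV'.smooth S) _
      have h2 : Ds (fun S q => Ds V S q + Ds V' S q) =
          fun S q => Ds (Ds V) S q + Ds (Ds V') S q :=
        funext fun S => dir_add (hV.ds.smooth S) (hV'.ds.smooth S) _
      rw [h1, h2]
      simp only [hd, hd']
      ring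
  | term hc h1 h2 hh hv =>
    obtain ⟨r, g, hg, hgd⟩ := hh.double_antideriv
    refine ⟨_, _, Sep.term hc h1 h2 (Per.const r) hv, Sep.term hc h1 h2 hg hv,
      fun _ _ _ _ _ _ => rfl, fun S q => ?_⟩
    rw [Ds_term (fun S => hc.smooth S) h1.smooth h2.smooth hg.smooth,
      Ds_term (fun S => hc.smooth S) h1.smooth h2.smooth hg.deriv.smooth]
    simp only [hgd]
    ring

theorem KK.primitive (hc : K0 j c) : KK true j (fun S t => ∫ τ in (1:ℝ)..t, c S τ) := by
  obtain ⟨hs, C, m, hC, hb⟩ := hc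
  refine ⟨⟨fun S => contDiff_primitive (hs S) 1, C, m, hC, fun S t ht => ?_⟩, fun _ => ?_⟩
  · have hB : 0 ≤ C * S.X ^ m * S.η ^ j := by have := S.X_pos; have := S.η_pos; positivity
    have h1 : ‖∫ τ in (1:ℝ)..t, c S τ‖ ≤ C * S.X ^ m * S.η ^ j * |t - 1| := by
      refine intervalIntegral.norm_integral_le_of_norm_le_const fun x hx => ?_
      rw [Set.uIoc_comm, Set.uIoc_of_le ht.2] at hx
      exact hb S x ⟨ht.1.trans hx.1.le, hx.2⟩
    have h2 : |t - 1| ≤ 1 := by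
      have := S.s0_nonneg
      rw [abs_le]; constructor <;> linarith [ht.1, ht.2]
    calc _ ≤ _ := h1
      _ ≤ C * S.X ^ m * S.η ^ j * 1 := by gcongr
      _ = _ := mul_one _
  · have : (fun S : Stage => _root_.deriv fun t => ∫ τ in (1:ℝ)..t, c S τ) = c :=
      funext fun S => funext fun t => (hasDerivAt_primitive (hs S).continuous 1 t).deriv
    rw [this]
    exact ⟨hs, C, m, hC, hb⟩

theorem Sep.exists_primitive (h : Sep false j v W) : ∃ δ, Sep true j v δ ∧ Dt δ = W := by
  induction h with
  | zero => exact ⟨_, Sep.zero, by funext S; simp [Dt, dir_const]⟩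
  | add _ _ e e' =>
    obtain ⟨δ, hδ, hd⟩ := e
    obtain ⟨δ', hδ', hd'⟩ := e'
    refine ⟨_, hδ.add hδ', ?_⟩
    rw [← hd, ← hd']
    exact funext fun S => dir_add (hδ.smooth S) (hδ'.smooth S) _
  | term hc h1 h2 hh hv =>
    have hk := KK.primitive hc.1
    refine ⟨_, Sep.term hk h1 h2 hh hv, ?_⟩
    funext S q
    simp only [Dt, dir_term (hk.smooth S) h1.smooth h2.smooth hh.smooth]
    rw [(hasDerivAt_primitive (hc.smooth S).continuous 1 q.1).deriv]
    ring

theorem Sep.eq_zero_of_supp (h : Sep d j v W) (S : Stage) {q : Q}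
    (hq : 1 < |q.2.1| ∨ 1 < |q.2.2.1|) : W S q = 0 := by
  induction h with
  | zero => rfl
  | add _ _ e e' => simp [e, e']
  | term hc h1 h2 hh hv =>
    rcases hq with hq | hq
    · simp [h1.supp _ hq]
    · simp [h2.supp _ hq]

theorem Sep.eq_zero_of_inner (h : Sep d j true W) (S : Stage) {q : Q}
    (h1 : |q.2.1| < 1 / 2) (h2 : |q.2.2.1| < 1 / 2) : W S q = 0 := by
  induction h with
  | zero => rfl
  | add _ _ e e' => simp [e, e']
  | term _ _ _ _ hv =>
    rcases hv rfl with hv | hv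
    · simp [hv _ h1]
    · simp [hv _ h2]

theorem Sep.bound (h : Sep d j v W) : ∃ (C : ℝ) (m : ℕ), 0 ≤ C ∧
    ∀ S, ∀ q : Q, q.1 ∈ Set.Icc S.s0 1 → |W S q| ≤ C * S.X ^ m * S.η ^ j := by
  induction h with
  | zero => exact ⟨0, 0, le_rfl, fun S q _ => by simp⟩
  | add _ _ e e' =>
    obtain ⟨C, m, hC, hb⟩ := e
    obtain ⟨C', m', hC', hb'⟩ := e'
    refine ⟨C + C', max m m', by positivity, fun S q ht => ?_⟩
    have h1 := (hb S q ht).trans (S.bound_mono hC le_rfl (le_max_left m m') le_rfl)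
    have h2 := (hb' S q ht).trans (S.bound_mono hC' le_rfl (le_max_right m m') le_rfl)
    calc _ ≤ _ := abs_add_le _ _
      _ ≤ _ := add_le_add h1 h2
      _ = _ := by ring
  | term hc h1 h2 hh hv =>
    obtain ⟨-, C, m, hC, hb⟩ := hc.1
    obtain ⟨C1, hC1⟩ := h1.bounded
    obtain ⟨C2, hC2⟩ := h2.bounded
    obtain ⟨C3, hC3⟩ := hh.bounded
    have p1 := (abs_nonneg _).trans (hC1 0)
    have p2 := (abs_nonneg _).trans (hC2 0)
    have p3 := (abs_nonneg _).trans (hC3 0)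
    refine ⟨C * C1 * C2 * C3, m, by positivity, fun S q ht => ?_⟩
    have := S.X_pos
    have := S.η_pos
    rw [abs_mul, abs_mul, abs_mul]
    calc _ ≤ (C * S.X ^ m * S.η ^ j) * C1 * C2 * C3 := by
          gcongr
          · exact hb S _ ht
          · exact hC1 _
          · exact hC2 _
          · exact hC3 _
      _ = _ := by ring

end Sep

namespace Stage
noncomputable def ν (S : Stage) (_ : ℝ) : ℝ := 1 / S.N
noncomputable def bg (S : Stage) (t : ℝ) : ℝ := S.b1 t * S.g2 t - S.b2 t * S.g1 t
noncomputable def kg (S : Stage) (t : ℝ) : ℝ := S.k1 t * S.g2 t - S.k2 t * S.g1 t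
noncomputable def bk (S : Stage) (t : ℝ) : ℝ := S.b1 t * S.k2 t - S.b2 t * S.k1 t
noncomputable def μ (S : Stage) (t : ℝ) : ℝ := S.k1 t * S.kg t * S.q t
noncomputable def α (S : Stage) (t : ℝ) : ℝ := (S.b1 t * S.k1 t + S.b2 t * S.k2 t) * S.q t
noncomputable def β (S : Stage) (t : ℝ) : ℝ := (S.b1 t * S.b1 t + S.b2 t * S.b2 t) * S.q t
noncomputable def γ (S : Stage) (t : ℝ) : ℝ := S.k1 t * S.q t
noncomputable def γb (S : Stage) (t : ℝ) : ℝ := S.b1 t * S.q t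
end Stage

section coefs
variable {d : Bool}

theorem KK.mul0 {j : ℕ} {c c' : Stage → ℝ → ℝ} (h : KK d 0 c) (h' : KK d j c') :
    KK d j (fun S t => c S t * c' S t) := by simpa using h.mul h'

theorem KK.neg {j : ℕ} {c : Stage → ℝ → ℝ} (h : KK d j c) : KK d j (fun S t => -c S t) := by
  simpa using (KK.const (-1)).mul0 h

theorem KK.sub {j : ℕ} {c c' : Stage → ℝ → ℝ} (h : KK d j c) (h' : KK d j c') :
    KK d j (fun S t => c S t - c' S t) := by
  simpa only [sub_eq_add_neg] using h.add h'.neg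

theorem kk_ν : KK d 1 Stage.ν := kk_invN
theorem kk_α : KK d 0 Stage.α := ((kk_b1.mul0 kk_k1).add (kk_b2.mul0 kk_k2)).mul0 kk_q
theorem kk_β : KK d 0 Stage.β := ((kk_b1.mul0 kk_b1).add (kk_b2.mul0 kk_b2)).mul0 kk_q
theorem kk_γ : KK d 0 Stage.γ := kk_k1.mul0 kk_q
theorem kk_γb : KK d 0 Stage.γb := kk_b1.mul0 kk_q
theorem kk_bg : KK false 0 Stage.bg := (kk_b1.mul0 kk_g2).sub (kk_b2.mul0 kk_g1)
theorem kk_kg : KK false 0 Stage.kg := (kk_k1.mul0 kk_g2).sub (kk_k2.mul0 kk_g1)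
theorem kk_bk : KK false 0 Stage.bk := (kk_b1.mul0 kk_k2).sub (kk_b2.mul0 kk_k1)
theorem kk_μ : KK false 0 Stage.μ := (kk_k1.mul0 kk_kg).mul0 kk_q

end coefs

/-- Smoothness of a family. -/
def SmF (W : Fam) : Prop := ∀ S, ContDiff ℝ ∞ (W S)

theorem Sep.smF {d v : Bool} {j : ℕ} {W : Fam} (h : Sep d j v W) : SmF W := h.smooth

section families
variable {W W' w δ : Fam}

theorem SmF.d1 (h : SmF W) : SmF (D1 W) := fun S => contDiff_dir (h S) _
theorem SmF.d2 (h : SmF W) : SmF (D2 W) := fun S => contDiff_dir (h S) _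
theorem SmF.ds (h : SmF W) : SmF (Ds W) := fun S => contDiff_dir (h S) _
theorem SmF.dt (h : SmF W) : SmF (Dt W) := fun S => contDiff_dir (h S) _
theorem SmF.add (h : SmF W) (h' : SmF W') : SmF (fun S q => W S q + W' S q) :=
  fun S => (h S).add (h' S)
theorem SmF.coef {c : Stage → ℝ → ℝ} (hc : ∀ S, ContDiff ℝ ∞ (c S)) (h : SmF W) :
    SmF (fun S q => c S q.1 * W S q) := fun S => ((hc S).comp contDiff_fst).mul (h S)

theorem D1_add (h : SmF W) (h' : SmF W') :
    D1 (fun S q => W S q + W' S q) = fun S q => D1 W S q + D1 W' S q :=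
  funext fun S => dir_add (h S) (h' S) _
theorem D2_add (h : SmF W) (h' : SmF W') :
    D2 (fun S q => W S q + W' S q) = fun S q => D2 W S q + D2 W' S q :=
  funext fun S => dir_add (h S) (h' S) _
theorem Ds_add (h : SmF W) (h' : SmF W') :
    Ds (fun S q => W S q + W' S q) = fun S q => Ds W S q + Ds W' S q :=
  funext fun S => dir_add (h S) (h' S) _
theorem Dt_add (h : SmF W) (h' : SmF W') :
    Dt (fun S q => W S q + W' S q) = fun S q => Dt W S q + Dt W' S q :=
  funext fun S => dir_add (h S) (h' S) _

theorem dir_coef {c : ℝ → ℝ} {f : Q → ℝ} (hc : ContDiff ℝ ∞ c) (h : ContDiff ℝ ∞ f) (w q : Q) :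
    dir w (fun q => c q.1 * f q) q = c q.1 * dir w f q + w.1 * (deriv c q.1 * f q) := by
  have hc' : ContDiff ℝ ∞ (fun q : Q => c q.1) := hc.comp contDiff_fst
  rw [dir_mul hc' h]
  have : dir w (fun q : Q => c q.1) q = w.1 * deriv c q.1 := by
    have := dir_comp (v := w) hc (L := fun q : Q => q.1) (p := q) differentiableAt_fst
      (L' := w.1) (by rw [fderiv_fst]; rfl)
    rw [this]
    simp [dir]
  simp only [this]
  ring

theorem Ds_coef {c : Stage → ℝ → ℝ} (hc : ∀ S, ContDiff ℝ ∞ (c S)) (h : SmF W) :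
    Ds (fun S q => c S q.1 * W S q) = fun S q => c S q.1 * Ds W S q := by
  funext S q; simp [Ds, dir_coef (hc S) (h S)]

/-- The lower order part of the density profile. -/
noncomputable def vlow (w : Fam) : Fam := fun S q =>
  S.ν q.1 * (2 * D2 (Ds w) S q) + S.ν q.1 * (2 * (S.α q.1 * D1 (Ds w) S q)) +
    S.ν q.1 * (S.ν q.1 * (D2 (D2 w) S q + 2 * (S.α q.1 * D1 (D2 w) S q)
      + S.β q.1 * D1 (D1 w) S q))

/-- Density profile of the stream profile `w`. -/
noncomputable def vop (w : Fam) : Fam := fun S q => Ds (Ds w) S q + vlow w S q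

noncomputable def ylow (w : Fam) : Fam := fun S q =>
  S.γ q.1 * D2 w S q + S.γb q.1 * D1 w S q

/-- Profile of `∂₁` of the potential. -/
noncomputable def yop (w : Fam) : Fam := fun S q =>
  S.γ q.1 * Ds w S q + S.ν q.1 * ylow w S q

noncomputable def Lin (w : Fam) : Fam := fun S q =>
  Dt (vop w) S q + S.μ q.1 * vop w S q -
    (S.ν q.1 * (S.bg q.1 * D1 (yop w) S q) +
      S.kg q.1 * (Ds (yop w) S q + S.ν q.1 * D2 (yop w) S q))

noncomputable def Bil (w w' : Fam) : Fam := fun S q =>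
  -(S.a q.1 * (S.bk q.1 * (D1 (yop w) S q * (Ds (vop w') S q + S.ν q.1 * D2 (vop w') S q)
    - (Ds (yop w) S q + S.ν q.1 * D2 (yop w) S q) * D1 (vop w') S q)))

noncomputable def Res (w : Fam) : Fam := fun S q => Lin w S q + Bil w w S q

theorem ν_smooth (S : Stage) : ContDiff ℝ ∞ S.ν := contDiff_const

theorem SmF.ylow (h : SmF w) : SmF (ylow w) :=
  (SmF.coef (kk_γ (d := false)).smooth h.d2).add (SmF.coef (kk_γb (d := false)).smooth h.d1)

theorem SmF.yop (h : SmF w) : SmF (yop w) :=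
  (SmF.coef (kk_γ (d := false)).smooth h.ds).add (SmF.coef ν_smooth h.ylow)

theorem SmF.vlow (h : SmF w) : SmF (vlow w) := by
  have c2 : ∀ S : Stage, ContDiff ℝ ∞ (fun _ : ℝ => (2 : ℝ)) := fun _ => contDiff_const
  have hα := (kk_α (d := false)).smooth
  have hβ := (kk_β (d := false)).smooth
  exact ((SmF.coef ν_smooth (SmF.coef c2 h.ds.d2)).add
    (SmF.coef ν_smooth (SmF.coef c2 (SmF.coef hα h.ds.d1)))).add
    (SmF.coef ν_smooth (SmF.coef ν_smooth ((h.d2.d2.add (SmF.coef c2 (SmF.coef hα h.d2.d1))).add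
      (SmF.coef hβ h.d1.d1))))

theorem SmF.vop (h : SmF w) : SmF (vop w) := h.ds.ds.add h.vlow

theorem ylow_add (h : SmF w) (h' : SmF δ) : ylow (fun S q => w S q + δ S q) =
    fun S q => ylow w S q + ylow δ S q := by
  funext S q
  simp only [IPM.ylow, D2_add h h', D1_add h h']
  ring

theorem yop_add (h : SmF w) (h' : SmF δ) : yop (fun S q => w S q + δ S q) =
    fun S q => yop w S q + yop δ S q := by
  funext S q
  simp only [IPM.yop, ylow_add h h', Ds_add h h']
  ring

theorem vop_add (h : SmF w) (h' : SmF δ) : vop (fun S q => w S q + δ S q) =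
    fun S q => vop w S q + vop δ S q := by
  funext S q
  simp only [IPM.vop, IPM.vlow, Ds_add h h', D1_add h h', D2_add h h', Ds_add h.ds h'.ds,
    D2_add h.ds h'.ds, D1_add h.ds h'.ds, D2_add h.d2 h'.d2, D1_add h.d2 h'.d2,
    D1_add h.d1 h'.d1]
  ring

theorem Lin_add (h : SmF w) (h' : SmF δ) : Lin (fun S q => w S q + δ S q) =
    fun S q => Lin w S q + Lin δ S q := by
  funext S q
  simp only [Lin, vop_add h h', yop_add h h', Dt_add h.vop h'.vop, D1_add h.yop h'.yop,
    D2_add h.yop h'.yop, Ds_add h.yop h'.yop]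
  ring

theorem Res_add (h : SmF w) (h' : SmF δ) (S : Stage) (q : Q) :
    Res (fun S q => w S q + δ S q) S q =
      Res w S q + Lin δ S q + (Bil w δ S q + Bil δ w S q + Bil δ δ S q) := by
  simp only [Res, Lin_add h h', Bil, vop_add h h', yop_add h h', D1_add h.vop h'.vop,
    D2_add h.vop h'.vop, Ds_add h.vop h'.vop, D1_add h.yop h'.yop,
    D2_add h.yop h'.yop, Ds_add h.yop h'.yop]
  ring

variable {d v v' : Bool} {i j : ℕ}

theorem Sep.coef1 {c : Stage → ℝ → ℝ} (hc : KK d 1 c) (h : Sep d j v W) :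
    Sep d (j + 1) v (fun S q => c S q.1 * W S q) := by
  rw [add_comm]; exact Sep.coef hc h

theorem Sep.vlow (h : Sep d j v w) : Sep d (j + 1) true (vlow w) := by
  have h2 : KK d 0 (fun _ _ => 2) := KK.const 2
  refine ((h.ds.d2.coef' h2).coef1 kk_ν).add (((h.ds.d1.coef' kk_α).coef' h2).coef1 kk_ν)
    |>.add ?_
  refine Sep.coef1 kk_ν (Sep.mono (j := j + 1) ?_ (Nat.le_succ j))
  exact Sep.coef1 kk_ν ((h.d2.d2.add ((h.d2.d1.coef' kk_α).coef' h2)).add (h.d1.d1.coef' kk_β))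

theorem Sep.vop (h : Sep d j v w) : Sep d j v (vop w) :=
  h.ds.ds.add (h.vlow.mono (Nat.le_succ j)).full

theorem Sep.ylow (h : Sep d j v w) : Sep d j true (ylow w) :=
  (h.d2.coef' kk_γ).add (h.d1.coef' kk_γb)

theorem Sep.yop (h : Sep d j v w) : Sep d j v (yop w) :=
  (h.ds.coef' kk_γ).add ((h.ylow.coef1 kk_ν).mono (Nat.le_succ j)).full

theorem Sep.lin (h : Sep true j v w) :
    Sep false (j + 1) true (fun S q => Lin w S q - Dt (Ds (Ds w)) S q) := by
  have hw := h.smF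
  have hy : Sep false j v (IPM.yop w) := (h.lower (d := false)).yop
  have hyl : Sep false j true (IPM.ylow w) := (h.lower (d := false)).ylow
  have key : Sep false (j + 1) true (fun S q => Dt (IPM.vlow w) S q + S.μ q.1 * IPM.vlow w S q -
    (S.ν q.1 * (S.bg q.1 * D1 (IPM.yop w) S q) +
      S.kg q.1 * (S.ν q.1 * Ds (IPM.ylow w) S q + S.ν q.1 * D2 (IPM.yop w) S q))) :=
    (h.vlow.dt.add ((h.lower (d := false)).vlow.coef' kk_μ)).sub
      (((hy.d1.coef' kk_bg).coef1 kk_ν).add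
        (((hyl.ds.coef1 kk_ν).add (hy.d2.coef1 kk_ν)).coef' kk_kg))
  convert key using 1
  funext S q
  have e1 : Ds (IPM.yop w) S q = S.γ q.1 * Ds (Ds w) S q + S.ν q.1 * Ds (IPM.ylow w) S q := by
    have e := Ds_add (SmF.coef (kk_γ (d := false)).smooth hw.ds) (SmF.coef ν_smooth hw.ylow)
    rw [Ds_coef (kk_γ (d := false)).smooth hw.ds, Ds_coef ν_smooth hw.ylow] at e
    exact congrFun (congrFun e S) q
  have e2 : Dt (IPM.vop w) S q = Dt (Ds (Ds w)) S q + Dt (IPM.vlow w) S q :=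
    congrFun (congrFun (Dt_add hw.ds.ds hw.vlow) S) q
  simp only [Lin, e1, e2, IPM.vop, Stage.μ, Stage.γ]
  ring

theorem Sep.bil (h : Sep true i v w) (h' : Sep true j v' δ) :
    Sep false (i + j + 1) true (Bil w δ) := by
  have hy := (h.lower (d := false)).yop
  have hv := (h'.lower (d := false)).vop
  have hνv := (hv.d2.coef1 kk_ν).mono (Nat.le_succ j)
  have hνy := (hy.d2.coef1 kk_ν).mono (Nat.le_succ i)
  have p1 : Sep false (i + j) true _ := hy.d1.mul (hv.ds.add hνv.full)
  have p2 := (hy.ds.add hνy.full).mul hv.d1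
  rw [Bool.or_true] at p2
  exact (((p1.sub p2).coef' kk_bk).coef1 kk_a).neg

end families

/-- Approximate solutions of the profile equation to every order, up to a slow remainder. -/
theorem exists_profile_family {χ H : ℝ → ℝ} (hχ : Cut χ) (hH : Per H) (J : ℕ) :
    ∃ e r m : Fam, Sep true 0 true e ∧ Sep false J true r ∧ Sep false 0 true m ∧ Slow m ∧
      ∀ S q, Res (fun S q => χ q.2.1 * χ q.2.2.1 * H q.2.2.2 + e S q) S q = r S q + m S q := by
  have hmain : Sep true 0 false (fun _ q => χ q.2.1 * χ q.2.2.1 * H q.2.2.2) := by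
    simpa using Sep.term (d := true) (v := false) (KK.const 1) hχ hχ hH (by simp)
  induction J with
  | zero =>
    refine ⟨_, _, _, Sep.zero, ?_, Sep.zero, fun _ _ _ _ _ _ => rfl, fun S q =>
      (add_zero _).symm⟩
    simp only [add_zero]
    have h1 := hmain.lin
    have h2 := hmain.bil hmain
    have h3 : Dt (Ds (Ds (fun _ q => χ q.2.1 * χ q.2.2.1 * H q.2.2.2))) = fun _ _ => 0 := by
      have e1 := Ds_term (c := fun _ _ => 1) (fun _ => contDiff_const) hχ.smooth hχ.smooth
        hH.smooth
      have e2 := Ds_term (c := fun _ _ => 1) (fun _ => contDiff_const) hχ.smooth hχ.smooth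
        hH.deriv.smooth
      simp only [one_mul] at e1 e2
      rw [e1, e2]
      funext S q
      have := dir_term (c := fun _ => 1) contDiff_const hχ.smooth hχ.smooth hH.deriv.deriv.smooth
        (1, 0, 0, 0) q
      simp only [one_mul] at this
      simp [Dt, this]
    rw [h3] at h1
    simp only [sub_zero] at h1
    exact ((h1.mono zero_le_one).add (h2.mono zero_le_one))
  | succ J ih =>
    obtain ⟨e, r, m, he, hr, hm, hsl, hres⟩ := ih
    obtain ⟨m', V, hm', hV, hsl', hdV⟩ := hr.exists_mean
    obtain ⟨δ, hδ, hdt⟩ := hV.neg.exists_primitive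
    have hw := hmain.add he.full
    have hδ0 := hδ.mono (Nat.zero_le J)
    have b1 := hw.bil hδ
    have b2 := hδ.bil hw
    have b3 := hδ0.bil hδ
    simp only [zero_add, add_zero] at b1 b2 b3
    refine ⟨fun S q => e S q + δ S q,
      fun S q => (Lin δ S q - Dt (Ds (Ds δ)) S q) + (Bil _ δ S q + Bil δ _ S q + Bil δ δ S q),
      fun S q => m S q + m' S q, he.add hδ0, hδ.lin.add ((b1.add b2).add b3),
      hm.add (hm'.mono (Nat.zero_le J)), fun S t y1 y2 s s' => ?_, fun S q => ?_⟩
    · simp only [hsl S t y1 y2 s s', hsl' S t y1 y2 s s']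
    · have e1 := Res_add hw.smF hδ.smF S q
      rw [hres] at e1
      simp only [← add_assoc] at e1 ⊢
      rw [e1]
      have e2 : Dt (Ds (Ds δ)) S q = -(r S q - m' S q) := by
        have c1 : Dt (Ds (Ds δ)) S = Ds (Ds (Dt δ)) S := by
          simp only [Dt, Ds]
          rw [dir_comm (contDiff_dir (hδ.smooth S) _), dir_comm (hδ.smooth S)]
        have c2 : Ds (Ds (Dt δ)) S q = -Ds (Ds V) S q := by
          rw [hdt]
          simp only [Ds]
          rw [dir_neg, dir_neg]
        rw [c1, c2, hdV]
      rw [e2]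
      ring

theorem hasFDerivAt_form {c1 c2 : ℝ → ℝ} (h1 : ContDiff ℝ ∞ c1) (h2 : ContDiff ℝ ∞ c2) (p : ST) :
    ∃ L : ST →L[ℝ] ℝ, HasFDerivAt (fun p : ST => c1 p.2 * p.1.1 + c2 p.2 * p.1.2) L p ∧
      ∀ v : ST, L v = c1 p.2 * v.1.1 + c2 p.2 * v.1.2
        + v.2 * (deriv c1 p.2 * p.1.1 + deriv c2 p.2 * p.1.2) := by
  have e2 : HasFDerivAt (fun p : ST => p.2) (ContinuousLinearMap.snd ℝ (ℝ × ℝ) ℝ) p :=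
    hasFDerivAt_snd
  have e1 : HasFDerivAt (fun p : ST => p.1) (ContinuousLinearMap.fst ℝ (ℝ × ℝ) ℝ) p :=
    hasFDerivAt_fst
  have e11 := (hasFDerivAt_fst (𝕜 := ℝ) (p := p.1)).comp p e1
  have e12 := (hasFDerivAt_snd (𝕜 := ℝ) (p := p.1)).comp p e1
  have k1 := (hasDerivAt_of_smooth h1 p.2).comp_hasFDerivAt p e2
  have k2 := (hasDerivAt_of_smooth h2 p.2).comp_hasFDerivAt p e2
  refine ⟨_, (k1.mul e11).add (k2.mul e12), fun v => ?_⟩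
  simp
  ring

/-- The linear phase coordinates of a stage. -/
noncomputable def Stage.coord (n : ℝ) (S : Stage) (p : ST) : Q :=
  (p.2, S.b1 p.2 * p.1.1 + S.b2 p.2 * p.1.2, S.k1 p.2 * p.1.1 + S.k2 p.2 * p.1.2,
    n * (S.k1 p.2 * p.1.1 + S.k2 p.2 * p.1.2))

theorem Stage.smooth_coord (n : ℝ) (S : Stage) : ContDiff ℝ ∞ (S.coord n) := by
  have := S.smooth_b1
  have := S.smooth_b2
  have := S.smooth_k1
  have := S.smooth_k2
  unfold Stage.coord
  fun_prop

theorem Stage.fderiv_coord (n : ℝ) (S : Stage) (p v : ST) :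
    fderiv ℝ (S.coord n) p v = (v.2,
      S.b1 p.2 * v.1.1 + S.b2 p.2 * v.1.2
        + v.2 * (deriv S.b1 p.2 * p.1.1 + deriv S.b2 p.2 * p.1.2),
      S.k1 p.2 * v.1.1 + S.k2 p.2 * v.1.2
        + v.2 * (deriv S.k1 p.2 * p.1.1 + deriv S.k2 p.2 * p.1.2),
      n * (S.k1 p.2 * v.1.1 + S.k2 p.2 * v.1.2
        + v.2 * (deriv S.k1 p.2 * p.1.1 + deriv S.k2 p.2 * p.1.2))) := by
  obtain ⟨L1, hL1, h1⟩ := hasFDerivAt_form S.smooth_b1 S.smooth_b2 p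
  obtain ⟨L2, hL2, h2⟩ := hasFDerivAt_form S.smooth_k1 S.smooth_k2 p
  have e2 : HasFDerivAt (fun p : ST => p.2) (ContinuousLinearMap.snd ℝ (ℝ × ℝ) ℝ) p :=
    hasFDerivAt_snd
  have := (e2.prodMk (hL1.prodMk (hL2.prodMk (hL2.const_mul n)))).fderiv
  change fderiv ℝ (S.coord n) p = _ at this
  rw [this]
  simp [h1, h2]

/-- Evaluation of a family in the phase coordinates, with frequency `n`. -/
noncomputable def ev (n : Stage → ℝ) (W : Fam) (S : Stage) : ST → ℝ :=
  fun p => W S (S.coord (n S) p)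

theorem ev_smooth {W : Fam} (h : SmF W) (n : Stage → ℝ) (S : Stage) : ContDiff ℝ ∞ (ev n W S) :=
  (h S).comp (S.smooth_coord _)

theorem dir_ev {W : Fam} (h : SmF W) (n : Stage → ℝ) (S : Stage) (v p : ST) :
    dir v (ev n W S) p = v.2 * ev n (Dt W) S p
      + (S.b1 p.2 * v.1.1 + S.b2 p.2 * v.1.2
        + v.2 * (deriv S.b1 p.2 * p.1.1 + deriv S.b2 p.2 * p.1.2)) * ev n (D1 W) S p
      + (S.k1 p.2 * v.1.1 + S.k2 p.2 * v.1.2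
        + v.2 * (deriv S.k1 p.2 * p.1.1 + deriv S.k2 p.2 * p.1.2)) *
        (ev n (D2 W) S p + n S * ev n (Ds W) S p) := by
  have h1 := dir_comp (v := v) (p := p) (h S) ((S.smooth_coord (n S)).differentiable (by simp) p)
    (S.fderiv_coord (n S) p v)
  change dir v (ev n W S) p = _ at h1
  rw [h1]
  have hdec : ∀ a b c d : ℝ, ((a, b, c, d) : Q) = a • (1, 0, 0, 0) + b • (0, 1, 0, 0)
      + c • (0, 0, 1, 0) + d • (0, 0, 0, 1) := by
    intro a b c d; simp
  rw [hdec, dir_vec_add, dir_vec_add, dir_vec_add, dir_vec_smul, dir_vec_smul, dir_vec_smul,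
    dir_vec_smul]
  simp only [ev, Dt, D1, D2, Ds]
  ring

noncomputable def Dx (n : Stage → ℝ) (W : Fam) : Fam := fun S q =>
  S.b1 q.1 * D1 W S q + S.k1 q.1 * (D2 W S q + n S * Ds W S q)
noncomputable def Dy (n : Stage → ℝ) (W : Fam) : Fam := fun S q =>
  S.b2 q.1 * D1 W S q + S.k2 q.1 * (D2 W S q + n S * Ds W S q)

theorem SmF.dx {W : Fam} (h : SmF W) (n : Stage → ℝ) : SmF (Dx n W) :=
  (SmF.coef Stage.smooth_b1 h.d1).add (SmF.coef Stage.smooth_k1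
    (h.d2.add (SmF.coef (c := fun S _ => n S) (fun _ => contDiff_const) h.ds)))

theorem SmF.dy {W : Fam} (h : SmF W) (n : Stage → ℝ) : SmF (Dy n W) :=
  (SmF.coef Stage.smooth_b2 h.d1).add (SmF.coef Stage.smooth_k2
    (h.d2.add (SmF.coef (c := fun S _ => n S) (fun _ => contDiff_const) h.ds)))

theorem dx_ev {W : Fam} (h : SmF W) (n : Stage → ℝ) (S : Stage) :
    dx (ev n W S) = ev n (Dx n W) S := by
  funext p
  rw [dx, dir_ev h]
  simp [ev, Dx, Stage.coord]

theorem dy_ev {W : Fam} (h : SmF W) (n : Stage → ℝ) (S : Stage) :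
    dy (ev n W S) = ev n (Dy n W) S := by
  funext p
  rw [dy, dir_ev h]
  simp [ev, Dy, Stage.coord]

section commutation
variable {W : Fam} {c : Stage → ℝ → ℝ}

theorem D1_coef (hc : ∀ S, ContDiff ℝ ∞ (c S)) (h : SmF W) :
    D1 (fun S q => c S q.1 * W S q) = fun S q => c S q.1 * D1 W S q := by
  funext S q; simp [D1, dir_coef (hc S) (h S)]

theorem D2_coef (hc : ∀ S, ContDiff ℝ ∞ (c S)) (h : SmF W) :
    D2 (fun S q => c S q.1 * W S q) = fun S q => c S q.1 * D2 W S q := by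
  funext S q; simp [D2, dir_coef (hc S) (h S)]

theorem Dx_coef (hc : ∀ S, ContDiff ℝ ∞ (c S)) (h : SmF W) (n : Stage → ℝ) :
    Dx n (fun S q => c S q.1 * W S q) = fun S q => c S q.1 * Dx n W S q := by
  funext S q
  simp only [Dx, D1_coef hc h, D2_coef hc h, Ds_coef hc h]
  ring

theorem Dy_coef (hc : ∀ S, ContDiff ℝ ∞ (c S)) (h : SmF W) (n : Stage → ℝ) :
    Dy n (fun S q => c S q.1 * W S q) = fun S q => c S q.1 * Dy n W S q := by
  funext S q
  simp only [Dy, D1_coef hc h, D2_coef hc h, Ds_coef hc h]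
  ring

theorem D2D1 (h : SmF W) : D2 (D1 W) = D1 (D2 W) := funext fun S => dir_comm (h S) _ _
theorem DsD1 (h : SmF W) : Ds (D1 W) = D1 (Ds W) := funext fun S => dir_comm (h S) _ _
theorem DsD2 (h : SmF W) : Ds (D2 W) = D2 (Ds W) := funext fun S => dir_comm (h S) _ _

theorem D1_comb {f1 f2 : Stage → ℝ → ℝ} (n : Stage → ℝ)
    (h1 : ∀ S, ContDiff ℝ ∞ (f1 S)) (h2 : ∀ S, ContDiff ℝ ∞ (f2 S)) (h : SmF W)
    (w : Q) (hw : w.1 = 0) (S : Stage) (q : Q) :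
    dir w (fun q => f1 S q.1 * D1 W S q + f2 S q.1 * (D2 W S q + n S * Ds W S q)) q =
      f1 S q.1 * dir (0, 1, 0, 0) (dir w (W S)) q + f2 S q.1 * (dir (0, 0, 1, 0) (dir w (W S)) q
        + n S * dir (0, 0, 0, 1) (dir w (W S)) q) := by
  have e1 := h.d1
  have e2 := h.d2
  have e3 := h.ds
  have e4 : ContDiff ℝ ∞ (fun q => n S * Ds W S q) := contDiff_const.mul (e3 S)
  have e5 : ContDiff ℝ ∞ (fun q => D2 W S q + n S * Ds W S q) := (e2 S).add e4
  have k1 : ContDiff ℝ ∞ (fun q : Q => f1 S q.1 * D1 W S q) := (SmF.coef h1 e1) S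
  have k2 : ContDiff ℝ ∞ (fun q : Q => f2 S q.1 * (D2 W S q + n S * Ds W S q)) :=
    ((h2 S).comp contDiff_fst).mul e5
  rw [dir_add k1 k2]
  beta_reduce
  rw [dir_coef (h1 S) (e1 S), dir_coef (h2 S) e5, dir_add (e2 S) e4, dir_const_mul (e3 S), hw,
    dir_comm (h S) _ w, dir_comm (h S) _ w, dir_comm (h S) _ w]
  simp only [zero_mul, add_zero]
  rfl

theorem D1_Dx (h : SmF W) (n : Stage → ℝ) : D1 (Dx n W) = Dx n (D1 W) :=
  funext fun S => funext fun q => D1_comb n Stage.smooth_b1 Stage.smooth_k1 h _ rfl S q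
theorem D2_Dx (h : SmF W) (n : Stage → ℝ) : D2 (Dx n W) = Dx n (D2 W) :=
  funext fun S => funext fun q => D1_comb n Stage.smooth_b1 Stage.smooth_k1 h _ rfl S q
theorem Ds_Dx (h : SmF W) (n : Stage → ℝ) : Ds (Dx n W) = Dx n (Ds W) :=
  funext fun S => funext fun q => D1_comb n Stage.smooth_b1 Stage.smooth_k1 h _ rfl S q
theorem D1_Dy (h : SmF W) (n : Stage → ℝ) : D1 (Dy n W) = Dy n (D1 W) :=
  funext fun S => funext fun q => D1_comb n Stage.smooth_b2 Stage.smooth_k2 h _ rfl S q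
theorem D2_Dy (h : SmF W) (n : Stage → ℝ) : D2 (Dy n W) = Dy n (D2 W) :=
  funext fun S => funext fun q => D1_comb n Stage.smooth_b2 Stage.smooth_k2 h _ rfl S q
theorem Ds_Dy (h : SmF W) (n : Stage → ℝ) : Ds (Dy n W) = Dy n (Ds W) :=
  funext fun S => funext fun q => D1_comb n Stage.smooth_b2 Stage.smooth_k2 h _ rfl S q

end commutation

/-- The frequency of a layer. -/
noncomputable abbrev freq : Stage → ℝ := Stage.N

theorem Stage.N_pos (S : Stage) : 0 < S.N := one_pos.trans_le S.one_le_N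

/-- The potential of a layer with profile `w`. -/
noncomputable def pot (w : Fam) : Fam := fun S q =>
  -(S.a q.1 * (S.ν q.1 * S.ν q.1 * S.q q.1)) * w S q

section layer
variable {w : Fam}

theorem smooth_potCoef (S : Stage) :
    ContDiff ℝ ∞ (fun t => -(S.a t * (S.ν t * S.ν t * S.q t))) := by
  have := S.smooth_a
  have := S.smooth_q
  have := ν_smooth S
  fun_prop

theorem SmF.pot (h : SmF w) : SmF (pot w) := SmF.coef smooth_potCoef h

theorem Dx_pot (h : SmF w) : Dx freq (pot w) =
    fun S q => -(S.a q.1 * S.ν q.1) * yop w S q := by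
  funext S q
  have := Dx_coef (c := fun S t => -(S.a t * (S.ν t * S.ν t * S.q t))) smooth_potCoef h freq
  unfold IPM.pot
  rw [this]
  have hN := S.N_pos.ne'
  simp only [Dx, yop, ylow, Stage.ν, Stage.γ, Stage.γb]
  field_simp
  ring

theorem rho_pot (h : SmF w) (S : Stage) : rho (ev freq (pot w) S) =
    ev freq (fun S q => S.a q.1 * vop w S q) S := by
  have hc := smooth_potCoef
  funext p
  simp only [rho]
  rw [dx_ev h.pot, dx_ev (h.pot.dx _), dy_ev h.pot, dy_ev (h.pot.dy _)]
  have eX : Dx freq (Dx freq (pot w)) = fun S q =>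
      -(S.a q.1 * (S.ν q.1 * S.ν q.1 * S.q q.1)) * Dx freq (Dx freq w) S q := by
    unfold IPM.pot
    rw [Dx_coef hc h freq, Dx_coef hc (h.dx _) freq]
  have eY : Dy freq (Dy freq (pot w)) = fun S q =>
      -(S.a q.1 * (S.ν q.1 * S.ν q.1 * S.q q.1)) * Dy freq (Dy freq w) S q := by
    unfold IPM.pot
    rw [Dy_coef hc h freq, Dy_coef hc (h.dy _) freq]
  rw [eX, eY]
  change -(_ * Dx freq (Dx freq w) S (S.coord (freq S) p) +
    _ * Dy freq (Dy freq w) S (S.coord (freq S) p)) = _ * vop w S (S.coord (freq S) p)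
  generalize S.coord (freq S) p = q
  have hX : Dx freq (Dx freq w) S q = S.b1 q.1 * Dx freq (D1 w) S q + S.k1 q.1 *
      (Dx freq (D2 w) S q + S.N * Dx freq (Ds w) S q) := by
    rw [← D1_Dx h, ← D2_Dx h, ← Ds_Dx h]; rfl
  have hY : Dy freq (Dy freq w) S q = S.b2 q.1 * Dy freq (D1 w) S q + S.k2 q.1 *
      (Dy freq (D2 w) S q + S.N * Dy freq (Ds w) S q) := by
    rw [← D1_Dy h, ← D2_Dy h, ← Ds_Dy h]; rfl
  rw [hX, hY]
  have hN := S.N_pos.ne'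
  have hk := (S.k_pos q.1).ne'
  simp only [Dx, Dy, vop, vlow, Stage.ν, Stage.α, Stage.β, Stage.q, D2D1 h, DsD1 h, DsD2 h]
  field_simp
  ring

end layer

section layer
variable {w : Fam}

theorem deriv_a (S : Stage) (t : ℝ) :
    deriv S.a t = deriv S.θ t * S.A t + S.a t * S.μ t := by
  have := (hasDerivAt_of_smooth S.smooth_θ t).mul (hasDerivAt_of_smooth S.smooth_A t)
  change HasDerivAt S.a _ t at this
  rw [this.deriv, S.deriv_A t]
  simp only [Stage.a, Stage.μ, Stage.kg, Stage.q]
  ring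

theorem vel2_pot (h : SmF w) (S : Stage) : vel2 (ev freq (pot w) S) =
    ev freq (fun S q => -(S.a q.1 * S.ν q.1) * Dx freq (yop w) S q) S := by
  have hc : ∀ S : Stage, ContDiff ℝ ∞ (fun t => -(S.a t * S.ν t)) := fun S =>
    (S.smooth_a.mul (ν_smooth S)).neg
  rw [vel2, dx_ev h.pot, Dx_pot h, dx_ev (SmF.coef (c := fun S t => -(S.a t * S.ν t)) hc h.yop),
    Dx_coef (c := fun S t => -(S.a t * S.ν t)) hc h.yop]

theorem vel1_pot (h : SmF w) (S : Stage) : vel1 (ev freq (pot w) S) =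
    ev freq (fun S q => (S.a q.1 * S.ν q.1) * Dy freq (yop w) S q) S := by
  have hc : ∀ S : Stage, ContDiff ℝ ∞ (fun t => -(S.a t * S.ν t)) := fun S =>
    (S.smooth_a.mul (ν_smooth S)).neg
  funext p
  rw [vel1, show dx (dy (ev freq (pot w) S)) = dy (dx (ev freq (pot w) S)) from
    dir_comm (ev_smooth h.pot _ S) _ _, dx_ev h.pot, Dx_pot h,
    dy_ev (SmF.coef (c := fun S t => -(S.a t * S.ν t)) hc h.yop),
    Dy_coef (c := fun S t => -(S.a t * S.ν t)) hc h.yop]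
  simp only [ev]
  ring

/-- The source created by adding a layer to a background. -/
noncomputable def gain (w : Fam) : Fam := fun S q =>
  deriv S.θ q.1 * S.A q.1 * vop w S q + S.a q.1 * Res w S q

theorem force_layer (h : SmF w) (S : Stage) {φ : ST → ℝ} (hφ : ContDiff ℝ ∞ φ) {p : ST}
    (h1 : dx (rho φ) p = S.g1 p.2) (h2 : dy (rho φ) p = S.g2 p.2)
    (hb : deriv S.b1 p.2 * p.1.1 + deriv S.b2 p.2 * p.1.2
      + (S.b1 p.2 * vel1 φ p + S.b2 p.2 * vel2 φ p) = 0)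
    (hk : deriv S.k1 p.2 * p.1.1 + deriv S.k2 p.2 * p.1.2
      + (S.k1 p.2 * vel1 φ p + S.k2 p.2 * vel2 φ p) = 0) :
    force (fun p => φ p + ev freq (pot w) S p) p = force φ p + ev freq (gain w) S p := by
  have ha := Stage.smooth_a
  have hR : SmF (fun S q => S.a q.1 * vop w S q) := SmF.coef ha h.vop
  rw [force_add hφ (ev_smooth h.pot _ S), rho_pot h, vel1_pot h, vel2_pot h, h1, h2, dx_ev hR,
    dy_ev hR, Dx_coef ha h.vop, Dy_coef ha h.vop, dt, dir_ev hR, D1_coef ha h.vop,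
    D2_coef ha h.vop, Ds_coef ha h.vop]
  have hdt : Dt (fun S q => S.a q.1 * vop w S q) = fun S q => S.a q.1 * Dt (vop w) S q
      + deriv S.a q.1 * vop w S q := by
    funext S q; simp [Dt, dir_coef (ha S) (h.vop S)]
  rw [hdt]
  simp only [ev, gain, Res, Lin, Bil, deriv_a]
  have hq : (S.coord (freq S) p).1 = p.2 := rfl
  generalize S.coord (freq S) p = q at *
  simp only [Dx, Dy, hq, Stage.bg, Stage.kg, Stage.bk]
  have hν : S.ν p.2 * S.N = 1 := by
    simp only [Stage.ν]; field_simp [S.N_pos.ne']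
  have hb' := eq_neg_of_add_eq_zero_left hb
  have hk' := eq_neg_of_add_eq_zero_left hk
  simp only [one_mul, mul_zero, zero_add, hb', hk']
  linear_combination (S.a p.2 * (S.g1 p.2 * S.k2 p.2 - S.g2 p.2 * S.k1 p.2) * Ds (yop w) S q +
    S.a p.2 ^ 2 * (S.b1 p.2 * S.k2 p.2 - S.b2 p.2 * S.k1 p.2) *
    (Ds (yop w) S q * D1 (vop w) S q - D1 (yop w) S q * Ds (vop w) S q)) * hν

end layer

section iterates
variable {f g : ST → ℝ}

theorem dx_dy_iterate_add (hf : ContDiff ℝ ∞ f) (hg : ContDiff ℝ ∞ g) (i j : ℕ) :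
    dx^[i] (dy^[j] (fun p => f p + g p)) =
      fun p => dx^[i] (dy^[j] f) p + dx^[i] (dy^[j] g) p := by
  have h1 : ∀ j, dy^[j] (fun p => f p + g p) = fun p => dy^[j] f p + dy^[j] g p := by
    intro j
    induction j with
    | zero => rfl
    | succ j ih =>
      rw [Function.iterate_succ_apply', ih, dy, dir_add (contDiff_dy_iterate hf j)
        (contDiff_dy_iterate hg j), Function.iterate_succ_apply', Function.iterate_succ_apply']
  rw [h1]
  have hf' := contDiff_dy_iterate hf j
  have hg' := contDiff_dy_iterate hg j
  induction i with
  | zero => rfl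
  | succ i ih =>
    rw [Function.iterate_succ_apply', ih, dx, dir_add (contDiff_dx_iterate hf' i)
      (contDiff_dx_iterate hg' i), Function.iterate_succ_apply', Function.iterate_succ_apply']

theorem dir_time_coef {c : ℝ → ℝ} (hc : ContDiff ℝ ∞ c) (hf : ContDiff ℝ ∞ f) (v : ℝ × ℝ) :
    dir ((v, 0) : ST) (fun p => c p.2 * f p) = fun p => c p.2 * dir ((v, 0) : ST) f p := by
  have hc' : ContDiff ℝ ∞ (fun p : ST => c p.2) := hc.comp contDiff_snd
  funext p
  rw [dir_mul hc' hf]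
  have : dir ((v, 0) : ST) (fun p : ST => c p.2) p = 0 := by
    have := dir_comp (v := ((v, 0) : ST)) hc (L := fun q : ST => q.2) (p := p)
      differentiableAt_snd (L' := 0) (by rw [fderiv_snd]; rfl)
    rw [this]
    simp [dir]
  simp [this]

theorem dx_dy_iterate_time_coef {c : ℝ → ℝ} (hc : ContDiff ℝ ∞ c) (hf : ContDiff ℝ ∞ f)
    (i j : ℕ) : dx^[i] (dy^[j] (fun p => c p.2 * f p)) =
      fun p => c p.2 * dx^[i] (dy^[j] f) p := by
  have h1 : ∀ j, dy^[j] (fun p => c p.2 * f p) = fun p => c p.2 * dy^[j] f p := by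
    intro j
    induction j with
    | zero => rfl
    | succ j ih =>
      rw [Function.iterate_succ_apply', ih, dy, dir_time_coef hc (contDiff_dy_iterate hf j),
        Function.iterate_succ_apply']
  rw [h1]
  have hf' := contDiff_dy_iterate hf j
  induction i with
  | zero => rfl
  | succ i ih =>
    rw [Function.iterate_succ_apply', ih, dx, dir_time_coef hc (contDiff_dx_iterate hf' i),
      Function.iterate_succ_apply']

theorem dx_dy_iterate_congr_slice (hf : ContDiff ℝ ∞ f) (hg : ContDiff ℝ ∞ g) {t : ℝ}
    (h : ∀ x, f (x, t) = g (x, t)) (i j : ℕ) (x : ℝ × ℝ) :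
    dx^[i] (dy^[j] f) (x, t) = dx^[i] (dy^[j] g) (x, t) := by
  have h1 := congrFun (pdMix_slice hf i j t) x
  have h2 := congrFun (pdMix_slice hg i j t) x
  rw [← h1, ← h2, show (fun x => f (x, t)) = fun x => g (x, t) from funext h]

end iterates

section bounds
variable {j : ℕ} {v : Bool} {W : Fam} {n : Stage → ℝ}

theorem Sep.dxN (h : Sep false j v W) (hn : KK false 0 (fun S _ => 1 / n S))
    {c1 c2 : Stage → ℝ → ℝ} (h1 : KK false 0 c1) (h2 : KK false 0 c2) :
    Sep false j v (fun S q => 1 / n S * (c1 S q.1 * D1 W S q + c2 S q.1 * D2 W S q) +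
      c2 S q.1 * Ds W S q) := by
  refine Sep.add ?_ (Sep.coef' h2 h.ds)
  exact Sep.coef' hn ((Sep.coef' h1 h.d1.full).add (Sep.coef' h2 h.d2.full))

theorem iterate_ev (h : Sep false j v W) (hn0 : ∀ S, n S ≠ 0)
    (hn : KK false 0 (fun S _ => 1 / n S)) (i k : ℕ) :
    ∃ V, Sep false j v V ∧ ∀ S, dx^[i] (dy^[k] (ev n W S)) = fun p => n S ^ (i + k) * ev n V S p := by
  have hy : ∀ k, ∃ V, Sep false j v V ∧ ∀ S, dy^[k] (ev n W S) =
      fun p => n S ^ k * ev n V S p := by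
    intro k
    induction k with
    | zero => exact ⟨W, h, fun S => by simp⟩
    | succ k ih =>
      obtain ⟨V, hV, e⟩ := ih
      refine ⟨_, hV.dxN hn kk_b2 kk_k2, fun S => ?_⟩
      have := hn0 S
      rw [Function.iterate_succ_apply', e, dy, dir_const_mul (ev_smooth hV.smF n S)]
      funext p
      have h3 := congrFun (dy_ev hV.smF n S) p
      rw [dy] at h3
      rw [h3]
      simp only [ev, Dy]
      field_simp
      ring
  obtain ⟨V, hV, e⟩ := hy k
  induction i with
  | zero => exact ⟨V, hV, fun S => by simp [e]⟩
  | succ i ih =>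
    obtain ⟨V, hV, e⟩ := ih
    refine ⟨_, hV.dxN hn kk_b1 kk_k1, fun S => ?_⟩
    have := hn0 S
    rw [Function.iterate_succ_apply', e, dx, dir_const_mul (ev_smooth hV.smF n S)]
    funext p
    have h3 := congrFun (dx_ev hV.smF n S) p
    rw [dx] at h3
    rw [h3]
    simp only [ev, Dx]
    field_simp
    ring

theorem iterate_bound (h : Sep false j v W) (hn0 : ∀ S, n S ≠ 0)
    (hn : KK false 0 (fun S _ => 1 / n S)) (K : ℕ) :
    ∃ (C : ℝ) (m : ℕ), 0 ≤ C ∧ ∀ i k, i + k ≤ K → ∀ S : Stage, ∀ p : ST, p.2 ∈ Set.Icc S.s0 1 →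
      |dx^[i] (dy^[k] (ev n W S)) p| ≤ C * S.X ^ m * S.η ^ j * |n S| ^ (i + k) := by
  have hex : ∀ ik : ℕ × ℕ, ∃ (C : ℝ) (m : ℕ), 0 ≤ C ∧ ∀ S : Stage, ∀ p : ST,
      p.2 ∈ Set.Icc S.s0 1 →
      |dx^[ik.1] (dy^[ik.2] (ev n W S)) p| ≤ C * S.X ^ m * S.η ^ j * |n S| ^ (ik.1 + ik.2) := by
    rintro ⟨i, k⟩
    obtain ⟨V, hV, e⟩ := iterate_ev h hn0 hn i k
    obtain ⟨C, m, hC, hb⟩ := hV.bound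
    refine ⟨C, m, hC, fun S p hp => ?_⟩
    simp only [e, abs_mul, abs_pow]
    rw [mul_comm]
    gcongr
    exact hb S _ hp
  choose C m hC hb using hex
  let s := Finset.range (K + 1) ×ˢ Finset.range (K + 1)
  refine ⟨∑ x ∈ s, C x, ∑ x ∈ s, m x, Finset.sum_nonneg fun x _ => hC x,
    fun i k hik S p hp => (hb (i, k) S p hp).trans ?_⟩
  have hm : (i, k) ∈ s := by simp [s]; omega
  refine mul_le_mul_of_nonneg_right ?_ (by positivity)
  exact S.bound_mono (hC _) (Finset.single_le_sum (f := C) (fun x _ => hC x) hm)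
    (Finset.single_le_sum (f := m) (fun x _ => Nat.zero_le _) hm) le_rfl

end bounds

/-- The profile at inner points behaves like the pure phase `s ^ 3 / 6`. -/
def InnerPhase (w : Fam) : Prop := ∀ (S : Stage) (q : Q), |q.2.1| < 1 / 2 → |q.2.2.1| < 1 / 2 →
  |q.2.2.2| < 11 / 10 → D1 (vop w) S q = 0 ∧ D2 (vop w) S q = 0 ∧ Ds (vop w) S q = 1 ∧
    D1 (yop w) S q = 0 ∧ D2 (yop w) S q = 0 ∧ Ds (yop w) S q = S.γ q.1 * q.2.2.2

theorem innerPhase_of_profile {χ H : ℝ → ℝ} {e : Fam} (hχ : Cut χ) (h1 : ∀ y, |y| < 1 / 2 → χ y = 1)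
    (hH : Per H) (hs : ∀ s, |s| < 11 / 10 → deriv (deriv H) s = s) (he : Sep true 0 true e) :
    InnerPhase (fun S q => χ q.2.1 * χ q.2.2.1 * H q.2.2.2 + e S q) := by
  have hmain : ∀ {H}, Per H → Sep false 0 false (fun _ q => χ q.2.1 * χ q.2.2.1 * H q.2.2.2) := by
    intro H hH
    simpa using Sep.term (d := false) (v := false) (KK.const 1) hχ hχ hH (by simp)
  have he' : Sep false 0 true e := he.lower
  have hw : Sep false 0 false (fun S q => χ q.2.1 * χ q.2.2.1 * H q.2.2.2 + e S q) :=
    (hmain hH).add he'.full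
  have hDs : ∀ {H}, Per H → ∀ {e : Fam}, Sep false 0 true e →
      Ds (fun S q => χ q.2.1 * χ q.2.2.1 * H q.2.2.2 + e S q) =
      fun S q => χ q.2.1 * χ q.2.2.1 * deriv H q.2.2.2 + Ds e S q := by
    intro H hH e he
    rw [Ds_add (hmain hH).smF he.smF]
    have := Ds_term (c := fun _ _ => 1) (f1 := χ) (f2 := χ) (h := H) (fun _ => contDiff_const)
      hχ.smooth hχ.smooth hH.smooth
    simp only [one_mul] at this
    rw [this]
  intro S q q1 q2 q3
  have hv := hw.vop
  have hy := hw.yop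
  refine ⟨hv.d1.eq_zero_of_inner S q1 q2, hv.d2.eq_zero_of_inner S q1 q2, ?_,
    hy.d1.eq_zero_of_inner S q1 q2, hy.d2.eq_zero_of_inner S q1 q2, ?_⟩
  · have hlow := hw.vlow
    unfold vop
    rw [Ds_add hw.ds.ds.smF hlow.smF]
    beta_reduce
    rw [hlow.ds.eq_zero_of_inner S q1 q2, hDs hH he',
      hDs hH.deriv he'.ds, hDs hH.deriv.deriv he'.ds.ds]
    beta_reduce
    rw [he'.ds.ds.ds.eq_zero_of_inner S q1 q2]
    simp only [h1 _ q1, h1 _ q2]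
    have : deriv (deriv H) =ᶠ[𝓝 q.2.2.2] fun s => s := by
      filter_upwards [(isOpen_lt continuous_abs continuous_const).mem_nhds q3] with s hs'
      exact hs s hs'
    rw [this.deriv_eq]
    simp
  · have hlow := hw.ylow
    have hγ : ∀ S : Stage, ContDiff ℝ ∞ S.γ := (kk_γ (d := false)).smooth
    unfold yop
    rw [Ds_add (SmF.coef hγ hw.ds.smF) (SmF.coef ν_smooth hlow.smF), Ds_coef hγ hw.ds.smF,
      Ds_coef ν_smooth hlow.smF]
    beta_reduce
    rw [hlow.ds.eq_zero_of_inner S q1 q2, hDs hH he',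
      hDs hH.deriv he'.ds]
    beta_reduce
    rw [he'.ds.ds.eq_zero_of_inner S q1 q2]
    simp only [h1 _ q1, h1 _ q2, hs _ q3]
    ring

/-- A layer profile, with small gain of source up to order `K`. -/
structure IsLayer (K J : ℕ) (w : Fam) : Prop where
  smooth : SmF w
  supp : ∀ (S : Stage) (q : Q), (1 < |q.2.1| ∨ 1 < |q.2.2.1|) → w S q = 0
  supp_gain : ∀ (S : Stage) (q : Q), (1 < |q.2.1| ∨ 1 < |q.2.2.1|) → gain w S q = 0
  smooth_gain : SmF (gain w)
  inner : InnerPhase w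
  bound : ∃ (C : ℝ) (m : ℕ), 0 ≤ C ∧ ∀ i k, i + k ≤ K → ∀ S : Stage, ∀ p : ST,
    p.2 ∈ Set.Icc S.s0 1 → |dx^[i] (dy^[k] (ev freq (gain w) S)) p| ≤
      C * S.X ^ m * (S.N ^ K * (|deriv S.θ p.2 * S.A p.2| + S.η ^ (J + 1)) + S.η)

theorem exists_layer (K J : ℕ) : ∃ w, IsLayer K J w := by
  obtain ⟨χ, hχ, h1⟩ := exists_cut
  obtain ⟨H, hH, hs⟩ := exists_profile
  obtain ⟨e, r, m, he, hr, hm, hslow, hres⟩ := exists_profile_family hχ hH J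
  set w : Fam := fun S q => χ q.2.1 * χ q.2.2.1 * H q.2.2.2 + e S q with hw_def
  have hmain : Sep false 0 false (fun _ q => χ q.2.1 * χ q.2.2.1 * H q.2.2.2) := by
    simpa using Sep.term (d := false) (v := false) (KK.const 1) hχ hχ hH (by simp)
  have hw : Sep false 0 false w := hmain.add he.lower.full
  have hR : ∀ S q, gain w S q = deriv S.θ q.1 * S.A q.1 * vop w S q +
      (S.a q.1 * r S q + S.a q.1 * m S q) := by
    intro S q
    rw [gain, hres]; ring
  have hr1 : Sep false (1 + J) true (fun S q => S.a q.1 * r S q) := Sep.coef kk_a hr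
  have hm1 : Sep false (1 + 0) true (fun S q => S.a q.1 * m S q) := Sep.coef kk_a hm
  have hθ : ∀ S : Stage, ContDiff ℝ ∞ (fun t => deriv S.θ t * S.A t) := fun S =>
    (contDiff_deriv S.smooth_θ).mul S.smooth_A
  have hg : gain w = fun S q => deriv S.θ q.1 * S.A q.1 * vop w S q +
      (S.a q.1 * r S q + S.a q.1 * m S q) := funext fun S => funext fun q => hR S q
  have hv := hw.vop
  have hv' : SmF (fun S q => deriv S.θ q.1 * S.A q.1 * vop w S q) :=
    SmF.coef (c := fun S t => deriv S.θ t * S.A t) hθ hv.smF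
  refine ⟨w, hw.smF, fun S q hq => hw.eq_zero_of_supp S hq, fun S q hq => ?_, ?_,
    innerPhase_of_profile hχ h1 hH hs he, ?_⟩
  · rw [hR, hv.eq_zero_of_supp S hq, hr1.eq_zero_of_supp S hq, hm1.eq_zero_of_supp S hq]
    simp
  · rw [hg]
    exact hv'.add (hr1.smF.add hm1.smF)
  · have hNK : KK false 0 (fun S _ => 1 / freq S) := kk_invN.mono (Nat.zero_le _)
    obtain ⟨C1, m1, hC1, b1⟩ := iterate_bound hv (fun S => S.N_pos.ne') hNK K
    obtain ⟨C2, m2, hC2, b2⟩ := iterate_bound hr1 (fun S => S.N_pos.ne') hNK K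
    obtain ⟨C3, m3, hC3, b3⟩ := iterate_bound (n := fun _ => 1) hm1 (fun _ => one_ne_zero)
      (by simpa using KK.const 1) K
    refine ⟨C1 + C2 + C3, m1 + m2 + m3, by positivity, fun i k hik S p hp => ?_⟩
    have hslow' : ev freq (fun S q => S.a q.1 * m S q) S =
        ev (fun _ => 1) (fun S q => S.a q.1 * m S q) S := by
      funext p
      simp only [ev, Stage.coord]
      rw [hslow]
    have hdec : ev freq (gain w) S = fun p => (fun t => deriv S.θ t * S.A t) p.2 *
        ev freq (vop w) S p + (ev freq (fun S q => S.a q.1 * r S q) S p +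
          ev (fun _ => 1) (fun S q => S.a q.1 * m S q) S p) := by
      rw [← hslow']
      funext p
      simp only [ev, hR]
      rfl
    have s1 : ContDiff ℝ ∞ (ev freq (vop w) S) := ev_smooth hv.smF _ S
    have s2 : ContDiff ℝ ∞ (ev freq (fun S q => S.a q.1 * r S q) S) := ev_smooth hr1.smF _ S
    have s3 : ContDiff ℝ ∞ (ev (fun _ => 1) (fun S q => S.a q.1 * m S q) S) :=
      ev_smooth hm1.smF _ S
    have s0 : ContDiff ℝ ∞ (fun p : ST => (fun t => deriv S.θ t * S.A t) p.2 *
        ev freq (vop w) S p) := ((hθ S).comp contDiff_snd).mul s1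
    rw [hdec, dx_dy_iterate_add s0 (s2.add s3),
      dx_dy_iterate_add s2 s3, dx_dy_iterate_time_coef (hθ S) s1]
    have hN := S.one_le_N
    have hX := S.one_le_X
    have hη := S.η_pos
    have t1 := b1 i k hik S p hp
    have t2 := b2 i k hik S p hp
    have t3 := b3 i k hik S p hp
    have hNp : |S.N| ^ (i + k) ≤ S.N ^ K := by
      rw [abs_of_pos S.N_pos]
      exact pow_le_pow_right₀ hN hik
    have x1 := S.X_pow_le (show m1 ≤ m1 + m2 + m3 by omega)
    have x2 := S.X_pow_le (show m2 ≤ m1 + m2 + m3 by omega)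
    have x3 := S.X_pow_le (show m3 ≤ m1 + m2 + m3 by omega)
    simp only [abs_one, one_pow, mul_one, add_zero, pow_one, pow_zero] at t1 t2 t3
    set P := S.X ^ (m1 + m2 + m3)
    set T := |deriv S.θ p.2 * S.A p.2|
    have hP : 0 ≤ P := by positivity
    have t1' : |dx^[i] (dy^[k] (ev freq (vop w) S)) p| ≤ C1 * P * S.N ^ K :=
      t1.trans (by gcongr)
    have t2' : |dx^[i] (dy^[k] (ev freq (fun S q => S.a q.1 * r S q) S)) p| ≤
      C2 * P * S.η ^ (J + 1) * S.N ^ K := t2.trans (by rw [add_comm 1 J]; gcongr)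
    have t3' : |dx^[i] (dy^[k] (ev (fun _ => 1) (fun S q => S.a q.1 * m S q) S)) p| ≤
      C3 * P * S.η := t3.trans (by gcongr)
    calc _ ≤ |deriv S.θ p.2 * S.A p.2 * dx^[i] (dy^[k] (ev freq (vop w) S)) p| + (_ + _) :=
          (abs_add_le _ _).trans (add_le_add le_rfl (abs_add_le _ _))
      _ ≤ T * (C1 * P * S.N ^ K) + (C2 * P * S.η ^ (J + 1) * S.N ^ K + C3 * P * S.η) := by
          rw [abs_mul]
          gcongr
      _ ≤ _ := by
          have e1 : 0 ≤ P * S.N ^ K * T := by positivity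
          have e2 : 0 ≤ P * S.N ^ K * S.η ^ (J + 1) := by positivity
          have e3 : 0 ≤ P * S.η := by positivity
          nlinarith [mul_nonneg hC1 e2, mul_nonneg hC1 e3, mul_nonneg hC2 e1, mul_nonneg hC2 e3,
            mul_nonneg hC3 e1, mul_nonneg hC3 e2]

/-- A potential with a layer added to it. -/
noncomputable def addLayer (w : Fam) (S : Stage) (φ : ST → ℝ) : ST → ℝ :=
  fun p => φ p + ev freq (pot w) S p

/-- The linear forms bounding a layer. -/
noncomputable def lin (c1 c2 : ℝ → ℝ) (p : ST) : ℝ := c1 p.2 * p.1.1 + c2 p.2 * p.1.2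

theorem continuous_lin {c1 c2 : ℝ → ℝ} (h1 : ContDiff ℝ ∞ c1) (h2 : ContDiff ℝ ∞ c2) :
    Continuous (lin c1 c2) := by
  have := h1.continuous
  have := h2.continuous
  unfold lin
  fun_prop

/-- A background on which a layer can be added. -/
structure Background (S : Stage) (φ : ST → ℝ) : Prop where
  smooth : ContDiff ℝ ∞ φ
  dx_rho : ∀ p : ST, p.2 ∈ Set.Icc S.s0 1 → |lin S.b1 S.b2 p| ≤ 1 → |lin S.k1 S.k2 p| ≤ 1 →
    dx (rho φ) p = S.g1 p.2
  dy_rho : ∀ p : ST, p.2 ∈ Set.Icc S.s0 1 → |lin S.b1 S.b2 p| ≤ 1 → |lin S.k1 S.k2 p| ≤ 1 →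
    dy (rho φ) p = S.g2 p.2
  transport_b : ∀ p : ST, p.2 ∈ Set.Icc S.s0 1 → |lin S.b1 S.b2 p| ≤ 1 → |lin S.k1 S.k2 p| ≤ 1 →
    lin (deriv S.b1) (deriv S.b2) p + (S.b1 p.2 * vel1 φ p + S.b2 p.2 * vel2 φ p) = 0
  transport_k : ∀ p : ST, p.2 ∈ Set.Icc S.s0 1 → |lin S.b1 S.b2 p| ≤ 1 → |lin S.k1 S.k2 p| ≤ 1 →
    lin (deriv S.k1) (deriv S.k2) p + (S.k1 p.2 * vel1 φ p + S.k2 p.2 * vel2 φ p) = 0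

section layer
variable {K J : ℕ} {w : Fam} {S : Stage} {φ : ST → ℝ}

theorem IsLayer.smooth_addLayer (hw : IsLayer K J w) (h : ContDiff ℝ ∞ φ) :
    ContDiff ℝ ∞ (addLayer w S φ) := h.add (ev_smooth hw.smooth.pot _ S)

theorem addLayer_of_le {p : ST} (hp : p.2 ≤ S.s0) : addLayer w S φ p = φ p := by
  simp [addLayer, ev, pot, Stage.coord, Stage.a, S.θ_zero _ hp]

theorem IsLayer.addLayer_of_outside (hw : IsLayer K J w) {p : ST}
    (hp : 1 < |lin S.b1 S.b2 p| ∨ 1 < |lin S.k1 S.k2 p|) :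
    addLayer w S φ =ᶠ[𝓝 p] φ := by
  have o1 : IsOpen {p : ST | 1 < |lin S.b1 S.b2 p| ∨ 1 < |lin S.k1 S.k2 p|} :=
    (isOpen_lt continuous_const (continuous_lin S.smooth_b1 S.smooth_b2).abs).union
      (isOpen_lt continuous_const (continuous_lin S.smooth_k1 S.smooth_k2).abs)
  filter_upwards [o1.mem_nhds hp] with q hq
  have : w S (S.coord S.N q) = 0 := hw.supp S _ hq
  simp [addLayer, ev, pot, this]

theorem IsLayer.force_addLayer (hw : IsLayer K J w) (h : Background S φ) {p : ST}
    (hp : p.2 ∈ Set.Icc S.s0 1) :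
    force (addLayer w S φ) p = force φ p + ev freq (gain w) S p := by
  by_cases hq : 1 < |lin S.b1 S.b2 p| ∨ 1 < |lin S.k1 S.k2 p|
  · rw [(force_congr (hw.addLayer_of_outside hq)).eq_of_nhds]
    have : gain w S (S.coord S.N p) = 0 := hw.supp_gain S _ hq
    simp [ev, this]
  · push Not at hq
    exact force_layer hw.smooth S h.smooth (h.dx_rho p hp hq.1 hq.2) (h.dy_rho p hp hq.1 hq.2)
      (h.transport_b p hp hq.1 hq.2) (h.transport_k p hp hq.1 hq.2)

theorem force_addLayer_of_lt {p : ST} (hp : p.2 < S.s0) :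
    force (addLayer w S φ) p = force φ p := by
  have : addLayer w S φ =ᶠ[𝓝 p] φ := by
    filter_upwards [(isOpen_lt continuous_snd continuous_const).mem_nhds hp] with q hq
    exact addLayer_of_le (le_of_lt hq)
  exact (force_congr this).eq_of_nhds

theorem IsLayer.exists_force_bound (hw : IsLayer K J w) : ∃ (C : ℝ) (m : ℕ), 0 ≤ C ∧
    ∀ (S : Stage) (φ : ST → ℝ), Background S φ → ∀ i k, i + k ≤ K → ∀ p : ST, p.2 ≤ 1 →
      |dx^[i] (dy^[k] (force (addLayer w S φ))) p - dx^[i] (dy^[k] (force φ)) p| ≤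
      C * S.X ^ m * (S.N ^ K * (|deriv S.θ p.2 * S.A p.2| + S.η ^ (J + 1)) + S.η) := by
  obtain ⟨C, m, hC, hb⟩ := hw.bound
  refine ⟨C, m, hC, fun S φ hφ i k hik ⟨x, t⟩ hp => ?_⟩
  have s1 := contDiff_force hφ.smooth
  have s2 := contDiff_force (hw.smooth_addLayer (S := S) hφ.smooth)
  have s3 : ContDiff ℝ ∞ (ev freq (gain w) S) := ev_smooth hw.smooth_gain _ S
  rcases lt_or_ge t S.s0 with ht | ht
  · rw [dx_dy_iterate_congr_slice s2 s1 (fun x => force_addLayer_of_lt ht) i k x]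
    have := S.X_pos
    have := S.N_pos
    have := S.η_pos
    rw [sub_self, abs_zero]
    positivity
  · rw [dx_dy_iterate_congr_slice s2 (s1.add s3) (fun x => hw.force_addLayer hφ ⟨ht, hp⟩) i k x,
      dx_dy_iterate_add s1 s3, add_sub_cancel_left]
    exact hb i k hik S _ ⟨ht, hp⟩

theorem IsLayer.inner_formulas (hw : IsLayer K J w) (hφ : ContDiff ℝ ∞ φ) {p : ST}
    (h1 : |lin S.b1 S.b2 p| < 1 / 2) (h2 : |lin S.k1 S.k2 p| < 1 / 2)
    (h3 : |S.N * lin S.k1 S.k2 p| < 11 / 10) :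
    dx (rho (addLayer w S φ)) p = dx (rho φ) p + S.a p.2 * (S.N * S.k1 p.2) ∧
    dy (rho (addLayer w S φ)) p = dy (rho φ) p + S.a p.2 * (S.N * S.k2 p.2) ∧
    vel1 (addLayer w S φ) p = vel1 φ p +
      S.a p.2 * S.γ p.2 * (S.N * lin S.k1 S.k2 p) * S.k2 p.2 ∧
    vel2 (addLayer w S φ) p = vel2 φ p -
      S.a p.2 * S.γ p.2 * (S.N * lin S.k1 S.k2 p) * S.k1 p.2 := by
  obtain ⟨e1, e2, e3, e4, e5, e6⟩ := hw.inner S (S.coord S.N p) h1 h2 h3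
  have hP : ContDiff ℝ ∞ (ev freq (pot w) S) := ev_smooth hw.smooth.pot _ S
  have ha := Stage.smooth_a
  have hR : SmF (fun S q => S.a q.1 * vop w S q) := SmF.coef ha hw.smooth.vop
  have hν : S.ν p.2 * S.N = 1 := by
    simp only [Stage.ν]; field_simp [S.N_pos.ne']
  have r : rho (addLayer w S φ) = fun p => rho φ p + rho (ev freq (pot w) S) p := rho_add hφ hP
  have rx : dx (rho (addLayer w S φ)) p = dx (rho φ) p + dx (rho (ev freq (pot w) S)) p := by
    rw [r, dx, dir_add (contDiff_rho hφ) (contDiff_rho hP)]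
  have ry : dy (rho (addLayer w S φ)) p = dy (rho φ) p + dy (rho (ev freq (pot w) S)) p := by
    rw [r, dy, dir_add (contDiff_rho hφ) (contDiff_rho hP)]
  have u1 : vel1 (addLayer w S φ) = fun p => vel1 φ p + vel1 (ev freq (pot w) S) p :=
    vel1_add hφ hP
  have u2 : vel2 (addLayer w S φ) = fun p => vel2 φ p + vel2 (ev freq (pot w) S) p :=
    vel2_add hφ hP
  rw [rx, ry, u1, u2, rho_pot hw.smooth, dx_ev hR, dy_ev hR, Dx_coef ha hw.smooth.vop,
    Dy_coef ha hw.smooth.vop, vel1_pot hw.smooth, vel2_pot hw.smooth]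
  simp only [ev, Dx, Dy, e1, e2, e3, e4, e5, e6]
  have hq : (S.coord S.N p).1 = p.2 := rfl
  have hq' : (S.coord S.N p).2.2.2 = S.N * lin S.k1 S.k2 p := rfl
  rw [hq, hq']
  refine ⟨by ring, by ring, ?_, ?_⟩
  · linear_combination S.a p.2 * S.γ p.2 * (S.N * lin S.k1 S.k2 p) * S.k2 p.2 * hν
  · linear_combination -S.a p.2 * S.γ p.2 * (S.N * lin S.k1 S.k2 p) * S.k1 p.2 * hν

end layer

section phase
variable {G ε Y : ℝ}

theorem phase_bounds {z f E : ℝ → ℝ} {s0 te : ℝ} (hε : 0 < ε) (hε1 : ε ≤ 1) (hG : 0 < G)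
    (hY : 0 ≤ Y) (hYG : 10 ^ 6 * Y ≤ G * ε ^ 2) (hs : s0 ≤ te) (hte : te ≤ 1)
    (hlen : (1 - s0) * (G * ε ^ 2) ≤ 51)
    (hz : ∀ t ∈ Set.Icc s0 1, HasDerivAt z (f t + E t) t)
    (hf : ∀ t ∈ Set.Icc s0 1, G * ε / 5 ≤ f t ∧ f t ≤ 4 * (G * ε))
    (hE : ∀ t ∈ Set.Icc s0 1, |E t| ≤ 2 * Y * |z t| + Y) (hze : |z te| ≤ 3 / ε) :
    ∀ t ∈ Set.Icc s0 1, |z t| ≤ 208 / ε ∧ |E t| ≤ G * ε / 40 := by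
  have hle : s0 ≤ 1 := hs.trans hte
  have hcont : ContinuousOn (fun t => |z t|) (Set.Icc s0 1) := fun t ht =>
    (hz t ht).continuousAt.abs.continuousWithinAt
  obtain ⟨ts, hts, hmax⟩ := isCompact_Icc.exists_isMaxOn (Set.nonempty_Icc.2 hle) hcont
  set M := |z ts| with hM
  have hM0 : 0 ≤ M := abs_nonneg _
  have hdz : ∀ t ∈ Set.Icc s0 1, ‖f t + E t‖ ≤ 4 * (G * ε) + (2 * Y * M + Y) := by
    intro t ht
    obtain ⟨h1, h2⟩ := hf t ht
    have h3 := hE t ht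
    have h4 : |z t| ≤ M := hmax ht
    have h5 : 0 < G * ε := by positivity
    calc ‖f t + E t‖ ≤ |f t| + |E t| := abs_add_le _ _
      _ ≤ 4 * (G * ε) + (2 * Y * |z t| + Y) := by
        refine add_le_add ?_ h3
        rw [abs_of_nonneg (by linarith)]; exact h2
      _ ≤ _ := by gcongr
  have hmv := (convex_Icc s0 1).norm_image_sub_le_of_norm_hasDerivWithin_le
    (fun t ht => (hz t ht).hasDerivWithinAt) hdz (⟨hs, hte⟩ : te ∈ Set.Icc s0 1) hts
  have hd : ‖ts - te‖ ≤ 1 - s0 := by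
    rw [Real.norm_eq_abs, abs_le]; constructor <;> linarith [hts.1, hts.2]
  have h1 : M ≤ 3 / ε + (4 * (G * ε) + (2 * Y * M + Y)) * (1 - s0) := by
    have h2 : |z ts - z te| ≤ (4 * (G * ε) + (2 * Y * M + Y)) * (1 - s0) :=
      hmv.trans (by gcongr)
    have h3 := abs_sub_abs_le_abs_sub (z ts) (z te)
    linarith
  have hT0 : 0 ≤ 1 - s0 := by linarith
  have hA : G * ε * (1 - s0) ≤ 51 / ε := by
    rw [le_div_iff₀ hε]; linarith [show G * ε * (1 - s0) * ε = (1 - s0) * (G * ε ^ 2) by ring]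
  have hB : Y * (1 - s0) ≤ 51 / 10 ^ 6 := by
    rw [le_div_iff₀ (by norm_num)]
    nlinarith [mul_le_mul_of_nonneg_right hYG hT0]
  have h1ε : 1 ≤ 1 / ε := by rw [le_div_iff₀ hε]; linarith
  have hMb : M ≤ 208 / ε := by
    have e3 : 3 / ε = 3 * (1 / ε) := by ring
    have e51 : 51 / ε = 51 * (1 / ε) := by ring
    have e208 : 208 / ε = 208 * (1 / ε) := by ring
    have h5 : Y * (1 - s0) * M ≤ 51 / 10 ^ 6 * M := by gcongr
    rw [e3] at h1
    rw [e51] at hA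
    rw [e208]
    nlinarith
  intro t ht
  have h4 : |z t| ≤ 208 / ε := (show |z t| ≤ M from hmax ht).trans hMb
  refine ⟨h4, (hE t ht).trans ?_⟩
  have h6 : Y ≤ G * ε ^ 2 / 10 ^ 6 := by linarith
  have h7 : Y * |z t| ≤ G * ε ^ 2 / 10 ^ 6 * (208 / ε) := by gcongr
  have h8 : G * ε ^ 2 / 10 ^ 6 * (208 / ε) = 208 / 10 ^ 6 * (G * ε) := by field_simp
  have h9 : Y ≤ G * ε / 10 ^ 6 := by
    have : G * ε ^ 2 ≤ G * ε := by
      have : 0 < G * ε := by positivity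
      nlinarith
    linarith
  rw [h8] at h7
  have : 0 < G * ε := by positivity
  linarith

variable {z σ Gt δ : ℝ}

theorem one_half_le_norm (hσ0 : 0 ≤ σ) (hσ : σ ≤ 1) : 1 / 2 ≤ (1 - z * σ) ^ 2 + z ^ 2 := by
  nlinarith [sq_nonneg (1 - 2 * z * σ), sq_nonneg (z * σ - z), sq_nonneg z, sq_nonneg (z * σ),
    mul_nonneg hσ0 (sub_nonneg.2 hσ), sq_nonneg (1 - z * σ - z), sq_nonneg (1 - z * σ + z),
    mul_nonneg (sq_nonneg z) (mul_nonneg hσ0 (sub_nonneg.2 hσ)),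
    mul_nonneg (sq_nonneg z) (sub_nonneg.2 hσ)]

theorem rate_ge (hG : 0 < G) (hσ0 : 0 < σ) (hσ : σ ≤ 2 * ε) (hσ1 : σ ≤ 1) (h1 : G / 4 ≤ Gt - δ)
    (h2 : Gt - δ ≤ 3 * G) :
    -(12 * (G * ε ^ 2)) ≤ (1 - z * σ) * (Gt - δ) / ((1 - z * σ) ^ 2 + z ^ 2) := by
  have hn := one_half_le_norm (z := z) hσ0.le hσ1
  have hn' : 0 < (1 - z * σ) ^ 2 + z ^ 2 := by linarith
  rw [le_div_iff₀ hn']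
  rcases le_or_gt 0 (1 - z * σ) with h | h
  · have : 0 ≤ (1 - z * σ) * (Gt - δ) := by
      apply mul_nonneg h; linarith
    nlinarith [mul_nonneg (mul_nonneg hG.le (sq_nonneg ε)) hn'.le]
  · have hz : 0 < z := by
      by_contra hz
      push Not at hz
      nlinarith
    have hs : σ ^ 2 ≤ 4 * ε ^ 2 := by nlinarith
    have a1 : (z * σ - 1) * (Gt - δ) ≤ (z * σ - 1) * (3 * G) := by
      gcongr; linarith
    have a2 : z * σ - 1 ≤ (z * σ) ^ 2 := by nlinarith
    have a3 : (z * σ) ^ 2 ≤ 4 * ε ^ 2 * z ^ 2 := by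
      rw [mul_pow]; nlinarith [sq_nonneg z]
    have a4 : 0 ≤ G * ε ^ 2 * (1 - z * σ) ^ 2 := by positivity
    nlinarith [mul_le_mul_of_nonneg_right (a2.trans a3) hG.le]

theorem rate_ge_of_mem (hG : 0 < G) (hσ0 : 0 < σ) (hσ : σ ≤ 1 / 10)
    (h1 : G / 4 ≤ Gt - δ) (hz : 0 ≤ z) (hz1 : z ≤ 1) :
    G / 20 ≤ (1 - z * σ) * (Gt - δ) / ((1 - z * σ) ^ 2 + z ^ 2) := by
  have hn := one_half_le_norm (z := z) hσ0.le (by linarith)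
  have b1 : z * σ ≤ 1 / 10 := by nlinarith
  have b0 : 0 ≤ z * σ := by positivity
  rw [le_div_iff₀ (by linarith)]
  have : 9 / 10 * (G / 4) ≤ (1 - z * σ) * (Gt - δ) := by
    gcongr <;> linarith
  have : (1 - z * σ) ^ 2 + z ^ 2 ≤ 2 := by nlinarith
  nlinarith

theorem abs_rate_le (hG : 0 < G) (hσ0 : 0 < σ) (hσ1 : σ ≤ 1) (h1 : G / 4 ≤ Gt - δ)
    (h2 : Gt - δ ≤ 3 * G) :
    |(1 - z * σ) * (Gt - δ) / ((1 - z * σ) ^ 2 + z ^ 2)| ≤ 6 * G := by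
  have hn := one_half_le_norm (z := z) hσ0.le hσ1
  have hn' : 0 < (1 - z * σ) ^ 2 + z ^ 2 := by linarith
  rw [abs_div, abs_of_pos hn', div_le_iff₀ hn', abs_mul, abs_of_nonneg (show 0 ≤ Gt - δ by linarith)]
  have h3 : |1 - z * σ| ≤ 2 * ((1 - z * σ) ^ 2 + z ^ 2) := by
    rw [abs_le]
    constructor <;> nlinarith [sq_nonneg (1 - z * σ - 1 / 2), sq_nonneg (1 - z * σ + 1 / 2)]
  calc _ ≤ 2 * ((1 - z * σ) ^ 2 + z ^ 2) * (3 * G) := by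
        apply mul_le_mul h3 h2 (by linarith) (by positivity)
    _ = _ := by ring

end phase

/-- The time dependent coefficients of the innermost part of a flow. -/
structure Coef (S ε Y : ℝ) where
  b1 : ℝ → ℝ
  b2 : ℝ → ℝ
  d1 : ℝ → ℝ
  d2 : ℝ → ℝ
  a : ℝ → ℝ
  g1 : ℝ → ℝ
  g2 : ℝ → ℝ
  D : ℝ
  smooth_b1 : ContDiff ℝ ∞ b1
  smooth_b2 : ContDiff ℝ ∞ b2
  smooth_d1 : ContDiff ℝ ∞ d1
  smooth_d2 : ContDiff ℝ ∞ d2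
  smooth_a : ContDiff ℝ ∞ a
  smooth_g1 : ContDiff ℝ ∞ g1
  smooth_g2 : ContDiff ℝ ∞ g2
  det : ∀ t, d1 t * b2 t - d2 t * b1 t = D
  one_le_D : 1 ≤ D
  D_le : D ≤ S ^ 16
  one_le_b2 : ∀ t ∈ Set.Icc (1 - 1 / S) 1, 1 ≤ b2 t
  b2_le : ∀ t ∈ Set.Icc (1 - 1 / S) 1, b2 t ≤ S ^ 16
  le_b1 : ∀ t ∈ Set.Icc (1 - 1 / S) 1, ε / 2 * b2 t ≤ b1 t
  b1_le : ∀ t ∈ Set.Icc (1 - 1 / S) 1, b1 t ≤ 2 * ε * b2 t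
  le_a : ∀ t ∈ Set.Icc (1 - 1 / S) 1, S ^ 2 / 2 ≤ a t * b2 t
  a_le : ∀ t ∈ Set.Icc (1 - 1 / S) 1, a t * b2 t ≤ 2 * S ^ 2
  deriv_b_le : ∀ t ∈ Set.Icc (1 - 1 / S) 1,
    |deriv b1 t * b2 t - b1 t * deriv b2 t| ≤ Y * b2 t ^ 2
  deriv_b2_le : ∀ t ∈ Set.Icc (1 - 1 / S) 1, |deriv b2 t| ≤ Y * b2 t
  deriv_d_le : ∀ t ∈ Set.Icc (1 - 1 / S) 1, |d2 t * deriv b2 t - deriv d2 t * b2 t| ≤ Y * D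
  g1_le : ∀ t ∈ Set.Icc (1 - 1 / S) 1, |g1 t| ≤ Y
  g2_le : ∀ t ∈ Set.Icc (1 - 1 / S) 1, |g2 t| ≤ Y
  d1_le : ∀ t ∈ Set.Icc (1 - 1 / S) 1, |d1 t| * S ^ 4 ≤ b2 t
  d2_le : ∀ t ∈ Set.Icc (1 - 1 / S) 1, |d2 t| * S ^ 4 ≤ b2 t
  deriv_d1_le : ∀ t ∈ Set.Icc (1 - 1 / S) 1, |deriv d1 t| ≤ S ^ 32
  deriv_d2_le : ∀ t ∈ Set.Icc (1 - 1 / S) 1, |deriv d2 t| ≤ S ^ 32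

/-- The relations between the parameters of two consecutive stages. -/
structure Admissible (S ε Y S' ε' : ℝ) : Prop where
  ε_pos : 0 < ε
  ε_le : ε ≤ 1 / 100
  one_le_Y : 1 ≤ Y
  Y_le : 10 ^ 6 * Y ≤ S * ε ^ 2
  le_S : 10 ^ 6 ≤ S
  exp_le : exp 600 ≤ S
  le_S' : S ^ 100 ≤ S'
  ε'_pos : 0 < ε'
  ε'_le : ε' ≤ ε / 100
  one_le : 1 ≤ ε' * S

/-- The final growth time of the layer. -/
noncomputable def tEnd (S' : ℝ) : ℝ := 1 - 1 / S'

/-- The phase of the new layer, chosen so that its direction is nearly vertical at the time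
`tEnd S'`. -/
structure Phase (S ε Y S' ε' : ℝ) extends Coef S ε Y where
  p : ℝ → ℝ
  smooth_p : ContDiff ℝ ∞ p
  deriv_p : ∀ t, deriv p t = 8 * a t * D * (b1 t * (b1 t ^ 2 + b2 t ^ 2)⁻¹)
  p_end : (p (tEnd S') * b2 (tEnd S') - 8 * d2 (tEnd S')) * (b1 (tEnd S') - ε' * b2 (tEnd S')) = 8 * D

namespace Admissible
variable {S ε Y S' ε' : ℝ} (h : Admissible S ε Y S' ε')
include h

theorem S_pos : 0 < S := lt_of_lt_of_le (by norm_num) h.le_S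
theorem one_le_S : 1 ≤ S := le_trans (by norm_num) h.le_S
theorem S_pow_le {m : ℕ} (hm : m ≤ 100) : S ^ m ≤ S' :=
  (pow_le_pow_right₀ h.one_le_S hm).trans h.le_S'
theorem S'_pos : 0 < S' := (pow_pos h.S_pos 100).trans_le h.le_S'
theorem one_le_S' : 1 ≤ S' := (one_le_pow₀ h.one_le_S).trans h.le_S'
theorem ε_le_one : ε ≤ 1 := h.ε_le.trans (by norm_num)
theorem inv_S'_le {m : ℕ} (hm : m ≤ 100) : 1 / S' ≤ 1 / S ^ m :=
  one_div_le_one_div_of_le (pow_pos h.S_pos m) (h.S_pow_le hm)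
theorem tEnd_le : tEnd S' ≤ 1 := by
  have := h.S'_pos
  have : 0 < 1 / S' := by positivity
  unfold tEnd; linarith
theorem le_tEnd : 1 - 1 / S ≤ tEnd S' := by
  have := h.inv_S'_le (m := 1) (by norm_num)
  rw [pow_one] at this
  unfold tEnd; linarith
theorem tEnd_mem : tEnd S' ∈ Set.Icc (1 - 1 / S) 1 := ⟨h.le_tEnd, h.tEnd_le⟩
theorem Y_le' : 10 ^ 6 * Y ≤ S ^ 2 * ε ^ 2 := by
  refine h.Y_le.trans ?_
  gcongr
  nlinarith [h.one_le_S]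
theorem inv_ε_le : 1 / ε ≤ S / 100 := by
  rw [div_le_iff₀ h.ε_pos]
  nlinarith [h.one_le, h.ε'_le, h.S_pos]
theorem Y_le_S : 10 ^ 10 * Y ≤ S := by
  have h1 : ε ^ 2 ≤ (1 / 100) ^ 2 := by
    have := h.ε_pos; have := h.ε_le; gcongr
  nlinarith [h.Y_le, h.S_pos]

end Admissible

namespace Coef
variable {S ε Y : ℝ} (c : Coef S ε Y)

theorem D_pos : 0 < c.D := one_pos.trans_le c.one_le_D

theorem norm_b_pos (t : ℝ) : 0 < c.b1 t ^ 2 + c.b2 t ^ 2 := by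
  have h1 := c.det t
  have h2 := c.D_pos
  by_contra h
  have e1 : c.b1 t = 0 := by nlinarith [sq_nonneg (c.b1 t), sq_nonneg (c.b2 t)]
  have e2 : c.b2 t = 0 := by nlinarith [sq_nonneg (c.b1 t), sq_nonneg (c.b2 t)]
  rw [e1, e2] at h1
  linarith

theorem exists_phase {S' ε' : ℝ} (h : Admissible S ε Y S' ε') :
    ∃ P : Phase S ε Y S' ε', P.toCoef = c := by
  have hr : ContDiff ℝ ∞ fun t => 8 * c.a t * c.D * (c.b1 t * (c.b1 t ^ 2 + c.b2 t ^ 2)⁻¹) := by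
    have := c.smooth_a
    have := c.smooth_b1
    have := c.smooth_b2
    have hi : ContDiff ℝ ∞ fun t => (c.b1 t ^ 2 + c.b2 t ^ 2)⁻¹ :=
      ContDiff.inv (by fun_prop) fun t => (c.norm_b_pos t).ne'
    fun_prop
  set te := tEnd S'
  set p0 := (8 * c.D / (c.b1 te - ε' * c.b2 te) + 8 * c.d2 te) / c.b2 te
  have hd := fun t => (hasDerivAt_primitive hr.continuous te t).const_add p0
  refine ⟨{ c with
    p := fun t => p0 + ∫ s in te..t, 8 * c.a s * c.D * (c.b1 s * (c.b1 s ^ 2 + c.b2 s ^ 2)⁻¹)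
    smooth_p := contDiff_const.add (contDiff_primitive hr te)
    deriv_p := fun t => (hd t).deriv
    p_end := ?_ }, rfl⟩
  have h1 := c.one_le_b2 te h.tEnd_mem
  have h2 := c.le_b1 te h.tEnd_mem
  have h3 : ε' * c.b2 te < ε / 2 * c.b2 te := by
    have := h.ε'_le
    have := h.ε_pos
    gcongr
    linarith
  have h4 : c.b1 te - ε' * c.b2 te ≠ 0 := by
    intro h; linarith
  have h5 : c.b2 te ≠ 0 := by intro h; linarith
  have e : (p0 + ∫ s in te..te, 8 * c.a s * c.D * (c.b1 s * (c.b1 s ^ 2 + c.b2 s ^ 2)⁻¹)) = p0 := by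
    simp
  change ((p0 + ∫ s in te..te, 8 * c.a s * c.D * (c.b1 s * (c.b1 s ^ 2 + c.b2 s ^ 2)⁻¹)) * c.b2 te -
    8 * c.d2 te) * _ = _
  rw [e]
  change (p0 * c.b2 te - 8 * c.d2 te) * (c.b1 te - ε' * c.b2 te) = 8 * c.D
  simp only [p0]
  field_simp
  ring

end Coef

/-- The times between which the layer is switched on. -/
noncomputable def tStart (S ε S' : ℝ) : ℝ := tEnd S' - 50 / (S ^ 2 * ε ^ 2)

/-- The time at which the layer has been fully switched on. -/
noncomputable def tOn (S ε S' : ℝ) : ℝ := tEnd S' - 40 / (S ^ 2 * ε ^ 2)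

namespace Admissible
variable {S ε Y S' ε' : ℝ} (h : Admissible S ε Y S' ε')
include h

theorem le_Sε : 10 ^ 6 ≤ S * ε ^ 2 := by linarith [h.Y_le, h.one_le_Y]

theorem Sε_pos : 0 < S ^ 2 * ε ^ 2 := mul_pos (pow_pos h.S_pos 2) (pow_pos h.ε_pos 2)

theorem tOn_lt : tOn S ε S' < tEnd S' := by
  have := h.Sε_pos
  have : 0 < 40 / (S ^ 2 * ε ^ 2) := by positivity
  unfold tOn; linarith

theorem tStart_lt : tStart S ε S' < tOn S ε S' := by
  have := h.Sε_pos
  have : 40 / (S ^ 2 * ε ^ 2) < 50 / (S ^ 2 * ε ^ 2) := by gcongr; norm_num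
  unfold tStart tOn; linarith

theorem le_tStart : 1 - 1 / S ≤ tStart S ε S' := by
  have h1 : 50 / (S ^ 2 * ε ^ 2) ≤ 1 / S / 2 := by
    have := h.S_pos
    rw [div_le_iff₀ h.Sε_pos]
    have : 1 / S / 2 * (S ^ 2 * ε ^ 2) = S * ε ^ 2 / 2 := by field_simp
    linarith [h.le_Sε]
  have h2 : 1 / S' ≤ 1 / S / 2 := by
    refine (h.inv_S'_le (m := 2) (by norm_num)).trans ?_
    have := h.S_pos
    rw [div_div]
    gcongr
    nlinarith [h.le_S]
  unfold tStart tEnd; linarith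

theorem tStart_nonneg : 0 ≤ tStart S ε S' := by
  have : 1 / S ≤ 1 := by rw [div_le_one h.S_pos]; exact h.one_le_S
  linarith [h.le_tStart]

theorem mem_of_mem {t : ℝ} (ht : t ∈ Set.Icc (tStart S ε S') 1) : t ∈ Set.Icc (1 - 1 / S) 1 :=
  ⟨h.le_tStart.trans ht.1, ht.2⟩

theorem tEnd_mem' : tEnd S' ∈ Set.Icc (tStart S ε S') 1 :=
  ⟨(h.tStart_lt.trans h.tOn_lt).le, h.tEnd_le⟩

theorem length_le : (1 - tStart S ε S') * (S ^ 2 * ε ^ 2) ≤ 51 := by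
  have := h.Sε_pos
  have := h.S_pos
  have := h.ε_pos
  have := h.S'_pos
  have h1 : (1 - tStart S ε S') * (S ^ 2 * ε ^ 2) = 1 / S' * (S ^ 2 * ε ^ 2) + 50 := by
    unfold tStart tEnd; field_simp; ring
  have h2 : 1 / S' * (S ^ 2 * ε ^ 2) ≤ 1 / S ^ 2 * (S ^ 2 * 1) := by
    have := h.ε_pos
    have h3 : S ^ 2 ≤ S' := h.S_pow_le (by norm_num)
    have h4 : ε ^ 2 ≤ 1 := pow_le_one₀ h.ε_pos.le h.ε_le_one
    gcongr
  have := h.S_pos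
  rw [h1]
  have : 1 / S ^ 2 * (S ^ 2 * 1) = 1 := by field_simp
  linarith

end Admissible

namespace Phase
variable {S ε Y S' ε' : ℝ} (P : Phase S ε Y S' ε')

/-- The direction of the new layer. -/
noncomputable def k1 (t : ℝ) : ℝ := P.p t * P.b1 t - 8 * P.d1 t

/-- The vertical component of the direction of the new layer. -/
noncomputable def k2 (t : ℝ) : ℝ := P.p t * P.b2 t - 8 * P.d2 t

/-- The slope of the direction of the background. -/
noncomputable def σ (t : ℝ) : ℝ := P.b1 t / P.b2 t

/-- The normalised vertical component of the new direction. -/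
noncomputable def z (t : ℝ) : ℝ := P.k2 t * P.b2 t / (8 * P.D)

/-- The normalising factor of the new direction. -/
noncomputable def mag (t : ℝ) : ℝ := 8 * P.D / P.b2 t

theorem smooth_k1 : ContDiff ℝ ∞ P.k1 := by
  have := P.smooth_p; have := P.smooth_b1; have := P.smooth_d1
  unfold k1; fun_prop

theorem smooth_k2 : ContDiff ℝ ∞ P.k2 := by
  have := P.smooth_p; have := P.smooth_b2; have := P.smooth_d2
  unfold k2; fun_prop

theorem det_k (t : ℝ) : P.b1 t * P.k2 t - P.b2 t * P.k1 t = 8 * P.D := by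
  rw [← P.det t, k1, k2]; ring

theorem k_pos (t : ℝ) : 0 < P.k1 t ^ 2 + P.k2 t ^ 2 := by
  have h1 := P.det_k t
  have h2 := P.D_pos
  by_contra h
  have e1 : P.k1 t = 0 := by nlinarith [sq_nonneg (P.k1 t), sq_nonneg (P.k2 t)]
  have e2 : P.k2 t = 0 := by nlinarith [sq_nonneg (P.k1 t), sq_nonneg (P.k2 t)]
  rw [e1, e2] at h1
  linarith

theorem deriv_k1 (t : ℝ) :
    deriv P.k1 t = deriv P.p t * P.b1 t + P.p t * deriv P.b1 t - 8 * deriv P.d1 t :=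
  (((hasDerivAt_of_smooth P.smooth_p t).mul (hasDerivAt_of_smooth P.smooth_b1 t)).sub
    ((hasDerivAt_of_smooth P.smooth_d1 t).const_mul 8)).deriv

theorem deriv_k2 (t : ℝ) :
    deriv P.k2 t = deriv P.p t * P.b2 t + P.p t * deriv P.b2 t - 8 * deriv P.d2 t :=
  (((hasDerivAt_of_smooth P.smooth_p t).mul (hasDerivAt_of_smooth P.smooth_b2 t)).sub
    ((hasDerivAt_of_smooth P.smooth_d2 t).const_mul 8)).deriv

variable {t : ℝ}

theorem k2_eq (hb : P.b2 t ≠ 0) : P.k2 t = P.mag t * P.z t := by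
  have := P.D_pos
  unfold mag z; field_simp

theorem k1_eq (hb : P.b2 t ≠ 0) : P.k1 t = P.mag t * (P.z t * P.σ t - 1) := by
  have := P.D_pos
  have h := P.det_k t
  unfold mag z σ; field_simp; linarith

/-- The part of the derivative of `z` that drives the rotation. -/
noncomputable def f (t : ℝ) : ℝ := P.a t * P.b2 t * P.σ t / (1 + P.σ t ^ 2)

/-- The remaining part of the derivative of `z`. -/
noncomputable def E (t : ℝ) : ℝ :=
  2 * P.z t * deriv P.b2 t / P.b2 t + (P.d2 t * deriv P.b2 t - deriv P.d2 t * P.b2 t) / P.D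

theorem hasDerivAt_z (hb : P.b2 t ≠ 0) : HasDerivAt P.z (P.f t + P.E t) t := by
  have h := ((hasDerivAt_of_smooth P.smooth_k2 t).mul
    (hasDerivAt_of_smooth P.smooth_b2 t)).div_const (8 * P.D)
  refine HasDerivAt.congr_deriv h ?_
  have hD := P.D_pos
  have hn := P.norm_b_pos t
  rw [P.deriv_k2, P.deriv_p]
  have e1 : P.f t = P.a t * P.b1 t * P.b2 t ^ 2 * (P.b1 t ^ 2 + P.b2 t ^ 2)⁻¹ := by
    unfold f σ
    have : (1 + (P.b1 t / P.b2 t) ^ 2) = (P.b1 t ^ 2 + P.b2 t ^ 2) / P.b2 t ^ 2 := by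
      field_simp; ring
    rw [this]
    field_simp
  rw [e1]
  unfold E z k2
  generalize (P.b1 t ^ 2 + P.b2 t ^ 2)⁻¹ = q
  field_simp
  ring

section bounds

section
variable (ht : t ∈ Set.Icc (1 - 1 / S) 1)
include ht

theorem b2_pos : 0 < P.b2 t :=
  one_pos.trans_le (P.one_le_b2 t ht)

theorem mag_pos : 0 < P.mag t := div_pos (by linarith [P.D_pos]) (P.b2_pos ht)

theorem le_σ : ε / 2 ≤ P.σ t := by
  unfold σ; rw [le_div_iff₀ (P.b2_pos ht)]; exact P.le_b1 t ht

theorem σ_le : P.σ t ≤ 2 * ε := by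
  unfold σ; rw [div_le_iff₀ (P.b2_pos ht)]; exact P.b1_le t ht

theorem E_le : |P.E t| ≤ 2 * Y * |P.z t| + Y := by
  have hb := P.b2_pos ht
  have hD := P.D_pos
  unfold E
  refine (abs_add_le _ _).trans (add_le_add ?_ ?_)
  · rw [abs_div, abs_of_pos hb, div_le_iff₀ hb, abs_mul, abs_mul, abs_two]
    calc 2 * |P.z t| * |deriv P.b2 t| ≤ 2 * |P.z t| * (Y * P.b2 t) := by
          gcongr; exact P.deriv_b2_le t ht
      _ = _ := by ring
  · rw [abs_div, abs_of_pos hD, div_le_iff₀ hD]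
    exact P.deriv_d_le t ht

end

variable (h : Admissible S ε Y S' ε')
include h

section
variable (ht : t ∈ Set.Icc (1 - 1 / S) 1)
include ht

theorem σ_pos : 0 < P.σ t := by linarith [P.le_σ ht, h.ε_pos]

theorem σ_le_one : P.σ t ≤ 1 / 10 := by linarith [P.σ_le ht, h.ε_le]

theorem f_bounds : S ^ 2 * ε / 5 ≤ P.f t ∧ P.f t ≤ 4 * (S ^ 2 * ε) := by
  have a1 := P.le_a t ht
  have a2 := P.a_le t ht
  have s1 := P.le_σ ht
  have s2 := P.σ_le ht
  have s3 := P.σ_pos h ht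
  have s4 := P.σ_le_one h ht
  have hε := h.ε_pos
  have hS := pow_pos h.S_pos 2
  have hn : 0 < 1 + P.σ t ^ 2 := by positivity
  unfold f
  rw [le_div_iff₀ hn, div_le_iff₀ hn]
  have l1 : S ^ 2 / 2 * (ε / 2) ≤ P.a t * P.b2 t * P.σ t := by gcongr; linarith
  have l2 : P.a t * P.b2 t * P.σ t ≤ 2 * S ^ 2 * (2 * ε) := by gcongr
  have hsq : P.σ t ^ 2 ≤ 1 / 100 := by nlinarith
  have : 0 < S ^ 2 * ε := by positivity
  constructor <;> nlinarith [sq_nonneg (P.σ t)]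

end

theorem z_end_mul : P.z (tEnd S') * (P.σ (tEnd S') - ε') = 1 := by
  have hb := P.b2_pos h.tEnd_mem
  have hD := P.D_pos
  have := P.p_end
  unfold z σ k2
  field_simp
  linarith

theorem z_end_bounds : 1 / (2 * ε) ≤ P.z (tEnd S') ∧ P.z (tEnd S') ≤ 3 / ε := by
  have h1 := P.z_end_mul h
  have s1 := P.le_σ h.tEnd_mem
  have s2 := P.σ_le h.tEnd_mem
  have := h.ε_pos
  have := h.ε'_pos
  have := h.ε'_le
  have hz : P.z (tEnd S') = 1 / (P.σ (tEnd S') - ε') :=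
    eq_one_div_of_mul_eq_one_left h1
  have hp : 0 < P.σ (tEnd S') - ε' := by linarith
  rw [hz]
  constructor
  · gcongr; linarith
  · rw [div_le_div_iff₀ hp h.ε_pos]; linarith

theorem z_bounds (ht : t ∈ Set.Icc (tStart S ε S') 1) :
    |P.z t| ≤ 208 / ε ∧ |P.E t| ≤ S ^ 2 * ε / 40 := by
  have hz := P.z_end_bounds h
  have := h.ε_pos
  refine phase_bounds h.ε_pos h.ε_le_one (pow_pos h.S_pos 2) (zero_le_one.trans h.one_le_Y) h.Y_le'
    h.tEnd_mem'.1 h.tEnd_le h.length_le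
    (fun t ht => P.hasDerivAt_z (P.b2_pos (h.mem_of_mem ht)).ne')
    (fun t ht => P.f_bounds h (h.mem_of_mem ht)) (fun t ht => P.E_le (h.mem_of_mem ht)) ?_ t ht
  rw [abs_of_nonneg (le_trans (by positivity) hz.1)]
  exact hz.2

theorem deriv_z_bounds (ht : t ∈ Set.Icc (tStart S ε S') 1) :
    S ^ 2 * ε / 8 ≤ P.f t + P.E t ∧ P.f t + P.E t ≤ 5 * (S ^ 2 * ε) := by
  have h1 := P.f_bounds h (h.mem_of_mem ht)
  have h2 := abs_le.1 (P.z_bounds h ht).2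
  have : 0 < S ^ 2 * ε := mul_pos (pow_pos h.S_pos 2) h.ε_pos
  constructor <;> linarith [h1.1, h1.2, h2.1, h2.2]

theorem z_sub_bounds {s : ℝ} (hs : s ∈ Set.Icc (tStart S ε S') 1)
    (ht : t ∈ Set.Icc (tStart S ε S') 1) (hst : s ≤ t) :
    S ^ 2 * ε / 8 * (t - s) ≤ P.z t - P.z s ∧ P.z t - P.z s ≤ 5 * (S ^ 2 * ε) * (t - s) := by
  rcases hst.eq_or_lt with rfl | hlt
  · simp
  obtain ⟨r, hr, e⟩ := exists_hasDerivAt_eq_slope P.z (fun t => P.f t + P.E t) hlt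
    (fun r hr => (P.hasDerivAt_z (P.b2_pos
      (h.mem_of_mem ⟨hs.1.trans hr.1, hr.2.trans ht.2⟩)).ne').continuousAt.continuousWithinAt)
    (fun r hr => P.hasDerivAt_z (P.b2_pos
      (h.mem_of_mem ⟨hs.1.trans hr.1.le, hr.2.le.trans ht.2⟩)).ne')
  have hb := P.deriv_z_bounds h (t := r) ⟨hs.1.trans hr.1.le, hr.2.le.trans ht.2⟩
  have hpos : 0 < t - s := by linarith
  rw [eq_div_iff hpos.ne'] at e
  rw [← e]
  exact ⟨mul_le_mul_of_nonneg_right hb.1 hpos.le, mul_le_mul_of_nonneg_right hb.2 hpos.le⟩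

end bounds

end Phase

theorem mul_sub_le_of_le_deriv {f : ℝ → ℝ} {C s t : ℝ} (hf : ContDiff ℝ ∞ f) (hst : s ≤ t)
    (h : ∀ r ∈ Set.Icc s t, C ≤ deriv f r) : C * (t - s) ≤ f t - f s :=
  (convex_Icc s t).mul_sub_le_image_sub_of_le_deriv hf.continuous.continuousOn
    (hf.differentiable (by simp)).differentiableOn
    (fun r hr => h r (interior_subset hr)) s ⟨le_rfl, hst⟩ t ⟨hst, le_rfl⟩ hst

theorem sub_tEnd_le {S' t : ℝ} (ht : t ≤ 1) : t - tEnd S' ≤ 1 / S' := by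
  unfold tEnd; linarith

namespace Phase
variable {S ε Y S' ε' : ℝ} (P : Phase S ε Y S' ε')

/-- The gradient of the density of the background. -/
noncomputable def h1 (t : ℝ) : ℝ := P.g1 t + P.a t * P.b1 t

/-- The vertical component of the gradient of the background density. -/
noncomputable def h2 (t : ℝ) : ℝ := P.g2 t + P.a t * P.b2 t

theorem smooth_h1 : ContDiff ℝ ∞ P.h1 := P.smooth_g1.add (P.smooth_a.mul P.smooth_b1)

theorem smooth_h2 : ContDiff ℝ ∞ P.h2 := P.smooth_g2.add (P.smooth_a.mul P.smooth_b2)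

/-- The growth rate of the layer. -/
noncomputable def rate (t : ℝ) : ℝ :=
  P.k1 t * (P.k1 t * P.h2 t - P.k2 t * P.h1 t) * (P.k1 t ^ 2 + P.k2 t ^ 2)⁻¹

theorem smooth_rate : ContDiff ℝ ∞ P.rate := by
  have := P.smooth_k1
  have := P.smooth_k2
  have := P.smooth_h1
  have := P.smooth_h2
  have hi : ContDiff ℝ ∞ fun t => (P.k1 t ^ 2 + P.k2 t ^ 2)⁻¹ :=
    ContDiff.inv (by fun_prop) fun t => (P.k_pos t).ne'
  unfold rate
  fun_prop

/-- The logarithm of the growth of the layer. -/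
noncomputable def growth (t : ℝ) : ℝ := ∫ s in tEnd S'..t, P.rate s

theorem smooth_growth : ContDiff ℝ ∞ P.growth := contDiff_primitive P.smooth_rate _

theorem deriv_growth (t : ℝ) : deriv P.growth t = P.rate t :=
  (hasDerivAt_primitive P.smooth_rate.continuous _ t).deriv

theorem growth_end : P.growth (tEnd S') = 0 := by simp [growth]

/-- The contribution to the rate of the older gradients. -/
noncomputable def δ (t : ℝ) : ℝ := (P.z t * P.σ t - 1) * P.g2 t - P.z t * P.g1 t

variable {s t : ℝ}

theorem norm_k (ht : t ∈ Set.Icc (1 - 1 / S) 1) :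
    P.k1 t ^ 2 + P.k2 t ^ 2 = P.mag t ^ 2 * ((1 - P.z t * P.σ t) ^ 2 + P.z t ^ 2) := by
  have hb := (P.b2_pos ht).ne'
  rw [P.k1_eq hb, P.k2_eq hb]; ring

theorem rate_eq (ht : t ∈ Set.Icc (1 - 1 / S) 1) :
    P.rate t = (1 - P.z t * P.σ t) * (P.a t * P.b2 t - P.δ t) /
      ((1 - P.z t * P.σ t) ^ 2 + P.z t ^ 2) := by
  have hb := (P.b2_pos ht).ne'
  have hm := (P.mag_pos ht).ne'
  have hp := P.k_pos t
  have e : P.k1 t * P.h2 t - P.k2 t * P.h1 t = -P.mag t * (P.a t * P.b2 t - P.δ t) := by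
    have hσ : P.b1 t = P.σ t * P.b2 t := by unfold σ; field_simp
    rw [P.k1_eq hb, P.k2_eq hb, h1, h2, δ, hσ]; ring
  rw [rate, e]
  rw [P.norm_k ht] at hp ⊢
  rw [P.k1_eq hb]
  have hn : (1 - P.z t * P.σ t) ^ 2 + P.z t ^ 2 ≠ 0 := by
    intro h; rw [h] at hp; simp at hp
  generalize (1 - P.z t * P.σ t) ^ 2 + P.z t ^ 2 = n at *
  field_simp
  ring

section bounds
variable (h : Admissible S ε Y S' ε')
include h

section
variable (ht : t ∈ Set.Icc (tStart S ε S') 1)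
include ht

theorem δ_le : |P.δ t| ≤ S ^ 2 / 4 := by
  have hI := h.mem_of_mem ht
  have hz := (P.z_bounds h ht).1
  have s3 := P.σ_pos h hI
  have s4 := P.σ_le_one h hI
  have hε := h.ε_pos
  have hY := h.one_le_Y
  have g1 := P.g1_le t hI
  have g2 := P.g2_le t hI
  have hn : |P.z t * P.σ t - 1| ≤ |P.z t| + 1 := by
    refine (abs_sub _ _).trans ?_
    rw [abs_mul, abs_of_pos s3, abs_one]
    nlinarith [abs_nonneg (P.z t)]
  have h1 : (1 : ℝ) ≤ 1 / ε := by rw [le_div_iff₀ hε]; linarith [h.ε_le]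
  have e : (208 : ℝ) / ε = 208 * (1 / ε) := by ring
  calc |P.δ t| ≤ |P.z t * P.σ t - 1| * |P.g2 t| + |P.z t| * |P.g1 t| := by
        unfold δ; refine (abs_sub _ _).trans ?_; rw [abs_mul, abs_mul]
    _ ≤ (208 / ε + 1) * Y + 208 / ε * Y := by gcongr; linarith
    _ ≤ 417 * (1 / ε) * Y := by rw [e]; nlinarith
    _ ≤ 417 * (1 / ε) * (S ^ 2 * ε ^ 2 / 10 ^ 6) := by gcongr; linarith [h.Y_le']
    _ = 417 / 10 ^ 6 * ε * S ^ 2 := by field_simp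
    _ ≤ 1 / 4 * S ^ 2 := by gcongr; linarith [h.ε_le]
    _ = _ := by ring

theorem sub_δ_bounds : S ^ 2 / 4 ≤ P.a t * P.b2 t - P.δ t ∧ P.a t * P.b2 t - P.δ t ≤ 3 * S ^ 2 := by
  have h1 := abs_le.1 (P.δ_le h ht)
  have h2 := P.le_a t (h.mem_of_mem ht)
  have h3 := P.a_le t (h.mem_of_mem ht)
  constructor <;> nlinarith [h1.1, h1.2, pow_pos h.S_pos 2]

theorem le_rate : -(12 * (S ^ 2 * ε ^ 2)) ≤ P.rate t := by
  have hI := h.mem_of_mem ht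
  rw [P.rate_eq hI]
  exact IPM.rate_ge (pow_pos h.S_pos 2) (P.σ_pos h hI) (P.σ_le hI)
    ((P.σ_le_one h hI).trans (by norm_num)) (P.sub_δ_bounds h ht).1 (P.sub_δ_bounds h ht).2

theorem le_rate_of_mem (h0 : 0 ≤ P.z t) (h1 : P.z t ≤ 1) : S ^ 2 / 20 ≤ P.rate t := by
  have hI := h.mem_of_mem ht
  rw [P.rate_eq hI]
  exact IPM.rate_ge_of_mem (pow_pos h.S_pos 2) (P.σ_pos h hI) (P.σ_le_one h hI)
    (P.sub_δ_bounds h ht).1 h0 h1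

theorem rate_le : |P.rate t| ≤ 6 * S ^ 2 := by
  have hI := h.mem_of_mem ht
  rw [P.rate_eq hI]
  exact IPM.abs_rate_le (pow_pos h.S_pos 2) (P.σ_pos h hI)
    ((P.σ_le_one h hI).trans (by norm_num)) (P.sub_δ_bounds h ht).1 (P.sub_δ_bounds h ht).2

end

theorem growth_sub_ge (hs : s ∈ Set.Icc (tStart S ε S') 1) (ht : t ∈ Set.Icc (tStart S ε S') 1)
    (hst : s ≤ t) : -(12 * (S ^ 2 * ε ^ 2)) * (t - s) ≤ P.growth t - P.growth s :=
  mul_sub_le_of_le_deriv P.smooth_growth hst fun r hr => by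
    rw [P.deriv_growth]; exact P.le_rate h ⟨hs.1.trans hr.1, hr.2.trans ht.2⟩

theorem growth_le (hs : s ∈ Set.Icc (tStart S ε S') (tEnd S')) : P.growth s ≤ 600 := by
  have h1 := P.growth_sub_ge h ⟨hs.1, hs.2.trans h.tEnd_le⟩ h.tEnd_mem' hs.2
  rw [P.growth_end] at h1
  have h2 : 12 * (S ^ 2 * ε ^ 2) * (tEnd S' - s) ≤ 12 * (S ^ 2 * ε ^ 2) * (50 / (S ^ 2 * ε ^ 2)) := by
    have := h.Sε_pos
    have h3 : tStart S ε S' ≤ s := hs.1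
    unfold tStart at h3
    gcongr
    linarith
  have h3 : 12 * (S ^ 2 * ε ^ 2) * (50 / (S ^ 2 * ε ^ 2)) = 600 := by
    have := h.Sε_pos.ne'
    rw [mul_assoc, mul_div_cancel₀ _ this]
    norm_num
  linarith

theorem growth_le_early (hs : s ∈ Set.Icc (tStart S ε S') (tOn S ε S')) :
    P.growth s ≤ 600 - 1 / (100 * ε) := by
  have hε := h.ε_pos
  have hS := pow_pos h.S_pos 2
  have hG : 0 < S ^ 2 * ε := by positivity
  have hle : s ≤ tEnd S' := hs.2.trans h.tOn_lt.le
  have hsI : s ∈ Set.Icc (tStart S ε S') 1 := ⟨hs.1, hle.trans h.tEnd_le⟩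
  have hmem : ∀ r ∈ Set.Icc s (tEnd S'), r ∈ Set.Icc (tStart S ε S') 1 :=
    fun r hr => ⟨hs.1.trans hr.1, hr.2.trans h.tEnd_le⟩
  have hcont : ContinuousOn P.z (Set.Icc s (tEnd S')) := fun r hr =>
    (P.hasDerivAt_z (P.b2_pos (h.mem_of_mem (hmem r hr))).ne').continuousAt.continuousWithinAt
  have hz := P.z_end_bounds h
  have z1 : 1 ≤ P.z (tEnd S') := by
    refine le_trans ?_ hz.1
    rw [le_div_iff₀ (by positivity)]
    linarith [h.ε_le]
  have z0 : P.z s ≤ 0 := by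
    have h1 := (P.z_sub_bounds h hsI h.tEnd_mem' hle).1
    have h2 : S ^ 2 * ε / 8 * (40 / (S ^ 2 * ε ^ 2)) ≤ S ^ 2 * ε / 8 * (tEnd S' - s) := by
      have : s ≤ tOn S ε S' := hs.2
      unfold tOn at this
      gcongr
      linarith
    have h3 : S ^ 2 * ε / 8 * (40 / (S ^ 2 * ε ^ 2)) = 5 / ε := by
      have := h.S_pos
      field_simp; norm_num
    have h4 : 3 / ε ≤ 5 / ε := by gcongr; norm_num
    linarith [hz.2]
  obtain ⟨r0, hr0, e0⟩ := intermediate_value_Icc hle hcont ⟨z0, by linarith⟩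
  obtain ⟨r1, hr1, e1⟩ := intermediate_value_Icc hr0.2
    (hcont.mono (Set.Icc_subset_Icc_left hr0.1)) ⟨by rw [e0]; norm_num, z1⟩
  have hr1' : r1 ∈ Set.Icc s (tEnd S') := ⟨hr0.1.trans hr1.1, hr1.2⟩
  have hlen : 1 ≤ 5 * (S ^ 2 * ε) * (r1 - r0) := by
    have := (P.z_sub_bounds h (hmem r0 hr0) (hmem r1 hr1') hr1.1).2
    rw [e0, e1] at this
    linarith
  have l1 := P.growth_sub_ge h hsI (hmem r0 hr0) hr0.1
  have l2 : S ^ 2 / 20 * (r1 - r0) ≤ P.growth r1 - P.growth r0 :=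
    mul_sub_le_of_le_deriv P.smooth_growth hr1.1 fun r hr => by
      have hr' : r ∈ Set.Icc (tStart S ε S') 1 :=
        hmem r ⟨hr0.1.trans hr.1, hr.2.trans hr1.2⟩
      have h5 := (P.z_sub_bounds h (hmem r0 hr0) hr' hr.1).1
      have h6 := (P.z_sub_bounds h hr' (hmem r1 hr1') hr.2).1
      have h7 : 0 ≤ S ^ 2 * ε / 8 * (r - r0) := by
        have := hr.1
        have : 0 ≤ r - r0 := by linarith
        positivity
      have h8 : 0 ≤ S ^ 2 * ε / 8 * (r1 - r) := by
        have := hr.2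
        have : 0 ≤ r1 - r := by linarith
        positivity
      rw [P.deriv_growth]
      exact P.le_rate_of_mem h hr' (by linarith) (by linarith)
  have l3 := P.growth_sub_ge h (hmem r1 hr1') h.tEnd_mem' hr1.2
  rw [P.growth_end] at l3
  have l4 : 1 / (100 * ε) ≤ S ^ 2 / 20 * (r1 - r0) := by
    rw [div_le_iff₀ (by positivity)]
    nlinarith
  have h3 : 12 * (S ^ 2 * ε ^ 2) * (50 / (S ^ 2 * ε ^ 2)) = 600 := by
    have := h.Sε_pos.ne'
    rw [mul_assoc, mul_div_cancel₀ _ this]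
    norm_num
  have h4 : 12 * (S ^ 2 * ε ^ 2) * ((r0 - s) + (tEnd S' - r1)) ≤
      12 * (S ^ 2 * ε ^ 2) * (50 / (S ^ 2 * ε ^ 2)) := by
    have := h.Sε_pos
    have h5 : tStart S ε S' ≤ s := hs.1
    have h6 := hr1.1
    unfold tStart at h5
    gcongr
    linarith
  rw [h3] at h4
  linarith

section
variable (ht : t ∈ Set.Icc (tEnd S') 1)
include ht

theorem z_late : 1 / (2 * ε) ≤ P.z t ∧ P.z t ≤ 4 / ε := by
  have hε := h.ε_pos
  have hS := h.S_pos
  have hz := P.z_end_bounds h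
  have ht' : t ∈ Set.Icc (tStart S ε S') 1 := ⟨h.tEnd_mem'.1.trans ht.1, ht.2⟩
  have hb := P.z_sub_bounds h h.tEnd_mem' ht' ht.1
  have h1 : 0 ≤ S ^ 2 * ε / 8 * (t - tEnd S') := mul_nonneg (by positivity) (by linarith [ht.1])
  refine ⟨by linarith, ?_⟩
  have h2 : 5 * (S ^ 2 * ε) * (t - tEnd S') ≤ 5 * (S ^ 2 * ε) * (1 / S ^ 2) := by
    gcongr
    exact (sub_tEnd_le ht.2).trans (h.inv_S'_le (by norm_num))
  have h3 : 5 * (S ^ 2 * ε) * (1 / S ^ 2) = 5 * ε := by field_simp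
  have h4 : 5 * ε ≤ 1 / ε := by
    rw [le_div_iff₀ hε]; nlinarith [h.ε_le]
  have h5 : 3 / ε + 1 / ε = 4 / ε := by ring
  linarith

theorem k2_pos : 0 < P.k2 t := by
  have ht' : t ∈ Set.Icc (1 - 1 / S) 1 := ⟨h.le_tEnd.trans ht.1, ht.2⟩
  rw [P.k2_eq (P.b2_pos ht').ne']
  have := h.ε_pos
  exact mul_pos (P.mag_pos ht') (lt_of_lt_of_le (by positivity) (P.z_late h ht).1)

end

end bounds

end Phase

theorem exists_deriv_smoothTransition_le : ∃ C, 0 ≤ C ∧ ∀ x, |deriv smoothTransition x| ≤ C := by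
  have hs : ContDiff ℝ ∞ smoothTransition := smoothTransition.contDiff
  obtain ⟨C, hC⟩ := (isCompact_Icc (a := (0 : ℝ)) (b := 1)).exists_bound_of_continuousOn
    (contDiff_deriv hs).continuous.continuousOn
  refine ⟨C, (norm_nonneg _).trans (hC 0 ⟨le_rfl, zero_le_one⟩), fun x => ?_⟩
  by_cases hx : x ∈ Set.Icc (0 : ℝ) 1
  · exact hC x hx
  · have h0 : deriv smoothTransition x = 0 := by
      rw [Set.mem_Icc, not_and_or, not_le, not_le] at hx
      rcases hx with hx | hx
      · have : smoothTransition =ᶠ[𝓝 x] fun _ => 0 := by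
          filter_upwards [gt_mem_nhds hx] with y hy
          exact smoothTransition.zero_of_nonpos (le_of_lt hy)
        rw [this.deriv_eq, deriv_const]
      · have : smoothTransition =ᶠ[𝓝 x] fun _ => 1 := by
          filter_upwards [lt_mem_nhds hx] with y hy
          exact smoothTransition.one_of_one_le (le_of_lt hy)
        rw [this.deriv_eq, deriv_const]
    rw [h0, abs_zero]
    exact (norm_nonneg _).trans (hC 0 ⟨le_rfl, zero_le_one⟩)

namespace Admissible
variable {S ε Y S' ε' : ℝ} (h : Admissible S ε Y S' ε')
include h

theorem pow_le_pow {m n : ℕ} (hmn : m ≤ n) : S ^ m ≤ S ^ n := pow_le_pow_right₀ h.one_le_S hmn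

theorem mul_pow_le {C : ℝ} {m n : ℕ} (hC : C ≤ 10 ^ 6) (hmn : m + 1 ≤ n) : C * S ^ m ≤ S ^ n := by
  have := pow_pos h.S_pos m
  calc C * S ^ m ≤ S * S ^ m := by gcongr; exact hC.trans h.le_S
    _ = S ^ (m + 1) := by ring
    _ ≤ _ := h.pow_le_pow hmn

theorem Y_le_one_mul : Y ≤ S ^ 1 := by
  have := h.Y_le_S
  have := h.one_le_Y
  rw [pow_one]; linarith

end Admissible

namespace Coef
variable {S ε Y S' ε' : ℝ} (c : Coef S ε Y) (h : Admissible S ε Y S' ε') {t : ℝ}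
  (ht : t ∈ Set.Icc (1 - 1 / S) 1)
include ht

theorem abs_b2_le : |c.b2 t| ≤ S ^ 16 := by
  rw [abs_of_nonneg (zero_le_one.trans (c.one_le_b2 t ht))]; exact c.b2_le t ht

section
include h

theorem b1_nonneg : 0 ≤ c.b1 t := by
  have := c.one_le_b2 t ht
  have := h.ε_pos
  exact le_trans (by positivity) (c.le_b1 t ht)

theorem b1_le_b2 : c.b1 t ≤ c.b2 t := by
  have := c.one_le_b2 t ht
  have := h.ε_le
  exact (c.b1_le t ht).trans (by nlinarith)

theorem abs_b1_le : |c.b1 t| ≤ S ^ 16 := by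
  rw [abs_of_nonneg (c.b1_nonneg h ht)]
  exact (c.b1_le_b2 h ht).trans (c.b2_le t ht)

theorem abs_deriv_b2_le : |deriv c.b2 t| ≤ S ^ 17 := by
  have := h.Y_le_one_mul
  have := c.one_le_b2 t ht
  have hS := h.S_pos
  calc _ ≤ Y * c.b2 t := c.deriv_b2_le t ht
    _ ≤ S ^ 1 * S ^ 16 := by gcongr; exact c.b2_le t ht
    _ = _ := by ring

theorem abs_deriv_b1_le : |deriv c.b1 t| ≤ S ^ 18 := by
  have h1 := h.Y_le_one_mul
  have h2 := c.one_le_b2 t ht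
  have h3 := c.b2_le t ht
  have h4 := c.b1_nonneg h ht
  have h5 := c.b1_le_b2 h ht
  have hY := h.one_le_Y
  have hS := h.S_pos
  have hb : 0 < c.b2 t := by linarith
  have e : |deriv c.b1 t| * c.b2 t ≤ (2 * Y * c.b2 t) * c.b2 t := by
    calc |deriv c.b1 t| * c.b2 t = |(deriv c.b1 t * c.b2 t - c.b1 t * deriv c.b2 t) +
          c.b1 t * deriv c.b2 t| := by
            rw [sub_add_cancel, abs_mul, abs_of_pos hb]
      _ ≤ Y * c.b2 t ^ 2 + c.b1 t * (Y * c.b2 t) := by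
        refine (abs_add_le _ _).trans (add_le_add (c.deriv_b_le t ht) ?_)
        rw [abs_mul, abs_of_nonneg h4]
        gcongr
        exact c.deriv_b2_le t ht
      _ ≤ Y * c.b2 t ^ 2 + c.b2 t * (Y * c.b2 t) := by gcongr
      _ = _ := by ring
  calc |deriv c.b1 t| ≤ 2 * Y * c.b2 t := le_of_mul_le_mul_right e hb
    _ ≤ 2 * S ^ 1 * S ^ 16 := by gcongr
    _ = 2 * S ^ 17 := by ring
    _ ≤ _ := h.mul_pow_le (by norm_num) (by norm_num)

theorem abs_d_le {d : ℝ} (hd : |d| * S ^ 4 ≤ c.b2 t) : |d| ≤ S ^ 16 := by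
  have h1 : 1 ≤ S ^ 4 := one_le_pow₀ h.one_le_S
  have := c.b2_le t ht
  nlinarith [abs_nonneg d]

theorem a_mul_b1_le : |c.a t * c.b1 t| ≤ 2 * S ^ 2 := by
  have h2 := c.one_le_b2 t ht
  have h3 := c.a_le t ht
  have h4 := c.b1_nonneg h ht
  have h5 := c.b1_le_b2 h ht
  have h6 : 0 ≤ c.a t := by
    have := c.le_a t ht
    have : 0 < c.a t * c.b2 t := lt_of_lt_of_le (by have := h.S_pos; positivity) this
    exact (pos_of_mul_pos_left this (by linarith)).le
  rw [abs_of_nonneg (by positivity)]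
  exact (mul_le_mul_of_nonneg_left h5 h6).trans h3

theorem abs_a_mul_b2_le : |c.a t * c.b2 t| ≤ 2 * S ^ 2 := by
  have := h.S_pos
  rw [abs_of_nonneg (le_trans (by positivity) (c.le_a t ht))]
  exact c.a_le t ht

end

end Coef

namespace Phase
variable {S ε Y S' ε' : ℝ} (P : Phase S ε Y S' ε')

/-- The amplitude of the new layer. -/
noncomputable def amp (t : ℝ) : ℝ := (S' ^ 6 * P.k2 (tEnd S'))⁻¹ * exp (P.growth t)

theorem smooth_amp : ContDiff ℝ ∞ P.amp := contDiff_const.mul P.smooth_growth.exp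

theorem deriv_amp (t : ℝ) : deriv P.amp t = P.rate t * P.amp t := by
  have := ((hasDerivAt_of_smooth P.smooth_growth t).exp).const_mul (S' ^ 6 * P.k2 (tEnd S'))⁻¹
  rw [P.deriv_growth] at this
  rw [show P.amp = fun t => (S' ^ 6 * P.k2 (tEnd S'))⁻¹ * exp (P.growth t) from rfl, this.deriv]
  ring

variable {t : ℝ}

theorem deriv_k2_mul (ht : t ∈ Set.Icc (1 - 1 / S) 1) :
    deriv P.k2 t * P.b2 t = 8 * P.D * (P.f t + P.E t) - P.k2 t * deriv P.b2 t := by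
  have h1 := ((hasDerivAt_of_smooth P.smooth_k2 t).mul
    (hasDerivAt_of_smooth P.smooth_b2 t)).div_const (8 * P.D)
  have h2 := HasDerivAt.unique h1 (P.hasDerivAt_z (P.b2_pos ht).ne')
  have := P.D_pos
  rw [div_eq_iff (by positivity)] at h2
  linarith

section bounds
variable (h : Admissible S ε Y S' ε')
include h

section
variable (ht : t ∈ Set.Icc (tStart S ε S') 1)
include ht

theorem abs_p_le : |P.p t| ≤ 1 := by
  have hI := h.mem_of_mem ht
  have hb := P.b2_pos hI
  have hD := P.D_pos
  have hS := h.S_pos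
  have hz := (P.z_bounds h ht).1
  have e : P.p t = 8 * P.D * P.z t / P.b2 t ^ 2 + 8 * P.d2 t / P.b2 t := by
    unfold z k2; field_simp; ring
  have hDle : P.D * S ^ 4 ≤ 2 * P.b2 t ^ 2 := by
    have d1 := P.d1_le t hI
    have d2 := P.d2_le t hI
    have b1 := P.b1_nonneg h hI
    have b12 := P.b1_le_b2 h hI
    calc P.D * S ^ 4 = (P.d1 t * S ^ 4) * P.b2 t - (P.d2 t * S ^ 4) * P.b1 t := by
          rw [← P.det t]; ring
      _ ≤ P.b2 t * P.b2 t + P.b2 t * P.b2 t := by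
          have l1 : (P.d1 t * S ^ 4) * P.b2 t ≤ P.b2 t * P.b2 t := by
            refine mul_le_mul_of_nonneg_right (le_trans ?_ d1) hb.le
            gcongr; exact le_abs_self _
          have l2 : (-P.d2 t * S ^ 4) * P.b1 t ≤ P.b2 t * P.b2 t := by
            refine mul_le_mul (le_trans ?_ d2) b12 b1 hb.le
            gcongr; exact neg_le_abs _
          linarith
      _ = _ := by ring
  have hz' : |P.z t| ≤ 3 * S := by
    have := h.inv_ε_le
    have e : 208 / ε = 208 * (1 / ε) := by ring
    linarith
  rw [e]
  have hS4 : (10 ^ 6) ^ 3 * S ≤ S ^ 4 := by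
    have := h.le_S
    calc (10 ^ 6) ^ 3 * S ≤ S ^ 3 * S := by gcongr
      _ = _ := by ring
  have t1 : |8 * P.D * P.z t / P.b2 t ^ 2| ≤ 1 / 2 := by
    rw [abs_div, abs_of_pos (pow_pos hb 2), div_le_iff₀ (pow_pos hb 2), abs_mul,
      abs_of_pos (by positivity : 0 < 8 * P.D)]
    have l1 : 8 * P.D * |P.z t| ≤ 8 * P.D * (3 * S) := by gcongr
    have l2 : P.D * ((10 ^ 6) ^ 3 * S) ≤ 2 * P.b2 t ^ 2 := le_trans (by gcongr) hDle
    have l3 : 0 < P.D * S := by positivity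
    linarith
  have t2 : |8 * P.d2 t / P.b2 t| ≤ 1 / 2 := by
    rw [abs_div, abs_of_pos hb, div_le_iff₀ hb, abs_mul, abs_of_pos (by norm_num : (0 : ℝ) < 8)]
    have d2 := P.d2_le t hI
    have : 16 ≤ S ^ 4 := by nlinarith [h.le_S]
    nlinarith [abs_nonneg (P.d2 t)]
  exact (abs_add_le _ _).trans (by linarith)

theorem abs_k_le {b d : ℝ} (hb : |b| ≤ S ^ 16) (hd : |d| ≤ S ^ 16) :
    |P.p t * b - 8 * d| ≤ S ^ 17 := by
  have hp := P.abs_p_le h ht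
  calc |P.p t * b - 8 * d| ≤ |P.p t| * |b| + 8 * |d| := by
        refine (abs_sub _ _).trans ?_
        rw [abs_mul, abs_mul, abs_of_pos (by norm_num : (0 : ℝ) < 8)]
    _ ≤ 1 * S ^ 16 + 8 * S ^ 16 := by gcongr
    _ = 9 * S ^ 16 := by ring
    _ ≤ _ := h.mul_pow_le (by norm_num) (by norm_num)

theorem abs_deriv_p_le : |deriv P.p t| ≤ S ^ 19 := by
  have hI := h.mem_of_mem ht
  have hD := P.D_pos
  have hq : (P.b1 t ^ 2 + P.b2 t ^ 2)⁻¹ ≤ 1 :=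
    inv_le_one_of_one_le₀ (by nlinarith [P.one_le_b2 t hI, sq_nonneg (P.b1 t)])
  have hq0 : 0 < (P.b1 t ^ 2 + P.b2 t ^ 2)⁻¹ := inv_pos.2 (P.norm_b_pos t)
  have h1 := P.a_mul_b1_le h hI
  have := h.S_pos
  rw [P.deriv_p, show 8 * P.a t * P.D * (P.b1 t * (P.b1 t ^ 2 + P.b2 t ^ 2)⁻¹) =
    8 * P.D * (P.b1 t ^ 2 + P.b2 t ^ 2)⁻¹ * (P.a t * P.b1 t) by ring, abs_mul,
    abs_of_pos (by positivity : 0 < 8 * P.D * (P.b1 t ^ 2 + P.b2 t ^ 2)⁻¹)]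
  calc _ ≤ 8 * S ^ 16 * 1 * (2 * S ^ 2) := by gcongr; exact P.D_le
    _ = 16 * S ^ 18 := by ring
    _ ≤ _ := h.mul_pow_le (by norm_num) (by norm_num)

theorem abs_deriv_k_le {b b' d' : ℝ} (hb : |b| ≤ S ^ 16) (hb' : |b'| ≤ S ^ 18)
    (hd' : |d'| ≤ S ^ 32) : |deriv P.p t * b + P.p t * b' - 8 * d'| ≤ S ^ 36 := by
  have hp := P.abs_p_le h ht
  have hp' := P.abs_deriv_p_le h ht
  have hS := h.S_pos
  calc _ ≤ |deriv P.p t| * |b| + |P.p t| * |b'| + 8 * |d'| := by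
        refine (abs_sub _ _).trans ?_
        rw [abs_mul 8, abs_of_pos (by norm_num : (0 : ℝ) < 8)]
        gcongr
        refine (abs_add_le _ _).trans ?_
        rw [abs_mul, abs_mul]
    _ ≤ S ^ 19 * S ^ 16 + 1 * S ^ 18 + 8 * S ^ 32 := by gcongr
    _ = S ^ 35 + 1 * S ^ 18 + 8 * S ^ 32 := by ring
    _ ≤ S ^ 35 + 1 * S ^ 35 + 8 * S ^ 35 := by
        have h1 := h.pow_le_pow (show 18 ≤ 35 by norm_num)
        have h2 := h.pow_le_pow (show 32 ≤ 35 by norm_num)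
        gcongr
    _ = 10 * S ^ 35 := by ring
    _ ≤ _ := h.mul_pow_le (by norm_num) (by norm_num)

theorem mag_bounds : 8 ≤ P.mag t * S ^ 16 ∧ P.mag t ≤ 8 * S ^ 16 := by
  have hI := h.mem_of_mem ht
  have hb := P.b2_pos hI
  have hD := P.one_le_D
  have hS := h.S_pos
  unfold mag
  constructor
  · rw [div_mul_eq_mul_div, le_div_iff₀ hb]
    have := P.b2_le t hI
    have : 1 * S ^ 16 ≤ P.D * S ^ 16 := by gcongr
    linarith
  · rw [div_le_iff₀ hb]
    have h1 := P.one_le_b2 t hI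
    have h2 := P.D_le
    have : S ^ 16 * 1 ≤ S ^ 16 * P.b2 t := by gcongr
    linarith

theorem inv_norm_k_le : (P.k1 t ^ 2 + P.k2 t ^ 2)⁻¹ ≤ S ^ 32 := by
  have hI := h.mem_of_mem ht
  have hm := P.mag_bounds h ht
  have hS := h.S_pos
  have hn := one_half_le_norm (z := P.z t) (P.σ_pos h hI).le
    ((P.σ_le_one h hI).trans (by norm_num))
  have hk := P.k_pos t
  rw [P.norm_k hI] at hk ⊢
  rw [inv_le_iff_one_le_mul₀ hk]
  have h1 : 64 ≤ (P.mag t * S ^ 16) ^ 2 := by nlinarith [hm.1]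
  calc (1 : ℝ) ≤ 64 * (1 / 2) := by norm_num
    _ ≤ (P.mag t * S ^ 16) ^ 2 * ((1 - P.z t * P.σ t) ^ 2 + P.z t ^ 2) := by gcongr
    _ = _ := by ring

end

section
variable (ht : t ∈ Set.Icc (tEnd S') 1)
include ht

theorem k2_late : 1 ≤ P.k2 t * S ^ 16 ∧ P.k2 t ≤ S ^ 18 := by
  have ht' : t ∈ Set.Icc (tStart S ε S') 1 := ⟨h.tEnd_mem'.1.trans ht.1, ht.2⟩
  have hI := h.mem_of_mem ht'
  have hm := P.mag_bounds h ht'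
  have hz := P.z_late h ht
  have hS := h.S_pos
  have hε := h.ε_pos
  have hmp := P.mag_pos hI
  have z1 : 1 ≤ P.z t := by
    refine le_trans ?_ hz.1
    rw [le_div_iff₀ (by positivity)]
    linarith [h.ε_le]
  have z2 : P.z t ≤ S := by
    have := h.inv_ε_le
    have e : 4 / ε = 4 * (1 / ε) := by ring
    linarith [hz.2]
  rw [P.k2_eq (P.b2_pos hI).ne']
  constructor
  · have : P.mag t * S ^ 16 * 1 ≤ P.mag t * S ^ 16 * P.z t := by gcongr
    linarith [hm.1]
  · calc P.mag t * P.z t ≤ 8 * S ^ 16 * S := by gcongr; exact hm.2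
      _ = 8 * S ^ 17 := by ring
      _ ≤ _ := h.mul_pow_le (by norm_num) (by norm_num)

theorem deriv_z_le : P.f t + P.E t ≤ S ^ 2 / 2 * P.z t ∧ 0 ≤ P.f t + P.E t := by
  have ht' : t ∈ Set.Icc (tStart S ε S') 1 := ⟨h.tEnd_mem'.1.trans ht.1, ht.2⟩
  have hd := P.deriv_z_bounds h ht'
  have hz := P.z_late h ht
  have hS := pow_pos h.S_pos 2
  have hε := h.ε_pos
  refine ⟨hd.2.trans ?_, le_trans (by positivity) hd.1⟩
  calc 5 * (S ^ 2 * ε) = S ^ 2 / 2 * (10 * ε) := by ring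
    _ ≤ S ^ 2 / 2 * (1 / (2 * ε)) := by
      gcongr
      rw [le_div_iff₀ (by positivity)]
      nlinarith [h.ε_le]
    _ ≤ _ := by gcongr; exact hz.1

theorem abs_deriv_k2_late : |deriv P.k2 t| ≤ S ^ 2 * P.k2 t := by
  have ht' : t ∈ Set.Icc (tStart S ε S') 1 := ⟨h.tEnd_mem'.1.trans ht.1, ht.2⟩
  have hI := h.mem_of_mem ht'
  have hb := P.b2_pos hI
  have hD := P.D_pos
  have hk := P.k2_pos h ht
  have hz := P.deriv_z_le h ht
  have e : 8 * P.D * P.z t = P.k2 t * P.b2 t := by unfold z; field_simp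
  have hY : Y ≤ S ^ 2 / 2 := by
    have := h.Y_le_S
    have := h.one_le_Y
    nlinarith [h.one_le_S]
  refine le_of_mul_le_mul_right (a := P.b2 t) ?_ hb
  calc |deriv P.k2 t| * P.b2 t = |8 * P.D * (P.f t + P.E t) - P.k2 t * deriv P.b2 t| := by
        rw [← P.deriv_k2_mul hI, abs_mul, abs_of_pos hb]
    _ ≤ 8 * P.D * (P.f t + P.E t) + P.k2 t * |deriv P.b2 t| := by
        refine (abs_sub _ _).trans ?_
        rw [abs_of_nonneg (mul_nonneg (by positivity) hz.2), abs_mul, abs_of_pos hk]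
    _ ≤ 8 * P.D * (S ^ 2 / 2 * P.z t) + P.k2 t * (S ^ 2 / 2 * P.b2 t) := by
        gcongr
        · exact hz.1
        · exact (P.deriv_b2_le t hI).trans (by gcongr)
    _ = S ^ 2 / 2 * (8 * P.D * P.z t) + P.k2 t * (S ^ 2 / 2 * P.b2 t) := by ring
    _ = _ := by rw [e]; ring

theorem growth_late : |P.growth t + log (P.k2 t) - log (P.k2 (tEnd S'))| ≤ 1 / 2 := by
  have hk : ∀ r ∈ Set.Icc (tEnd S') t, HasDerivWithinAt (fun r => P.growth r + log (P.k2 r))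
      (P.rate r + deriv P.k2 r / P.k2 r) (Set.Icc (tEnd S') t) r := fun r hr => by
    have h1 := hasDerivAt_of_smooth P.smooth_growth r
    rw [P.deriv_growth] at h1
    exact (h1.add ((hasDerivAt_of_smooth P.smooth_k2 r).log
      (P.k2_pos h ⟨hr.1, hr.2.trans ht.2⟩).ne')).hasDerivWithinAt
  have hb : ∀ r ∈ Set.Icc (tEnd S') t, ‖P.rate r + deriv P.k2 r / P.k2 r‖ ≤ 7 * S ^ 2 :=
    fun r hr => by
      have hr' : r ∈ Set.Icc (tEnd S') 1 := ⟨hr.1, hr.2.trans ht.2⟩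
      have h1 := P.rate_le h (t := r) ⟨h.tEnd_mem'.1.trans hr.1, hr'.2⟩
      have h2 := P.abs_deriv_k2_late h hr'
      have h3 := P.k2_pos h hr'
      have h4 : |deriv P.k2 r / P.k2 r| ≤ S ^ 2 := by
        rw [abs_div, abs_of_pos h3, div_le_iff₀ h3]; exact h2
      calc _ ≤ |P.rate r| + |deriv P.k2 r / P.k2 r| := abs_add_le _ _
        _ ≤ _ := by linarith
  have := (convex_Icc (tEnd S') t).norm_image_sub_le_of_norm_hasDerivWithin_le hk hb
    ⟨le_rfl, ht.1⟩ ⟨ht.1, le_rfl⟩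
  rw [P.growth_end, zero_add, Real.norm_eq_abs, Real.norm_eq_abs,
    abs_of_nonneg (by linarith [ht.1] : 0 ≤ t - tEnd S')] at this
  refine this.trans ?_
  have hS := h.S_pos
  calc 7 * S ^ 2 * (t - tEnd S') ≤ 7 * S ^ 2 * (1 / S ^ 3) := by
        gcongr
        exact (sub_tEnd_le ht.2).trans (h.inv_S'_le (by norm_num))
    _ = 7 / S := by field_simp
    _ ≤ 1 / 2 := by rw [div_le_iff₀ hS]; linarith [h.le_S]

theorem amp_late : S' ^ 2 / 2 ≤ P.amp t * (S' ^ 8 * P.k2 t) ∧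
    P.amp t * (S' ^ 8 * P.k2 t) ≤ 2 * S' ^ 2 := by
  have hg := abs_le.1 (P.growth_late h ht)
  have hk := P.k2_pos h ht
  have hke := P.k2_pos h (t := tEnd S') ⟨le_rfl, h.tEnd_le⟩
  have hS' := h.S'_pos
  have e : P.amp t * (S' ^ 8 * P.k2 t) =
      S' ^ 2 * exp (P.growth t + log (P.k2 t) - log (P.k2 (tEnd S'))) := by
    unfold amp
    rw [exp_sub, exp_add, exp_log hk, exp_log hke]
    field_simp
  have e1 : exp (1 / 2) ≤ 2 := by
    have h1 : exp (1 / 2) ^ 2 ≤ 2 ^ 2 := by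
      rw [← exp_nat_mul]
      norm_num
      linarith [exp_one_lt_d9]
    exact le_of_sq_le_sq h1 (by norm_num)
  rw [e]
  constructor
  · have h2 : 1 / 2 ≤ exp (-(1 / 2)) := by
      rw [exp_neg, one_div (2 : ℝ)]; gcongr; simpa using e1
    have h3 : exp (-(1 / 2)) ≤ exp (P.growth t + log (P.k2 t) - log (P.k2 (tEnd S'))) :=
      exp_le_exp.2 hg.1
    calc S' ^ 2 / 2 = S' ^ 2 * (1 / 2) := by ring
      _ ≤ _ := by gcongr; exact h2.trans h3
  · have h3 := exp_le_exp.2 hg.2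
    calc _ ≤ S' ^ 2 * 2 := by gcongr; exact h3.trans e1
      _ = _ := by ring

end

end bounds

end Phase

/-- The switching function of a layer. -/
noncomputable def cut (S ε S' t : ℝ) : ℝ :=
  smoothTransition ((t - tStart S ε S') / (tOn S ε S' - tStart S ε S'))

theorem smooth_cut (S ε S' : ℝ) : ContDiff ℝ ∞ (cut S ε S') :=
  smoothTransition.contDiff.comp (by fun_prop)

namespace Phase
variable {S ε Y S' ε' : ℝ} (P : Phase S ε Y S' ε') {t : ℝ}
  (h : Admissible S ε Y S' ε')
include h

theorem cut_of_le (ht : t ≤ tStart S ε S') : cut S ε S' t = 0 :=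
  smoothTransition.zero_of_nonpos (div_nonpos_of_nonpos_of_nonneg (by linarith)
    (by linarith [h.tStart_lt]))

theorem cut_of_ge (ht : tOn S ε S' ≤ t) : cut S ε S' t = 1 := by
  refine smoothTransition.one_of_one_le ?_
  rw [one_le_div (by linarith [h.tStart_lt])]
  linarith

theorem deriv_cut_le {C : ℝ} (hC : ∀ x, |deriv smoothTransition x| ≤ C) (t : ℝ) :
    |deriv (cut S ε S') t| ≤ C * S ^ 2 := by
  have hs : ContDiff ℝ ∞ smoothTransition := smoothTransition.contDiff
  have h1 := (hasDerivAt_of_smooth hs ((t - tStart S ε S') / (tOn S ε S' - tStart S ε S'))).comp t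
    (((hasDerivAt_id t).sub_const (tStart S ε S')).div_const (tOn S ε S' - tStart S ε S'))
  have hpos := h.Sε_pos
  have e : tOn S ε S' - tStart S ε S' = 10 / (S ^ 2 * ε ^ 2) := by
    unfold tOn tStart; field_simp; ring
  have hC0 : 0 ≤ C := (abs_nonneg _).trans (hC 0)
  rw [show cut S ε S' = smoothTransition ∘ fun t =>
    (id t - tStart S ε S') / (tOn S ε S' - tStart S ε S') from rfl, h1.deriv, abs_mul]
  refine mul_le_mul (hC _) ?_ (abs_nonneg _) hC0
  rw [e, one_div_div, abs_of_pos (by positivity), div_le_iff₀ (by norm_num)]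
  have h3 : ε ^ 2 ≤ 1 := pow_le_one₀ h.ε_pos.le h.ε_le_one
  nlinarith [pow_pos h.S_pos 2]

theorem k2_end_pos : 0 < P.k2 (tEnd S') := P.k2_pos h ⟨le_rfl, h.tEnd_le⟩

theorem amp_pos (t : ℝ) : 0 < P.amp t := by
  have := h.S'_pos
  have := P.k2_end_pos h
  unfold amp
  positivity

theorem amp_le_of {M : ℝ} (hM : P.growth t ≤ M) : P.amp t ≤ S ^ 16 * exp M / S' ^ 6 := by
  have hk := P.k2_late h (t := tEnd S') ⟨le_rfl, h.tEnd_le⟩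
  have hkp := P.k2_end_pos h
  have hS' := h.S'_pos
  have hS := h.S_pos
  unfold amp
  rw [mul_inv]
  have h1 : (P.k2 (tEnd S'))⁻¹ ≤ S ^ 16 := by
    rw [inv_le_iff_one_le_mul₀ hkp]; linarith [hk.1]
  calc (S' ^ 6)⁻¹ * (P.k2 (tEnd S'))⁻¹ * exp (P.growth t) ≤ (S' ^ 6)⁻¹ * S ^ 16 * exp M := by
        gcongr
    _ = _ := by field_simp

theorem amp_le (ht : t ∈ Set.Icc (tStart S ε S') 1) : P.amp t ≤ S ^ 160 * (1 / S' ^ 4) := by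
  have hS' := h.S'_pos
  have hS := h.S_pos
  have key : P.growth t ≤ 600 := by
    rcases le_total t (tEnd S') with hle | hle
    · exact P.growth_le h ⟨ht.1, hle⟩
    · have h1 := (convex_Icc (tEnd S') t).norm_image_sub_le_of_norm_deriv_le (f := P.growth)
        (C := 6 * S ^ 2) (fun r _ => P.smooth_growth.differentiable (by simp) r)
        (fun r hr => by
          rw [P.deriv_growth]
          exact P.rate_le h ⟨h.tEnd_mem'.1.trans hr.1, hr.2.trans ht.2⟩)
        ⟨le_rfl, hle⟩ ⟨hle, le_rfl⟩
      rw [P.growth_end, sub_zero, Real.norm_eq_abs, Real.norm_eq_abs,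
        abs_of_nonneg (sub_nonneg.2 hle)] at h1
      have h2 : 6 * S ^ 2 * (t - tEnd S') ≤ 6 * S ^ 2 * (1 / S ^ 2) := by
        gcongr
        exact (sub_tEnd_le ht.2).trans (h.inv_S'_le (by norm_num))
      have h3 : 6 * S ^ 2 * (1 / S ^ 2) = 6 := by field_simp
      linarith [le_abs_self (P.growth t)]
  refine (P.amp_le_of h key).trans ?_
  rw [mul_one_div]
  have h1 : S' ^ 4 ≤ S' ^ 6 := pow_le_pow_right₀ h.one_le_S' (by norm_num)
  have h2 : S ^ 16 * exp 600 ≤ S ^ 160 := by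
    calc S ^ 16 * exp 600 ≤ S ^ 16 * S := by gcongr; exact h.exp_le
      _ = S ^ 17 := by ring
      _ ≤ _ := h.pow_le_pow (by norm_num)
  gcongr

theorem deriv_cut_mul_amp_le {C : ℝ} (hC : ∀ x, |deriv smoothTransition x| ≤ C) (t : ℝ) :
    |deriv (cut S ε S') t * P.amp t| ≤ C * S ^ 2 * exp (600 - 1 / (100 * ε)) := by
  have hC0 : 0 ≤ C := (abs_nonneg _).trans (hC 0)
  have hS := h.S_pos
  have hS' := h.S'_pos
  by_cases ht : t ∈ Set.Icc (tStart S ε S') (tOn S ε S')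
  · rw [abs_mul, abs_of_pos (P.amp_pos h t)]
    refine mul_le_mul (deriv_cut_le h hC t) ?_ (P.amp_pos h t).le (by positivity)
    refine (P.amp_le_of h (P.growth_le_early h ht)).trans ?_
    rw [div_le_iff₀ (by positivity), mul_comm]
    gcongr
    calc S ^ 16 ≤ S' := h.S_pow_le (by norm_num)
      _ ≤ S' ^ 6 := le_self_pow₀ h.one_le_S' (by norm_num)
  · have h0 : deriv (cut S ε S') t = 0 := by
      rw [Set.mem_Icc, not_and_or, not_le, not_le] at ht
      rcases ht with ht | ht
      · have : cut S ε S' =ᶠ[𝓝 t] fun _ => 0 := by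
          filter_upwards [gt_mem_nhds ht] with r hr
          exact cut_of_le h (le_of_lt hr)
        rw [this.deriv_eq, deriv_const]
      · have : cut S ε S' =ᶠ[𝓝 t] fun _ => 1 := by
          filter_upwards [lt_mem_nhds ht] with r hr
          exact cut_of_ge h (le_of_lt hr)
        rw [this.deriv_eq, deriv_const]
    rw [h0, zero_mul, abs_zero]
    positivity

theorem abs_h_le {x g : ℝ} (hx : |x| ≤ 2 * S ^ 2) (hg : |g| ≤ Y) : |g + x| ≤ S ^ 4 := by
  have h1 := h.Y_le_one_mul
  calc |g + x| ≤ |g| + |x| := abs_add_le _ _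
    _ ≤ S ^ 1 + 2 * S ^ 2 := by linarith
    _ ≤ S ^ 3 + 2 * S ^ 3 := by
      have := h.pow_le_pow (show 1 ≤ 3 by norm_num)
      have := h.pow_le_pow (show 2 ≤ 3 by norm_num)
      linarith
    _ = 3 * S ^ 3 := by ring
    _ ≤ _ := h.mul_pow_le (by norm_num) (by norm_num)

/-- The layer grown on the background. -/
noncomputable def stage : Stage where
  N := S' ^ 8
  X := S ^ 160
  η := 1 / S' ^ 4
  s0 := tStart S ε S'
  b1 := P.b1
  b2 := P.b2
  k1 := P.k1
  k2 := P.k2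
  g1 := P.h1
  g2 := P.h2
  A := P.amp
  θ := cut S ε S'
  one_le_N := one_le_pow₀ h.one_le_S'
  one_le_X := one_le_pow₀ h.one_le_S
  η_pos := by have := h.S'_pos; positivity
  η_le := by
    rw [div_le_one (pow_pos h.S'_pos 4)]
    exact one_le_pow₀ h.one_le_S'
  inv_N_le := one_div_le_one_div_of_le (pow_pos h.S'_pos 4)
    (pow_le_pow_right₀ h.one_le_S' (by norm_num))
  s0_nonneg := h.tStart_nonneg
  smooth_b1 := P.smooth_b1
  smooth_b2 := P.smooth_b2
  smooth_k1 := P.smooth_k1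
  smooth_k2 := P.smooth_k2
  smooth_g1 := P.smooth_h1
  smooth_g2 := P.smooth_h2
  smooth_A := P.smooth_amp
  smooth_θ := smooth_cut S ε S'
  k_pos := P.k_pos
  deriv_A := P.deriv_amp
  θ_zero := fun t ht => cut_of_le h ht
  b1_le := fun t ht => (P.abs_b1_le h (h.mem_of_mem ht)).trans (h.pow_le_pow (by norm_num))
  b2_le := fun t ht => (P.abs_b2_le (h.mem_of_mem ht)).trans (h.pow_le_pow (by norm_num))
  k1_le := fun t ht => (P.abs_k_le h ht (P.abs_b1_le h (h.mem_of_mem ht))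
    (P.abs_d_le h (h.mem_of_mem ht) (P.d1_le t (h.mem_of_mem ht)))).trans
    (h.pow_le_pow (by norm_num))
  k2_le := fun t ht => (P.abs_k_le h ht (P.abs_b2_le (h.mem_of_mem ht))
    (P.abs_d_le h (h.mem_of_mem ht) (P.d2_le t (h.mem_of_mem ht)))).trans
    (h.pow_le_pow (by norm_num))
  g1_le := fun t ht => (abs_h_le h (P.a_mul_b1_le h (h.mem_of_mem ht))
    (P.g1_le t (h.mem_of_mem ht))).trans (h.pow_le_pow (by norm_num))
  g2_le := fun t ht => (abs_h_le h (P.abs_a_mul_b2_le h (h.mem_of_mem ht))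
    (P.g2_le t (h.mem_of_mem ht))).trans (h.pow_le_pow (by norm_num))
  deriv_b1_le := fun t ht =>
    (P.abs_deriv_b1_le h (h.mem_of_mem ht)).trans (h.pow_le_pow (by norm_num))
  deriv_b2_le := fun t ht =>
    (P.abs_deriv_b2_le h (h.mem_of_mem ht)).trans (h.pow_le_pow (by norm_num))
  deriv_k1_le := fun t ht => by
    have hI := h.mem_of_mem ht
    rw [P.deriv_k1]
    exact (P.abs_deriv_k_le h ht (P.abs_b1_le h hI) (P.abs_deriv_b1_le h hI)
      (P.deriv_d1_le t hI)).trans (h.pow_le_pow (by norm_num))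
  deriv_k2_le := fun t ht => by
    have hI := h.mem_of_mem ht
    rw [P.deriv_k2]
    exact (P.abs_deriv_k_le h ht (P.abs_b2_le hI)
      ((P.abs_deriv_b2_le h hI).trans (h.pow_le_pow (by norm_num)))
      (P.deriv_d2_le t hI)).trans (h.pow_le_pow (by norm_num))
  inv_k_le := fun t ht => (P.inv_norm_k_le h ht).trans (h.pow_le_pow (by norm_num))
  A_le := fun t ht => by
    rw [abs_of_pos (P.amp_pos h t)]; exact P.amp_le h ht
  θ_le := fun t => by
    unfold cut
    rw [abs_of_nonneg (smoothTransition.nonneg _)]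
    exact smoothTransition.le_one _

section late
variable (ht : t ∈ Set.Icc (tEnd S') 1)
include ht

theorem mem_of_late : t ∈ Set.Icc (tStart S ε S') 1 := ⟨h.tEnd_mem'.1.trans ht.1, ht.2⟩

theorem mem_of_late' : t ∈ Set.Icc (1 - 1 / S) 1 := h.mem_of_mem (mem_of_late h ht)

theorem cut_late : cut S ε S' t = 1 := cut_of_ge h (h.tOn_lt.le.trans ht.1)

theorem deriv_slope_late : |deriv P.k1 t * P.k2 t - P.k1 t * deriv P.k2 t| ≤
    S ^ 3 * P.k2 t ^ 2 := by
  have hI := mem_of_late' h ht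
  have hb := P.b2_pos hI
  have hk := P.k2_pos h ht
  have hz := P.deriv_z_le h ht
  have hzl := P.z_late h ht
  have hε := h.ε_pos
  have hz0 : 1 ≤ P.z t := by
    refine le_trans ?_ hzl.1
    rw [le_div_iff₀ (by positivity)]
    linarith [h.ε_le]
  have hD := P.D_pos
  have hdet : ∀ r, P.b2 r * P.k1 r = P.b1 r * P.k2 r - 8 * P.D := fun r => by
    linarith [P.det_k r]
  have e1 : deriv P.b2 t * P.k1 t + P.b2 t * deriv P.k1 t =
      deriv P.b1 t * P.k2 t + P.b1 t * deriv P.k2 t := by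
    have h1 := ((hasDerivAt_of_smooth P.smooth_b2 t).mul (hasDerivAt_of_smooth P.smooth_k1 t))
    have h2 := ((hasDerivAt_of_smooth P.smooth_b1 t).mul
      (hasDerivAt_of_smooth P.smooth_k2 t)).sub_const (8 * P.D)
    refine HasDerivAt.unique h1 ?_
    convert h2 using 1
    exact funext hdet
  have e2 := P.deriv_k2_mul hI
  have e3 : 8 * P.D * P.z t = P.k2 t * P.b2 t := by unfold z; field_simp
  have e4 : (deriv P.k1 t * P.k2 t - P.k1 t * deriv P.k2 t) * P.b2 t ^ 2 =
      (deriv P.b1 t * P.b2 t - P.b1 t * deriv P.b2 t) * P.k2 t ^ 2 +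
        (8 * P.D) ^ 2 * (P.f t + P.E t) := by
    have hd := hdet t
    linear_combination (P.k2 t * P.b2 t) * e1 + (8 * P.D) * e2 -
      (P.b2 t * deriv P.k2 t + deriv P.b2 t * P.k2 t) * hd
  have e5 : (8 * P.D) ^ 2 * (P.f t + P.E t) ≤ S ^ 2 / 2 * P.k2 t ^ 2 * P.b2 t ^ 2 := by
    have l1 : P.f t + P.E t ≤ S ^ 2 / 2 * P.z t ^ 2 := by
      refine hz.1.trans ?_
      have := h.S_pos
      gcongr
      nlinarith
    calc (8 * P.D) ^ 2 * (P.f t + P.E t) ≤ (8 * P.D) ^ 2 * (S ^ 2 / 2 * P.z t ^ 2) := by gcongr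
      _ = S ^ 2 / 2 * (8 * P.D * P.z t) ^ 2 := by ring
      _ = _ := by rw [e3]; ring
  have hY := h.Y_le_one_mul
  have hS := h.S_pos
  refine le_of_mul_le_mul_right (a := P.b2 t ^ 2) ?_ (by positivity)
  rw [← abs_of_pos (show 0 < P.b2 t ^ 2 by positivity), ← abs_mul,
    abs_of_pos (show 0 < P.b2 t ^ 2 by positivity), e4]
  calc _ ≤ Y * P.b2 t ^ 2 * P.k2 t ^ 2 + S ^ 2 / 2 * P.k2 t ^ 2 * P.b2 t ^ 2 := by
        refine (abs_add_le _ _).trans (add_le_add ?_ ?_)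
        · rw [abs_mul, abs_of_pos (pow_pos hk 2)]
          gcongr
          exact P.deriv_b_le t hI
        · rw [abs_of_nonneg (mul_nonneg (by positivity) hz.2)]
          exact e5
    _ = (Y + S ^ 2 / 2) * (P.k2 t ^ 2 * P.b2 t ^ 2) := by ring
    _ ≤ S ^ 3 * (P.k2 t ^ 2 * P.b2 t ^ 2) := by
      gcongr
      have l1 : 1 * S ^ 2 ≤ S ^ 3 := h.mul_pow_le (by norm_num) (by norm_num)
      have l2 : 2 * S ^ 1 ≤ S ^ 2 := h.mul_pow_le (by norm_num) (by norm_num)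
      linarith
    _ = _ := by ring

theorem slope_late : |P.k1 t / P.k2 t - ε'| ≤ ε' / 2 := by
  have e0 : P.k1 (tEnd S') / P.k2 (tEnd S') = ε' := by
    have hk := P.k2_end_pos h
    have hb := P.b2_pos h.tEnd_mem
    have h1 := P.det_k (tEnd S')
    have h2 := P.p_end
    change P.k2 (tEnd S') * _ = _ at h2
    rw [div_eq_iff hk.ne']
    refine mul_left_cancel₀ hb.ne' ?_
    linarith
  have hd : ∀ r ∈ Set.Icc (tEnd S') t, HasDerivWithinAt (fun r => P.k1 r / P.k2 r)
      ((deriv P.k1 r * P.k2 r - P.k1 r * deriv P.k2 r) / P.k2 r ^ 2) (Set.Icc (tEnd S') t) r :=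
    fun r hr => ((hasDerivAt_of_smooth P.smooth_k1 r).div (hasDerivAt_of_smooth P.smooth_k2 r)
      (P.k2_pos h ⟨hr.1, hr.2.trans ht.2⟩).ne').hasDerivWithinAt
  have := (convex_Icc (tEnd S') t).norm_image_sub_le_of_norm_hasDerivWithin_le (C := S ^ 3) hd
    (fun r hr => by
      have hr' : r ∈ Set.Icc (tEnd S') 1 := ⟨hr.1, hr.2.trans ht.2⟩
      have hk := P.k2_pos h hr'
      rw [Real.norm_eq_abs, abs_div, abs_of_pos (pow_pos hk 2), div_le_iff₀ (pow_pos hk 2)]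
      exact P.deriv_slope_late h hr') ⟨le_rfl, ht.1⟩ ⟨ht.1, le_rfl⟩
  rw [e0, Real.norm_eq_abs, Real.norm_eq_abs, abs_of_nonneg (sub_nonneg.2 ht.1)] at this
  refine this.trans ?_
  have hS := h.S_pos
  calc S ^ 3 * (t - tEnd S') ≤ S ^ 3 * (1 / S ^ 5) := by
        gcongr; exact (sub_tEnd_le ht.2).trans (h.inv_S'_le (by norm_num))
    _ = (1 / S) / S := by field_simp
    _ ≤ ε' / S := by gcongr; rw [div_le_iff₀ hS]; exact h.one_le
    _ ≤ ε' / 2 := by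
      have := h.ε'_pos
      have := h.le_S
      gcongr; linarith

theorem deriv_det_late : |P.b2 t * deriv P.k2 t - deriv P.b2 t * P.k2 t| ≤ S ^ 4 * (8 * P.D) := by
  have hI := mem_of_late' h ht
  have hD := P.D_pos
  have hS := h.S_pos
  have hε := h.ε_pos
  have e2 := P.deriv_k2_mul hI
  have hzl := P.z_late h ht
  have hz := P.deriv_z_le h ht
  have hb := P.b2_pos hI
  have e3 : 8 * P.D * P.z t = P.k2 t * P.b2 t := by unfold z; field_simp
  have hz0 : 0 ≤ P.z t := le_trans (by positivity) hzl.1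
  have hzS : P.z t ≤ S ^ 1 := by
    have := h.inv_ε_le
    have e : 4 / ε = 4 * (1 / ε) := by ring
    rw [pow_one]
    linarith
  have hY := h.Y_le_one_mul
  have hY1 := h.one_le_Y
  have hk := P.k2_pos h ht
  calc |P.b2 t * deriv P.k2 t - deriv P.b2 t * P.k2 t|
      = |8 * P.D * (P.f t + P.E t) - 2 * P.k2 t * deriv P.b2 t| := by
        congr 1; linear_combination e2
    _ ≤ 8 * P.D * (S ^ 2 / 2 * P.z t) + 2 * P.k2 t * (Y * P.b2 t) := by
        refine (abs_sub _ _).trans (add_le_add ?_ ?_)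
        · rw [abs_of_nonneg (mul_nonneg (by positivity) hz.2)]
          gcongr
          exact hz.1
        · rw [abs_mul, abs_of_pos (by positivity : 0 < 2 * P.k2 t)]
          gcongr
          exact P.deriv_b2_le t hI
    _ = (S ^ 2 / 2 * P.z t + 2 * Y * P.z t) * (8 * P.D) := by linear_combination -2 * Y * e3
    _ ≤ (S ^ 2 / 2 * S ^ 1 + 2 * S ^ 1 * S ^ 1) * (8 * P.D) := by gcongr
    _ ≤ _ := by
      gcongr
      have l1 : 1 * S ^ 3 ≤ S ^ 4 := h.mul_pow_le (by norm_num) (by norm_num)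
      have l2 : 2 * S ^ 2 ≤ S ^ 3 := h.mul_pow_le (by norm_num) (by norm_num)
      calc S ^ 2 / 2 * S ^ 1 + 2 * S ^ 1 * S ^ 1 = S ^ 3 / 2 + 2 * S ^ 2 := by ring
        _ ≤ S ^ 3 / 2 + S ^ 3 := by linarith
        _ ≤ 2 * S ^ 3 := by linarith [pow_pos hS 3]
        _ ≤ _ := h.mul_pow_le (by norm_num) (by norm_num)

end late

end Phase

namespace Phase
variable {S ε Y S' ε' : ℝ} (P : Phase S ε Y S' ε')

theorem deriv_const_mul_smooth {f : ℝ → ℝ} (hf : ContDiff ℝ ∞ f) (C t : ℝ) :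
    deriv (fun t => C * f t) t = C * deriv f t :=
  ((hasDerivAt_of_smooth hf t).const_mul C).deriv

theorem old_le (h : Admissible S ε Y S' ε') {t b : ℝ} (ht : t ∈ Set.Icc (tEnd S') 1)
    (hb : |b| ≤ S ^ 16) : |b| * S' ^ 4 ≤ S' ^ 8 * P.k2 t := by
  have hk := P.k2_pos h ht
  have hS' := h.S'_pos
  have hS := h.S_pos
  have h1 : S ^ 16 * S ^ 16 ≤ S' ^ 4 := by
    calc S ^ 16 * S ^ 16 = S ^ 32 := by ring
      _ ≤ S' := h.S_pow_le (by norm_num)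
      _ ≤ _ := le_self_pow₀ h.one_le_S' (by norm_num)
  calc |b| * S' ^ 4 ≤ S ^ 16 * S' ^ 4 * 1 := by rw [mul_one]; gcongr
    _ ≤ S ^ 16 * S' ^ 4 * (P.k2 t * S ^ 16) := by gcongr; exact (P.k2_late h ht).1
    _ = (S ^ 16 * S ^ 16) * S' ^ 4 * P.k2 t := by ring
    _ ≤ S' ^ 4 * S' ^ 4 * P.k2 t := by gcongr
    _ = _ := by ring

/-- The coefficients after the layer is grown. -/
noncomputable def next (h : Admissible S ε Y S' ε') : Coef S' ε' (S ^ 8) where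
  b1 t := S' ^ 8 * P.k1 t
  b2 t := S' ^ 8 * P.k2 t
  d1 := P.b1
  d2 := P.b2
  a t := cut S ε S' t * P.amp t
  g1 := P.h1
  g2 := P.h2
  D := S' ^ 8 * (8 * P.D)
  smooth_b1 := contDiff_const.mul P.smooth_k1
  smooth_b2 := contDiff_const.mul P.smooth_k2
  smooth_d1 := P.smooth_b1
  smooth_d2 := P.smooth_b2
  smooth_a := (smooth_cut S ε S').mul P.smooth_amp
  smooth_g1 := P.smooth_h1
  smooth_g2 := P.smooth_h2
  det t := by rw [← P.det_k t]; ring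
  one_le_D := by
    have h1 := one_le_pow₀ h.one_le_S' (n := 8)
    have := P.one_le_D
    nlinarith
  D_le := by
    have hS' := h.S'_pos
    calc S' ^ 8 * (8 * P.D) ≤ S' ^ 8 * (8 * S ^ 16) := by gcongr; exact P.D_le
      _ ≤ S' ^ 8 * S' ^ 8 := by
        gcongr
        calc 8 * S ^ 16 ≤ S ^ 17 := h.mul_pow_le (by norm_num) (by norm_num)
          _ ≤ S' := h.S_pow_le (by norm_num)
          _ ≤ S' ^ 8 := le_self_pow₀ h.one_le_S' (by norm_num)
      _ = _ := by ring
  one_le_b2 t ht := by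
    have h1 := P.k2_late h ht
    have hk := P.k2_pos h ht
    have h2 : S ^ 16 ≤ S' ^ 8 := (h.S_pow_le (by norm_num)).trans
      (le_self_pow₀ h.one_le_S' (by norm_num))
    calc 1 ≤ P.k2 t * S ^ 16 := h1.1
      _ ≤ P.k2 t * S' ^ 8 := by gcongr
      _ = _ := by ring
  b2_le t ht := by
    have h1 := P.k2_late h ht
    have hS' := h.S'_pos
    calc S' ^ 8 * P.k2 t ≤ S' ^ 8 * S' ^ 8 := by
          gcongr
          exact h1.2.trans ((h.S_pow_le (by norm_num)).trans
            (le_self_pow₀ h.one_le_S' (by norm_num)))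
      _ = _ := by ring
  le_b1 t ht := by
    have hk := P.k2_pos h ht
    have hS' := h.S'_pos
    have h1 := (abs_le.1 (P.slope_late h ht)).1
    have h2 : ε' / 2 ≤ P.k1 t / P.k2 t := by linarith
    rw [le_div_iff₀ hk] at h2
    calc ε' / 2 * (S' ^ 8 * P.k2 t) = S' ^ 8 * (ε' / 2 * P.k2 t) := by ring
      _ ≤ _ := by gcongr
  b1_le t ht := by
    have hk := P.k2_pos h ht
    have hS' := h.S'_pos
    have h1 := (abs_le.1 (P.slope_late h ht)).2
    have h2 : P.k1 t / P.k2 t ≤ 2 * ε' := by linarith [h.ε'_pos]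
    rw [div_le_iff₀ hk] at h2
    calc S' ^ 8 * P.k1 t ≤ S' ^ 8 * (2 * ε' * P.k2 t) := by gcongr
      _ = _ := by ring
  le_a t ht := by
    rw [cut_late h ht, one_mul]; exact (P.amp_late h ht).1
  a_le t ht := by
    rw [cut_late h ht, one_mul]; exact (P.amp_late h ht).2
  deriv_b_le t ht := by
    rw [deriv_const_mul_smooth P.smooth_k1, deriv_const_mul_smooth P.smooth_k2]
    have hS' := h.S'_pos
    calc |S' ^ 8 * deriv P.k1 t * (S' ^ 8 * P.k2 t) - S' ^ 8 * P.k1 t * (S' ^ 8 * deriv P.k2 t)|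
        = (S' ^ 8) ^ 2 * |deriv P.k1 t * P.k2 t - P.k1 t * deriv P.k2 t| := by
          rw [← abs_of_pos (show 0 < (S' ^ 8) ^ 2 by positivity), ← abs_mul]
          congr 1; ring
      _ ≤ (S' ^ 8) ^ 2 * (S ^ 8 * P.k2 t ^ 2) := by
          gcongr
          refine (P.deriv_slope_late h ht).trans ?_
          gcongr ?_ * _
          exact h.pow_le_pow (by norm_num)
      _ = _ := by ring
  deriv_b2_le t ht := by
    rw [deriv_const_mul_smooth P.smooth_k2, abs_mul, abs_of_pos (pow_pos h.S'_pos 8)]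
    have hS' := h.S'_pos
    have hk := P.k2_pos h ht
    calc S' ^ 8 * |deriv P.k2 t| ≤ S' ^ 8 * (S ^ 8 * P.k2 t) := by
          gcongr
          refine (P.abs_deriv_k2_late h ht).trans ?_
          gcongr ?_ * _
          exact h.pow_le_pow (by norm_num)
      _ = _ := by ring
  deriv_d_le t ht := by
    rw [deriv_const_mul_smooth P.smooth_k2]
    have hS' := h.S'_pos
    have hD := P.D_pos
    calc |P.b2 t * (S' ^ 8 * deriv P.k2 t) - deriv P.b2 t * (S' ^ 8 * P.k2 t)|
        = S' ^ 8 * |P.b2 t * deriv P.k2 t - deriv P.b2 t * P.k2 t| := by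
          rw [← abs_of_pos (show 0 < S' ^ 8 by positivity), ← abs_mul,
            abs_of_pos (show 0 < S' ^ 8 by positivity)]
          congr 1; ring
      _ ≤ S' ^ 8 * (S ^ 8 * (8 * P.D)) := by
          gcongr
          refine (P.deriv_det_late h ht).trans ?_
          gcongr ?_ * _
          exact h.pow_le_pow (by norm_num)
      _ = _ := by ring
  g1_le t ht := (abs_h_le h (P.a_mul_b1_le h (mem_of_late' h ht))
    (P.g1_le t (mem_of_late' h ht))).trans (h.pow_le_pow (by norm_num))
  g2_le t ht := (abs_h_le h (P.abs_a_mul_b2_le h (mem_of_late' h ht))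
    (P.g2_le t (mem_of_late' h ht))).trans (h.pow_le_pow (by norm_num))
  d1_le t ht := P.old_le h ht (P.abs_b1_le h (mem_of_late' h ht))
  d2_le t ht := P.old_le h ht (P.abs_b2_le (mem_of_late' h ht))
  deriv_d1_le t ht := (P.abs_deriv_b1_le h (mem_of_late' h ht)).trans
    ((h.S_pow_le (by norm_num)).trans (le_self_pow₀ h.one_le_S' (by norm_num)))
  deriv_d2_le t ht := (P.abs_deriv_b2_le h (mem_of_late' h ht)).trans
    ((h.S_pow_le (by norm_num)).trans (le_self_pow₀ h.one_le_S' (by norm_num)))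

end Phase

/-- A potential whose innermost part is described by the coefficients `c`. -/
structure Flow {S ε Y : ℝ} (c : Coef S ε Y) (φ : ST → ℝ) : Prop where
  smooth : ContDiff ℝ ∞ φ
  supp : ∀ p : ST, p.2 ≤ 1 → 1 < p.1.1 ^ 2 + p.1.2 ^ 2 → φ p = 0
  subset : ∀ p : ST, p.2 ∈ Set.Icc (1 - 1 / S) 1 → |lin c.b1 c.b2 p| ≤ 1 →
    |lin c.d1 c.d2 p| ≤ 1 / 4 → p.1.1 ^ 2 + p.1.2 ^ 2 ≤ 1
  dx_rho : ∀ p : ST, p.2 ∈ Set.Icc (1 - 1 / S) 1 → |lin c.b1 c.b2 p| ≤ 1 →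
    |lin c.d1 c.d2 p| ≤ 1 / 4 → dx (rho φ) p = c.g1 p.2 + c.a p.2 * c.b1 p.2
  dy_rho : ∀ p : ST, p.2 ∈ Set.Icc (1 - 1 / S) 1 → |lin c.b1 c.b2 p| ≤ 1 →
    |lin c.d1 c.d2 p| ≤ 1 / 4 → dy (rho φ) p = c.g2 p.2 + c.a p.2 * c.b2 p.2
  transport_b : ∀ p : ST, p.2 ∈ Set.Icc (1 - 1 / S) 1 → |lin c.b1 c.b2 p| ≤ 1 →
    |lin c.d1 c.d2 p| ≤ 1 / 4 →
    lin (deriv c.b1) (deriv c.b2) p + (c.b1 p.2 * vel1 φ p + c.b2 p.2 * vel2 φ p) = 0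
  transport_d : ∀ p : ST, p.2 ∈ Set.Icc (1 - 1 / S) 1 → |lin c.b1 c.b2 p| ≤ 1 →
    |lin c.d1 c.d2 p| ≤ 1 / 4 →
    lin (deriv c.d1) (deriv c.d2) p + (c.d1 p.2 * vel1 φ p + c.d2 p.2 * vel2 φ p) =
      c.a p.2 * c.D * (c.b1 p.2 * (c.b1 p.2 ^ 2 + c.b2 p.2 ^ 2)⁻¹) * lin c.b1 c.b2 p

namespace Phase
variable {S ε Y S' ε' : ℝ} (P : Phase S ε Y S' ε') (h : Admissible S ε Y S' ε')
variable {φ : ST → ℝ} {K J : ℕ} {w : Fam}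

theorem lin_k (p : ST) : lin P.k1 P.k2 p = P.p p.2 * lin P.b1 P.b2 p - 8 * lin P.d1 P.d2 p := by
  simp only [lin, k1, k2]; ring

section
include h

theorem abs_lin_d_le {p : ST} (hp : p.2 ∈ Set.Icc (tStart S ε S') 1)
    (h1 : |lin P.b1 P.b2 p| ≤ 1) (h2 : |lin P.k1 P.k2 p| ≤ 1) : |lin P.d1 P.d2 p| ≤ 1 / 4 := by
  have h3 := P.abs_p_le h hp
  have h4 : |P.p p.2 * lin P.b1 P.b2 p| ≤ 1 := by
    rw [abs_mul]
    exact mul_le_one₀ h3 (abs_nonneg _) h1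
  rw [P.lin_k] at h2
  rw [abs_le] at *
  constructor <;> linarith

theorem background (hφ : Flow P.toCoef φ) : Background (P.stage h) φ := by
  refine ⟨hφ.smooth, fun p hp h1 h2 => ?_, fun p hp h1 h2 => ?_, fun p hp h1 h2 => ?_,
    fun p hp h1 h2 => ?_⟩
  · exact hφ.dx_rho p (h.mem_of_mem hp) h1 (P.abs_lin_d_le h hp h1 h2)
  · exact hφ.dy_rho p (h.mem_of_mem hp) h1 (P.abs_lin_d_le h hp h1 h2)
  · exact hφ.transport_b p (h.mem_of_mem hp) h1 (P.abs_lin_d_le h hp h1 h2)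
  · have e1 := hφ.transport_b p (h.mem_of_mem hp) h1 (P.abs_lin_d_le h hp h1 h2)
    have e2 := hφ.transport_d p (h.mem_of_mem hp) h1 (P.abs_lin_d_le h hp h1 h2)
    change lin (deriv P.k1) (deriv P.k2) p + (P.k1 p.2 * vel1 φ p + P.k2 p.2 * vel2 φ p) = 0
    have hp' := P.deriv_p p.2
    simp only [lin] at e1 e2 ⊢
    rw [P.deriv_k1, P.deriv_k2, k1, k2]
    linear_combination P.p p.2 * e1 - 8 * e2 +
      (P.b1 p.2 * p.1.1 + P.b2 p.2 * p.1.2) * hp'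

theorem addLayer_eq_old (w : Fam) {p : ST} (hp : p.2 ≤ 1 - 1 / S) :
    addLayer w (P.stage h) φ p = φ p :=
  addLayer_of_le (hp.trans h.le_tStart)

theorem flow_next (hφ : Flow P.toCoef φ) (hw : IsLayer K J w) :
    Flow (P.next h) (addLayer w (P.stage h) φ) := by
  have hS' := h.S'_pos
  have hN0 : (0 : ℝ) < S' ^ 8 := pow_pos hS' 8
  have hlin (p : ST) : lin (P.next h).b1 (P.next h).b2 p = S' ^ 8 * lin P.k1 P.k2 p := by
    simp only [lin, next]; ring
  have key : ∀ p : ST, p.2 ∈ Set.Icc (1 - 1 / S') 1 → |lin (P.next h).b1 (P.next h).b2 p| ≤ 1 →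
      |lin (P.next h).d1 (P.next h).d2 p| ≤ 1 / 4 → p.2 ∈ Set.Icc (tStart S ε S') 1 ∧
      |lin P.b1 P.b2 p| < 1 / 2 ∧ |lin P.k1 P.k2 p| < 1 / 2 ∧
      |S' ^ 8 * lin P.k1 P.k2 p| < 11 / 10 := by
    intro p hp h1 h2
    rw [hlin] at h1
    refine ⟨mem_of_late h hp, lt_of_le_of_lt h2 (by norm_num), ?_, by linarith⟩
    rw [abs_mul, abs_of_pos hN0] at h1
    have h3 : (10 : ℝ) ≤ S' ^ 8 := by
      have : S' ≤ S' ^ 8 := le_self_pow₀ h.one_le_S' (by norm_num)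
      have := h.S_pow_le (m := 1) (by norm_num)
      have := h.le_S
      linarith
    nlinarith [abs_nonneg (lin P.k1 P.k2 p)]
  have inner := fun p hp h1 h2 => hw.inner_formulas (S := P.stage h) (p := p) hφ.smooth
    (key p hp h1 h2).2.1 (key p hp h1 h2).2.2.1 (key p hp h1 h2).2.2.2
  refine ⟨hw.smooth_addLayer hφ.smooth, fun p hp hx => ?_, fun p hp h1 h2 => ?_,
    fun p hp h1 h2 => ?_, fun p hp h1 h2 => ?_, fun p hp h1 h2 => ?_, fun p hp h1 h2 => ?_⟩
  · rcases le_total p.2 (tStart S ε S') with ht | ht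
    · rw [addLayer_of_le (show p.2 ≤ (P.stage h).s0 from ht)]
      exact hφ.supp p hp hx
    · by_cases hq : 1 < |lin P.b1 P.b2 p| ∨ 1 < |lin P.k1 P.k2 p|
      · rw [(hw.addLayer_of_outside (S := P.stage h) hq).eq_of_nhds]
        exact hφ.supp p hp hx
      · push Not at hq
        exact absurd (hφ.subset p (h.mem_of_mem ⟨ht, hp⟩) hq.1
          (P.abs_lin_d_le h ⟨ht, hp⟩ hq.1 hq.2)) hx.not_ge
  · obtain ⟨ht, k1, k2, -⟩ := key p hp h1 h2
    exact hφ.subset p (h.mem_of_mem ht) (by linarith)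
      (P.abs_lin_d_le h ht (by linarith) (by linarith))
  · obtain ⟨ht, k1, k2, -⟩ := key p hp h1 h2
    rw [(inner p hp h1 h2).1, (P.background h hφ).dx_rho p ht
      (show |lin P.b1 P.b2 p| ≤ 1 by linarith) (show |lin P.k1 P.k2 p| ≤ 1 by linarith)]
    rfl
  · obtain ⟨ht, k1, k2, -⟩ := key p hp h1 h2
    rw [(inner p hp h1 h2).2.1, (P.background h hφ).dy_rho p ht
      (show |lin P.b1 P.b2 p| ≤ 1 by linarith) (show |lin P.k1 P.k2 p| ≤ 1 by linarith)]
    rfl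
  · obtain ⟨ht, k1, k2, -⟩ := key p hp h1 h2
    have e := (P.background h hφ).transport_k p ht
      (show |lin P.b1 P.b2 p| ≤ 1 by linarith) (show |lin P.k1 P.k2 p| ≤ 1 by linarith)
    rw [(inner p hp h1 h2).2.2.1, (inner p hp h1 h2).2.2.2]
    simp only [lin, next, stage] at e ⊢
    rw [deriv_const_mul_smooth P.smooth_k1, deriv_const_mul_smooth P.smooth_k2]
    linear_combination S' ^ 8 * e
  · obtain ⟨ht, k1, k2, -⟩ := key p hp h1 h2
    have e := (P.background h hφ).transport_b p ht
      (show |lin P.b1 P.b2 p| ≤ 1 by linarith) (show |lin P.k1 P.k2 p| ≤ 1 by linarith)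
    have hd := P.det_k p.2
    have hk := P.k_pos p.2
    rw [(inner p hp h1 h2).2.2.1, (inner p hp h1 h2).2.2.2, hlin]
    simp only [Stage.a, Stage.γ, Stage.q]
    have hq : S' ^ 8 * (8 * P.D) * (S' ^ 8 * P.k1 p.2 * ((S' ^ 8 * P.k1 p.2) ^ 2 +
        (S' ^ 8 * P.k2 p.2) ^ 2)⁻¹) = 8 * P.D * (P.k1 p.2 * (P.k1 p.2 ^ 2 + P.k2 p.2 ^ 2)⁻¹) := by
      rw [show (S' ^ 8 * P.k1 p.2) ^ 2 + (S' ^ 8 * P.k2 p.2) ^ 2 =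
        (S' ^ 8) ^ 2 * (P.k1 p.2 ^ 2 + P.k2 p.2 ^ 2) by ring]
      field_simp
    simp only [lin, next, stage] at e hd ⊢
    rw [mul_assoc (cut S ε S' p.2 * P.amp p.2) _ (S' ^ 8 * P.k1 p.2 * _), hq]
    linear_combination e + cut S ε S' p.2 * P.amp p.2 * (P.k1 p.2 * (P.k1 p.2 ^ 2 + P.k2 p.2 ^ 2)⁻¹)
      * (S' ^ 8 * (P.k1 p.2 * p.1.1 + P.k2 p.2 * p.1.2)) * hd

theorem exists_large_deriv (hφ : Flow P.toCoef φ) (hw : IsLayer K J w) {t : ℝ}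
    (ht : t ∈ Set.Icc (1 - 1 / S) 1) :
    ∃ x : ℝ × ℝ, S / 4 ≤ |dy (rho (addLayer w (P.stage h) φ)) (x, t)| := by
  have hD := P.D_pos
  have hd := P.det t
  set x : ℝ × ℝ := (P.b2 t / (4 * P.D), -P.b1 t / (4 * P.D)) with hx
  have e1 : lin P.b1 P.b2 (x, t) = 0 := by
    simp only [lin, hx]; field_simp; ring
  have e2 : lin P.d1 P.d2 (x, t) = 1 / 4 := by
    simp only [lin, hx]; field_simp; linarith
  have e3 : lin P.k1 P.k2 (x, t) = -2 := by rw [P.lin_k, e1, e2]; norm_num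
  refine ⟨x, ?_⟩
  have hr : dy (rho (addLayer w (P.stage h) φ)) (x, t) = dy (rho φ) (x, t) :=
    (dir_congr (rho_congr (hw.addLayer_of_outside (S := P.stage h) (p := (x, t))
      (Or.inr (by change 1 < |lin P.k1 P.k2 (x, t)|; rw [e3]; norm_num)))) _).eq_of_nhds
  rw [hr, hφ.dy_rho (x, t) ht (by rw [e1]; norm_num) (by rw [e2]; norm_num)]
  have h1 := (abs_le.1 (P.g2_le t ht)).1
  have h2 := P.le_a t ht
  have h3 := h.Y_le_S
  have h4 := h.le_S
  refine le_trans ?_ (le_abs_self _)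
  have := h.one_le_Y
  change S / 4 ≤ P.g2 t + P.a t * P.b2 t
  nlinarith

end

end Phase

/-- The parameters of the flow at the level `l`. -/
noncomputable def levelS (l : ℝ) : ℝ := exp (l ^ 2 / 8)

/-- The slope parameter at the level `l`. -/
noncomputable def levelε (l : ℝ) : ℝ := 1 / l ^ 8

/-- A potential with an innermost part of level `l`. -/
def HasLevel (l : ℝ) (φ : ST → ℝ) : Prop :=
  ∃ c : Coef (levelS l) (levelε l) (exp l), Flow c φ

theorem levelS_pos (l : ℝ) : 0 < levelS l := exp_pos _

theorem levelS_pow (l : ℝ) (m : ℕ) : levelS l ^ m = exp (m * (l ^ 2 / 8)) := (exp_nat_mul _ m).symm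

theorem levelS_pow_eight (l : ℝ) : levelS l ^ 8 = exp (l ^ 2) := by
  rw [levelS_pow]; congr 1; push_cast; ring

theorem eventually_mul_pow_le_exp (C : ℝ) (m : ℕ) : ∀ᶠ l : ℝ in atTop, C * l ^ m ≤ exp l := by
  rcases le_or_gt C 0 with hC | hC
  · filter_upwards [eventually_ge_atTop 0] with l hl
    exact (mul_nonpos_of_nonpos_of_nonneg hC (pow_nonneg hl m)).trans (exp_pos l).le
  · filter_upwards [(isLittleO_pow_exp_atTop (n := m)).def (inv_pos.2 hC), eventually_ge_atTop 0]
      with l hl h0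
    rw [norm_of_nonneg (pow_nonneg h0 m), norm_of_nonneg (exp_pos l).le] at hl
    rwa [inv_mul_eq_div, le_div_iff₀ hC, mul_comm] at hl

theorem eventually_admissible : ∀ᶠ l : ℝ in atTop,
    Admissible (levelS l) (levelε l) (exp l) (levelS (l ^ 2)) (levelε (l ^ 2)) := by
  filter_upwards [eventually_ge_atTop 10000, eventually_mul_pow_le_exp (10 ^ 6) 16] with l hl he
  have hl0 : 0 < l := by linarith
  have hl1 : 1 ≤ l := by linarith
  have h16 : 10 ^ 6 * exp l * l ^ 16 ≤ levelS l := by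
    calc 10 ^ 6 * exp l * l ^ 16 = exp l * (10 ^ 6 * l ^ 16) := by ring
      _ ≤ exp l * exp l := by gcongr
      _ = exp (l + l) := (exp_add _ _).symm
      _ ≤ _ := exp_le_exp.2 (by nlinarith)
  have hp1 := one_le_pow₀ hl1 (n := 16)
  have hex : 1 ≤ exp l := one_le_exp hl0.le
  have hl8 : l ≤ l ^ 8 := le_self_pow₀ hl1 (by norm_num)
  have hpos := mul_pos (exp_pos l) (pow_pos hl0 16)
  refine ⟨by unfold levelε; positivity, ?_, hex, ?_, ?_, ?_, ?_, by unfold levelε; positivity, ?_, ?_⟩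
  · exact one_div_le_one_div_of_le (by norm_num) (by linarith)
  · rw [levelε, div_pow, one_pow, mul_one_div, le_div_iff₀ (by positivity)]
    calc _ = 10 ^ 6 * exp l * l ^ 16 := by ring
      _ ≤ _ := h16
  · nlinarith
  · exact exp_le_exp.2 (by nlinarith)
  · rw [levelS_pow]
    refine exp_le_exp.2 ?_
    have : (100 : ℝ) ≤ l ^ 2 := by nlinarith
    push_cast; nlinarith
  · rw [levelε, levelε, div_div]
    refine one_div_le_one_div_of_le (by positivity) ?_
    calc l ^ 8 * 100 ≤ l ^ 8 * l ^ 8 := by gcongr; linarith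
      _ = _ := by ring
  · rw [levelε, one_div_mul_eq_div, le_div_iff₀ (by positivity)]
    calc 1 * (l ^ 2) ^ 8 = 1 * 1 * l ^ 16 := by ring
      _ ≤ 10 ^ 6 * exp l * l ^ 16 := by gcongr; norm_num
      _ ≤ _ := h16

theorem eventually_increment_le (C C' : ℝ) (hC : 0 ≤ C) (hC' : 0 ≤ C') (m K : ℕ) :
    ∀ᶠ l : ℝ in atTop, C * (levelS l ^ 160) ^ m * ((levelS (l ^ 2) ^ 8) ^ K *
      (C' * levelS l ^ 2 * exp (600 - 1 / (100 * levelε l)) +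
        (1 / levelS (l ^ 2) ^ 4) ^ (2 * K + 1 + 1)) + 1 / levelS (l ^ 2) ^ 4) ≤ 1 / l := by
  filter_upwards [eventually_ge_atTop (100 * ((K : ℝ) + 2000)),
    eventually_ge_atTop (40 * (m : ℝ) + 2), eventually_mul_pow_le_exp (C * (C' + 2)) 1]
    with l h1 h2 h3
  have hK : (0 : ℝ) ≤ K := K.cast_nonneg
  have hm : (0 : ℝ) ≤ m := m.cast_nonneg
  have hl1 : 1 ≤ l := by linarith
  have hl2 : 1 ≤ l ^ 2 := one_le_pow₀ hl1
  have hl : l ≤ l ^ 2 := le_self_pow₀ hl1 (by norm_num)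
  have hl4 : l ^ 2 ≤ l ^ 4 := pow_le_pow_right₀ hl1 (by norm_num)
  have e1 : (levelS l ^ 160) ^ m = exp (20 * m * l ^ 2) := by
    rw [levelS_pow, ← exp_nat_mul]; congr 1; push_cast; ring
  have e2 : (levelS (l ^ 2) ^ 8) ^ K = exp (K * l ^ 4) := by
    rw [levelS_pow_eight, ← exp_nat_mul]; congr 1; ring
  have e3 : 1 / levelS (l ^ 2) ^ 4 = exp (-(l ^ 4 / 2)) := by
    rw [levelS_pow, one_div, ← exp_neg]; congr 1; push_cast; ring
  have e4 : exp (-(l ^ 4 / 2)) ^ (2 * K + 1 + 1) = exp (-(K * l ^ 4) - l ^ 4) := by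
    rw [← exp_nat_mul]; congr 1; push_cast; ring
  have e5 : levelS l ^ 2 = exp (l ^ 2 / 4) := by
    rw [levelS_pow]; congr 1; push_cast; ring
  have e6 : 1 / (100 * levelε l) = l ^ 8 / 100 := by
    unfold levelε; field_simp
  rw [e3, e1, e2, e4, e5, e6]
  have b1 : exp (K * l ^ 4) * (C' * exp (l ^ 2 / 4) * exp (600 - l ^ 8 / 100)) ≤
      C' * exp (-(l ^ 4 / 2)) := by
    calc _ = C' * exp (K * l ^ 4 + l ^ 2 / 4 + (600 - l ^ 8 / 100)) := by
          rw [exp_add, exp_add]; ring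
      _ ≤ _ := by
          gcongr
          nlinarith
  have b2 : exp (K * l ^ 4) * exp (-(K * l ^ 4) - l ^ 4) ≤ exp (-(l ^ 4 / 2)) := by
    rw [← exp_add]
    exact exp_le_exp.2 (by nlinarith)
  have b3 : exp (20 * m * l ^ 2) * exp (-(l ^ 4 / 2)) ≤ exp (-l) := by
    rw [← exp_add]
    refine exp_le_exp.2 ?_
    nlinarith
  rw [pow_one] at h3
  calc _ = C * exp (20 * m * l ^ 2) *
        (exp (K * l ^ 4) * (C' * exp (l ^ 2 / 4) * exp (600 - l ^ 8 / 100)) +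
        exp (K * l ^ 4) * exp (-(K * l ^ 4) - l ^ 4) + exp (-(l ^ 4 / 2))) := by ring
    _ ≤ C * exp (20 * m * l ^ 2) * (C' * exp (-(l ^ 4 / 2)) + exp (-(l ^ 4 / 2)) +
        exp (-(l ^ 4 / 2))) := by gcongr
    _ = C * (C' + 2) * (exp (20 * m * l ^ 2) * exp (-(l ^ 4 / 2))) := by ring
    _ ≤ C * (C' + 2) * exp (-l) := by gcongr
    _ ≤ 1 / l := by
      rw [exp_neg, ← div_eq_mul_inv, div_le_div_iff₀ (exp_pos l) (by linarith), one_mul]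
      exact h3

/-- A layer raises the level and changes the low derivatives of the source only slightly. -/
theorem exists_next (K : ℕ) : ∀ᶠ l : ℝ in atTop, ∀ φ, HasLevel l φ → ∃ φ', HasLevel (l ^ 2) φ' ∧
    (∀ p : ST, p.2 ≤ 1 - 1 / levelS l → φ' p = φ p) ∧
    (∀ i k, i + k ≤ K → ∀ p : ST, p.2 ≤ 1 →
      |dx^[i] (dy^[k] (force φ')) p - dx^[i] (dy^[k] (force φ)) p| ≤ 1 / l) ∧
    ∀ t ∈ Set.Icc (1 - 1 / levelS l) 1, ∃ x, levelS l / 4 ≤ |dy (rho φ') (x, t)| := by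
  obtain ⟨w, hw⟩ := exists_layer K (2 * K + 1)
  obtain ⟨C, m, hC, hb⟩ := hw.exists_force_bound
  obtain ⟨C', hC', hθ⟩ := exists_deriv_smoothTransition_le
  filter_upwards [eventually_admissible, eventually_increment_le C C' hC hC' m K] with l h hl
  rintro φ ⟨c, hφ⟩
  obtain ⟨P, rfl⟩ := c.exists_phase h
  refine ⟨addLayer w (P.stage h) φ, ?_, fun p hp => P.addLayer_eq_old h w hp,
    fun i k hik p hp => ?_, fun t ht => P.exists_large_deriv h hφ hw ht⟩
  · rw [HasLevel, ← levelS_pow_eight]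
    exact ⟨P.next h, P.flow_next h hφ hw⟩
  · refine (hb (P.stage h) φ (P.background h hφ) i k hik p hp).trans (le_trans ?_ hl)
    have := h.S_pos
    have := h.S'_pos
    have := P.deriv_cut_mul_amp_le h hθ p.2
    simp only [Phase.stage]
    gcongr

theorem dir_pow_linear (ℓ : ST →L[ℝ] ℝ) (C : ℝ) (n : ℕ) (v : ST) :
    dir v (fun p => C * ℓ p ^ (n + 1)) = fun p => C * (n + 1) * ℓ v * ℓ p ^ n := by
  funext p
  have h := ((ℓ.hasFDerivAt (x := p)).pow (n + 1)).const_mul C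
  rw [dir, h.fderiv]
  simp
  ring

/-- The linear form with constant coefficients `b1`, `b2`. -/
noncomputable def form (b1 b2 : ℝ) : ST →L[ℝ] ℝ :=
  (b1 • ContinuousLinearMap.fst ℝ ℝ ℝ + b2 • ContinuousLinearMap.snd ℝ ℝ ℝ).comp
    (ContinuousLinearMap.fst ℝ (ℝ × ℝ) ℝ)

theorem form_apply (b1 b2 : ℝ) (p : ST) : form b1 b2 p = b1 * p.1.1 + b2 * p.1.2 := by
  simp [form]

/-- A time independent potential with a density that is linear near the origin. -/
noncomputable def seed (χ : ℝ → ℝ) (C b1 b2 d1 d2 : ℝ) : ST → ℝ :=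
  fun p => C * form b1 b2 p ^ 3 * (χ (form b1 b2 p / 4) * χ (form d1 d2 p))

section seed
variable {χ : ℝ → ℝ} {C b1 b2 d1 d2 : ℝ}

theorem smooth_seed (hχ : Cut χ) : ContDiff ℝ ∞ (seed χ C b1 b2 d1 d2) := by
  have := hχ.smooth
  unfold seed
  fun_prop

theorem seed_eventuallyEq (h1 : ∀ y, |y| < 1 / 2 → χ y = 1) {p : ST} (hb : |form b1 b2 p| ≤ 1)
    (hd : |form d1 d2 p| ≤ 1 / 4) :
    seed χ C b1 b2 d1 d2 =ᶠ[𝓝 p] fun p => C * form b1 b2 p ^ (2 + 1) := by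
  have o1 : IsOpen {q : ST | |form b1 b2 q| < 2} := isOpen_lt (by fun_prop) continuous_const
  have o2 : IsOpen {q : ST | |form d1 d2 q| < 1 / 2} := isOpen_lt (by fun_prop) continuous_const
  filter_upwards [o1.mem_nhds (show |form b1 b2 p| < 2 by linarith),
    o2.mem_nhds (show |form d1 d2 p| < 1 / 2 by linarith)] with q hq1 hq2
  have hq1 : |form b1 b2 q| < 2 := hq1
  have : |form b1 b2 q / 4| < 1 / 2 := by
    rw [abs_div, abs_of_pos (by norm_num : (0 : ℝ) < 4)]
    linarith
  rw [seed, h1 _ this, h1 _ hq2]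
  ring

theorem vel1_seed (h1 : ∀ y, |y| < 1 / 2 → χ y = 1) {p : ST} (hb : |form b1 b2 p| ≤ 1)
    (hd : |form d1 d2 p| ≤ 1 / 4) :
    vel1 (seed χ C b1 b2 d1 d2) p = -(6 * C * b1 * b2 * form b1 b2 p) := by
  rw [(vel1_congr (seed_eventuallyEq h1 hb hd)).eq_of_nhds, vel1, dy, dir_pow_linear, dx,
    dir_pow_linear]
  simp only [form_apply]
  push_cast
  ring

theorem vel2_seed (h1 : ∀ y, |y| < 1 / 2 → χ y = 1) {p : ST} (hb : |form b1 b2 p| ≤ 1)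
    (hd : |form d1 d2 p| ≤ 1 / 4) :
    vel2 (seed χ C b1 b2 d1 d2) p = 6 * C * b1 ^ 2 * form b1 b2 p := by
  rw [(vel2_congr (seed_eventuallyEq h1 hb hd)).eq_of_nhds]
  simp only [vel2, dx]
  rw [dir_pow_linear, dir_pow_linear]
  simp only [form_apply]
  push_cast
  ring

theorem rho_seed (h1 : ∀ y, |y| < 1 / 2 → χ y = 1) {p : ST} (hb : |form b1 b2 p| ≤ 1)
    (hd : |form d1 d2 p| ≤ 1 / 4) : rho (seed χ C b1 b2 d1 d2) =ᶠ[𝓝 p]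
      fun p => -(6 * C * (b1 ^ 2 + b2 ^ 2)) * form b1 b2 p ^ (0 + 1) := by
  refine (rho_congr (seed_eventuallyEq h1 hb hd)).trans (Eventually.of_forall fun q => ?_)
  simp only [rho, dx, dy]
  rw [dir_pow_linear, dir_pow_linear, dir_pow_linear, dir_pow_linear]
  simp only [form_apply]
  push_cast
  ring

theorem dx_rho_seed (h1 : ∀ y, |y| < 1 / 2 → χ y = 1) {p : ST} (hb : |form b1 b2 p| ≤ 1)
    (hd : |form d1 d2 p| ≤ 1 / 4) :
    dx (rho (seed χ C b1 b2 d1 d2)) p = -(6 * C * (b1 ^ 2 + b2 ^ 2)) * b1 := by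
  rw [dx, (dir_congr (rho_seed h1 hb hd) _).eq_of_nhds, dir_pow_linear]
  simp [form_apply]

theorem dy_rho_seed (h1 : ∀ y, |y| < 1 / 2 → χ y = 1) {p : ST} (hb : |form b1 b2 p| ≤ 1)
    (hd : |form d1 d2 p| ≤ 1 / 4) :
    dy (rho (seed χ C b1 b2 d1 d2)) p = -(6 * C * (b1 ^ 2 + b2 ^ 2)) * b2 := by
  rw [dy, (dir_congr (rho_seed h1 hb hd) _).eq_of_nhds, dir_pow_linear]
  simp [form_apply]

end seed

/-- Coefficients that do not depend on time. -/
noncomputable def staticCoef {S ε Y : ℝ} (hS : 1 ≤ S) (hε : 0 < ε) (hY : 0 ≤ Y) : Coef S ε Y where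
  b1 _ := ε * S ^ 8
  b2 _ := S ^ 8
  d1 _ := S ^ 4
  d2 _ := 0
  a _ := S ^ 2 / S ^ 8
  g1 _ := 0
  g2 _ := 0
  D := S ^ 12
  smooth_b1 := contDiff_const
  smooth_b2 := contDiff_const
  smooth_d1 := contDiff_const
  smooth_d2 := contDiff_const
  smooth_a := contDiff_const
  smooth_g1 := contDiff_const
  smooth_g2 := contDiff_const
  det _ := by ring
  one_le_D := one_le_pow₀ hS
  D_le := pow_le_pow_right₀ hS (by norm_num)
  one_le_b2 _ _ := one_le_pow₀ hS
  b2_le _ _ := pow_le_pow_right₀ hS (by norm_num)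
  le_b1 _ _ := by gcongr; linarith
  b1_le _ _ := by gcongr; linarith
  le_a _ _ := by
    have : 0 < S := by linarith
    field_simp; norm_num
  a_le _ _ := by
    have : 0 < S := by linarith
    field_simp; norm_num
  deriv_b_le _ _ := by simp; positivity
  deriv_b2_le _ _ := by simp; positivity
  deriv_d_le _ _ := by simp; positivity
  g1_le _ _ := by simpa
  g2_le _ _ := by simpa
  d1_le _ _ := by
    rw [abs_of_nonneg (by positivity)]
    exact le_of_eq (by ring)
  d2_le _ _ := by simp; positivity
  deriv_d1_le _ _ := by simp; positivity
  deriv_d2_le _ _ := by simp; positivity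

theorem exists_static {S ε Y : ℝ} (hS : 10 ≤ S) (hε : 0 < ε) (hε1 : ε ≤ 1) (hY : 0 ≤ Y) :
    ∃ (c : Coef S ε Y) (φ : ST → ℝ), Flow c φ := by
  obtain ⟨χ, hχ, h1⟩ := exists_cut
  have hS0 : 0 < S := by linarith
  have hS1 : 1 ≤ S := by linarith
  have h4 : 100 ≤ S ^ 4 := by
    calc (100 : ℝ) ≤ 10 ^ 4 := by norm_num
      _ ≤ S ^ 4 := by gcongr
  have disc : ∀ p : ST, |form (ε * S ^ 8) (S ^ 8) p| ≤ 4 → |form (S ^ 4) 0 p| ≤ 1 →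
      p.1.1 ^ 2 + p.1.2 ^ 2 ≤ 1 := by
    intro p hb hd
    rw [form_apply] at hb hd
    have hx : |p.1.1| ≤ 1 / 100 := by
      rw [zero_mul, add_zero, abs_mul, abs_of_pos (pow_pos hS0 4)] at hd
      nlinarith [abs_nonneg p.1.1]
    have hy : |p.1.2| ≤ 1 / 2 := by
      have h8 : 100 ≤ S ^ 8 := h4.trans (pow_le_pow_right₀ hS1 (by norm_num))
      rw [show ε * S ^ 8 * p.1.1 + S ^ 8 * p.1.2 = S ^ 8 * (ε * p.1.1 + p.1.2) by ring, abs_mul,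
        abs_of_pos (pow_pos hS0 8)] at hb
      have h5 : |ε * p.1.1 + p.1.2| ≤ 1 / 25 := by nlinarith [abs_nonneg (ε * p.1.1 + p.1.2)]
      have h6 : |ε * p.1.1| ≤ 1 / 100 := by
        rw [abs_mul, abs_of_pos hε]
        nlinarith [abs_nonneg p.1.1]
      rw [abs_le] at *
      constructor <;> linarith
    rw [abs_le] at hx hy
    nlinarith
  set C : ℝ := -(S ^ 2 / S ^ 8 / (6 * ((ε * S ^ 8) ^ 2 + (S ^ 8) ^ 2))) with hC
  have hC' : -(6 * C * ((ε * S ^ 8) ^ 2 + (S ^ 8) ^ 2)) = S ^ 2 / S ^ 8 := by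
    rw [hC]; field_simp
  refine ⟨staticCoef hS1 hε hY, seed χ C (ε * S ^ 8) (S ^ 8) (S ^ 4) 0, smooth_seed hχ,
    fun p _ hp => ?_, fun p _ hb hd => ?_, fun p _ hb hd => ?_, fun p _ hb hd => ?_,
    fun p _ hb hd => ?_, fun p _ hb hd => ?_⟩
  · by_cases hb : |form (ε * S ^ 8) (S ^ 8) p| ≤ 4
    · have hd : 1 < |form (S ^ 4) 0 p| := by
        by_contra hd
        exact hp.not_ge (disc p hb (not_lt.1 hd))
      rw [seed, hχ.supp _ hd]; ring
    · have : 1 < |form (ε * S ^ 8) (S ^ 8) p / 4| := by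
        rw [abs_div, abs_of_pos (by norm_num : (0 : ℝ) < 4)]; linarith
      rw [seed, hχ.supp _ this]; ring
  all_goals
    simp only [lin, staticCoef] at hb hd ⊢
    rw [← form_apply] at hb hd
  · exact disc p (by linarith) (by linarith)
  · rw [dx_rho_seed h1 hb hd, hC']; ring
  · rw [dy_rho_seed h1 hb hd, hC']; ring
  · rw [vel1_seed h1 hb hd, vel2_seed h1 hb hd, deriv_const, deriv_const]; ring
  · rw [vel1_seed h1 hb hd, vel2_seed h1 hb hd, deriv_const, deriv_const, form_apply, hC]
    field_simp
    ring

theorem eventually_hasLevel : ∀ᶠ l : ℝ in atTop, ∃ φ, HasLevel l φ := by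
  filter_upwards [eventually_ge_atTop 10] with l hl
  have hl8 : 1 ≤ l ^ 8 := one_le_pow₀ (by linarith)
  have hS : 10 ≤ levelS l := by
    have := add_one_le_exp (l ^ 2 / 8)
    unfold levelS; nlinarith
  have hε : 0 < levelε l := by unfold levelε; positivity
  have hε1 : levelε l ≤ 1 := by unfold levelε; rw [div_le_one (by positivity)]; exact hl8
  obtain ⟨c, φ, h⟩ := exists_static (Y := exp l) hS hε hε1 (exp_pos l).le
  exact ⟨φ, c, h⟩

theorem dx_dy_iterate_force_eq_zero {φ : ST → ℝ}
    (h : ∀ p : ST, p.2 ≤ 1 → 1 < p.1.1 ^ 2 + p.1.2 ^ 2 → φ p = 0) (i j : ℕ) {p : ST} (hp : p.2 < 1)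
    (hx : 1 < p.1.1 ^ 2 + p.1.2 ^ 2) : dx^[i] (dy^[j] (force φ)) p = 0 := by
  have o : IsOpen ({q : ST | q.2 < 1} ∩ {q | 1 < q.1.1 ^ 2 + q.1.2 ^ 2}) :=
    (isOpen_lt (by fun_prop) continuous_const).inter (isOpen_lt continuous_const (by fun_prop))
  have h0 : force φ =ᶠ[𝓝 p] fun _ => 0 := by
    rw [← force_zero]
    refine force_congr ?_
    filter_upwards [o.mem_nhds ⟨hp, hx⟩] with q hq
    exact h q hq.1.le hq.2
  have iter (v : ST) (n : ℕ) {f : ST → ℝ} (hf : f =ᶠ[𝓝 p] fun _ => 0) :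
      (dir v)^[n] f =ᶠ[𝓝 p] fun _ => 0 := by
    induction n with
    | zero => exact hf
    | succ n ih =>
      rw [Function.iterate_succ_apply', ← dir_zero_fun v]
      exact dir_congr ih v
  exact (iter _ i (iter _ j h0)).eq_of_nhds

theorem exists_force_bound_of_supp {φ : ST → ℝ} (hφ : ContDiff ℝ ∞ φ)
    (h : ∀ p : ST, p.2 ≤ 1 → 1 < p.1.1 ^ 2 + p.1.2 ^ 2 → φ p = 0) (i j : ℕ) :
    ∃ M, ∀ t ∈ Set.Ico (0 : ℝ) 1, ∀ x, |dx^[i] (dy^[j] (force φ)) (x, t)| ≤ M := by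
  have hs : ContDiff ℝ ∞ (dx^[i] (dy^[j] (force φ))) :=
    contDiff_dx_iterate (contDiff_dy_iterate (contDiff_force hφ) j) i
  obtain ⟨M, hM⟩ := (isCompact_disc.prod (isCompact_Icc (a := (0 : ℝ)) (b := 1))).exists_bound_of_continuousOn
    hs.continuous.continuousOn
  refine ⟨max M 0, fun t ht x => ?_⟩
  rcases le_or_gt (x.1 ^ 2 + x.2 ^ 2) 1 with hx | hx
  · exact (hM (x, t) ⟨hx, ht.1, ht.2.le⟩).trans (le_max_left _ _)
  · rw [dx_dy_iterate_force_eq_zero h i j (p := (x, t)) ht.2 hx, abs_zero]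
    exact le_max_right _ _

/-- A sequence of potentials with increments bounded in more and more derivatives. -/
theorem exists_chain : ∃ (l : ℕ → ℝ) (κ : ℕ → ℕ) (φ : ℕ → ST → ℝ),
    (∀ n, 1 ≤ l n) ∧ Monotone l ∧ (∀ n, (2 : ℝ) ^ n ≤ l n) ∧ Tendsto κ atTop atTop ∧
    (∀ n, HasLevel (l n) (φ n)) ∧
    (∀ n, ∀ p : ST, p.2 ≤ 1 - 1 / levelS (l n) → φ (n + 1) p = φ n p) ∧
    (∀ n i k, i + k ≤ κ n → ∀ p : ST, p.2 ≤ 1 →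
      |dx^[i] (dy^[k] (force (φ (n + 1)))) p - dx^[i] (dy^[k] (force (φ n))) p| ≤ 1 / l n) ∧
    ∀ n, ∀ t ∈ Set.Icc (1 - 1 / levelS (l n)) 1,
      ∃ x, levelS (l n) / 4 ≤ |dy (rho (φ (n + 1))) (x, t)| := by
  choose L hL using fun K => eventually_atTop.1 (exists_next K)
  obtain ⟨L', hL'⟩ := eventually_atTop.1 eventually_hasLevel
  set l0 : ℝ := max 2 (max (L 0) L') with hl0
  have h2 : 2 ≤ l0 := le_max_left _ _
  set l : ℕ → ℝ := fun n => l0 ^ 2 ^ n with hl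
  have hsq (n : ℕ) : l (n + 1) = l n ^ 2 := by simp only [hl]; rw [pow_succ, pow_mul]
  have hmono : Monotone l := fun m n h =>
    pow_le_pow_right₀ (by linarith) (Nat.pow_le_pow_right (by norm_num) h)
  have hl_zero : l 0 = l0 := by simp [hl]
  have hlow (n : ℕ) : (2 : ℝ) ^ n ≤ l n :=
    (pow_le_pow_right₀ (by norm_num) n.lt_two_pow_self.le).trans
      (pow_le_pow_left₀ (by norm_num) h2 _)
  have htop : Tendsto l atTop atTop :=
    tendsto_atTop_mono hlow (tendsto_pow_atTop_atTop_of_one_lt (by norm_num))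
  classical
  set κ : ℕ → ℕ := fun n => Nat.findGreatest (fun j => L j ≤ l n) n with hκ
  have hκL (n : ℕ) : L (κ n) ≤ l n := by
    refine Nat.findGreatest_spec (P := fun j => L j ≤ l n) (Nat.zero_le n) ?_
    exact ((le_max_left _ _).trans (le_max_right _ _)).trans (hl_zero ▸ hmono (Nat.zero_le n))
  have hκtop : Tendsto κ atTop atTop := by
    refine tendsto_atTop.2 fun K => ?_
    filter_upwards [eventually_ge_atTop K, htop.eventually_ge_atTop (L K)] with n h1 h2
    exact Nat.le_findGreatest h1 h2
  choose f hf using fun n φ (h : HasLevel (l n) φ) => hL (κ n) (l n) (hκL n) φ h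
  obtain ⟨φ0, hφ0⟩ := hL' (l 0) (hl_zero ▸ (le_max_right _ _).trans (le_max_right _ _))
  let s : ∀ n, {φ : ST → ℝ // HasLevel (l n) φ} := fun n => Nat.rec ⟨φ0, hφ0⟩
    (fun n s => ⟨f n s.1 s.2, by rw [hsq]; exact (hf n s.1 s.2).1⟩) n
  exact ⟨l, κ, fun n => (s n).1, fun n => (one_le_pow₀ (by norm_num)).trans (hlow n), hmono, hlow,
    hκtop, fun n => (s n).2, fun n => (hf n (s n).1 (s n).2).2.1,
    fun n => (hf n (s n).1 (s n).2).2.2.1, fun n => (hf n (s n).1 (s n).2).2.2.2⟩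

theorem exists_bound_of_increments {X : Type*} {g : ℕ → X → ℝ} (hg : ∀ n, ∃ M, ∀ x, |g n x| ≤ M)
    (h : ∀ᶠ n in atTop, ∀ x, |g (n + 1) x - g n x| ≤ (1 / 2) ^ n) :
    ∃ M, ∀ n x, |g n x| ≤ M := by
  choose M hM using hg
  obtain ⟨N, hN⟩ := eventually_atTop.1 h
  have key (m : ℕ) (x : X) : |g (N + m) x| ≤ M N + 2 - 2 * (1 / 2) ^ m := by
    induction m with
    | zero => simpa using hM N x
    | succ m ih =>
      have h1 := hN (N + m) (Nat.le_add_right _ _) x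
      have h2 : (1 / 2 : ℝ) ^ (N + m) ≤ (1 / 2) ^ m :=
        pow_le_pow_of_le_one (by norm_num) (by norm_num) (Nat.le_add_left _ _)
      have h3 := abs_sub_abs_le_abs_sub (g (N + m + 1) x) (g (N + m) x)
      rw [pow_succ, ← add_assoc]
      linarith
  refine ⟨(∑ n ∈ Finset.range N, |M n|) + |M N| + 2, fun n x => ?_⟩
  have hs : 0 ≤ ∑ n ∈ Finset.range N, |M n| := Finset.sum_nonneg fun _ _ => abs_nonneg _
  rcases lt_or_ge n N with hn | hn
  · have h1 := Finset.single_le_sum (f := fun n => |M n|) (fun _ _ => abs_nonneg _)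
      (Finset.mem_range.2 hn)
    have h2 := hM n x
    have h3 := le_abs_self (M n)
    have h4 := abs_nonneg (M N)
    linarith
  · obtain ⟨m, rfl⟩ := Nat.exists_eq_add_of_le hn
    have h1 := key m x
    have h2 : (0 : ℝ) < (1 / 2) ^ m := by positivity
    have h3 := le_abs_self (M N)
    linarith

theorem le_levelS {l : ℝ} (hl : 1 ≤ l) : l / 8 ≤ levelS l := by
  have := add_one_le_exp (l ^ 2 / 8)
  unfold levelS
  nlinarith

theorem levelS_mono {l l' : ℝ} (hl : 1 ≤ l) (h : l ≤ l') : levelS l ≤ levelS l' := by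
  unfold levelS
  gcongr

end IPM

/-- Finite-time blowup for the IPM equation with a smooth compactly supported source. -/
theorem ipm_finite_time_blowup :
    ∃ (ρ₀ : ℝ × ℝ → ℝ) (ρ P F : (ℝ × ℝ) × ℝ → ℝ) (u : (ℝ × ℝ) × ℝ → ℝ × ℝ),
      -- `ρ₀ ∈ C_c^∞(ℝ²)`
      ContDiff ℝ (⊤ : ℕ∞) ρ₀ ∧ HasCompactSupport ρ₀ ∧
      -- each `F(·,t)` is `C^∞`, supported in the closed unit ball
      (∀ t ∈ Set.Ico (0 : ℝ) 1, ContDiff ℝ (⊤ : ℕ∞) (fun x => F (x, t))) ∧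
      (∀ t ∈ Set.Ico (0 : ℝ) 1, ∀ x : ℝ × ℝ, F (x, t) ≠ 0 → x.1 ^ 2 + x.2 ^ 2 ≤ 1) ∧
      -- uniform-in-time bound on every `C^k` norm of the source
      (∀ k : ℕ, ∃ M : ℝ, ∀ t ∈ Set.Ico (0 : ℝ) 1, CkNorm k (fun x => F (x, t)) ≤ M) ∧
      -- `ρ, u, P` are smooth on `ℝ² × [0,1)`
      ContDiffOn ℝ (⊤ : ℕ∞) ρ spaceTime ∧ ContDiffOn ℝ (⊤ : ℕ∞) u spaceTime ∧ ContDiffOn ℝ (⊤ : ℕ∞) P spaceTime ∧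
      -- initial datum
      (∀ x : ℝ × ℝ, ρ (x, 0) = ρ₀ x) ∧
      -- each `ρ(·,t)` is compactly supported and `u(·,t)` is square integrable
      (∀ t ∈ Set.Ico (0 : ℝ) 1, HasCompactSupport (fun x => ρ (x, t))) ∧
      (∀ t ∈ Set.Ico (0 : ℝ) 1, Integrable (fun x : ℝ × ℝ => ‖u (x, t)‖ ^ 2)) ∧
      -- the IPM system: transport equation, Darcy's law, incompressibility
      (∀ x : ℝ × ℝ, ∀ t ∈ Set.Ico (0 : ℝ) 1,
        fderivWithin ℝ ρ spaceTime (x, t) ((0, 0), 1)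
            + (u (x, t)).1 * fderivWithin ℝ ρ spaceTime (x, t) ((1, 0), 0)
            + (u (x, t)).2 * fderivWithin ℝ ρ spaceTime (x, t) ((0, 1), 0) = F (x, t) ∧
        (u (x, t)).1 = -fderivWithin ℝ P spaceTime (x, t) ((1, 0), 0) ∧
        (u (x, t)).2 = -fderivWithin ℝ P spaceTime (x, t) ((0, 1), 0) - ρ (x, t) ∧
        (fderivWithin ℝ u spaceTime (x, t) ((1, 0), 0)).1
            + (fderivWithin ℝ u spaceTime (x, t) ((0, 1), 0)).2 = 0) ∧
      -- blow-up of the `C¹` norm as `t → 1⁻`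
      Tendsto (fun t => CkNorm 1 (fun x => ρ (x, t)))
        (nhdsWithin (1 : ℝ) (Set.Iio 1)) atTop := by
  obtain ⟨l, κ, φ, h1, hm, hlow, hκ, hφ, hst, hinc, hgrow⟩ := IPM.exists_chain
  have htop : Tendsto l atTop atTop :=
    tendsto_atTop_mono hlow (tendsto_pow_atTop_atTop_of_one_lt (by norm_num))
  have hStop : Tendsto (fun n => IPM.levelS (l n)) atTop atTop :=
    tendsto_atTop_mono (fun n => IPM.le_levelS (h1 n)) (htop.atTop_div_const (by norm_num))
  have hsmooth (n : ℕ) : ContDiff ℝ (⊤ : ℕ∞) (φ n) := (hφ n).choose_spec.smooth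
  have hsupp (n : ℕ) := (hφ n).choose_spec.supp
  exact IPM.blowup_of_chain φ (fun n => 1 - 1 / IPM.levelS (l n)) hsmooth
    (fun m n h => sub_le_sub_left (one_div_le_one_div_of_le (IPM.levelS_pos _)
      (IPM.levelS_mono (h1 m) (hm h))) 1)
    (by simpa using (tendsto_inv_atTop_zero.comp hStop).const_sub 1)
    (fun n => sub_lt_self 1 (one_div_pos.2 (IPM.levelS_pos _)))
    (fun n x t ht => hst n (x, t) ht) (fun n x t ht hx => hsupp n (x, t) ht hx)
    (fun i j => by
      obtain ⟨M, hM⟩ := IPM.exists_bound_of_increments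
        (g := fun n (q : (ℝ × ℝ) × Set.Ico (0 : ℝ) 1) =>
          (IPM.dx^[i] (IPM.dy^[j] (IPM.force (φ n)))) (q.1, q.2.1))
        (fun n => by
          obtain ⟨M, hM⟩ := IPM.exists_force_bound_of_supp (hsmooth n) (hsupp n) i j
          exact ⟨M, fun q => hM q.2.1 q.2.2 q.1⟩)
        (by
          filter_upwards [hκ.eventually_ge_atTop (i + j)] with n hn q
          refine (hinc n i j hn (q.1, q.2.1) q.2.2.2.le).trans ?_
          rw [one_div_pow]
          exact one_div_le_one_div_of_le (by positivity) (hlow n))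
      exact ⟨M, fun n t ht x => hM n (x, ⟨t, ht⟩)⟩)
    (fun B => by
      filter_upwards [hStop.eventually_ge_atTop (4 * B)] with n hn t ht
      obtain ⟨x, hx⟩ := hgrow n t ⟨ht.1, ht.2.le⟩
      exact ⟨x, by linarith⟩)
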